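/- arXiv:1002.0969 — 3 statements merged into one kernel-verified Lean document; each statement's English description precedes it below -/
import Mathlib

section
/- Let χ = 0 and λ ∈ F_p. Then Ext(V_0(λ), S), taken in the category of restricted W-modules (U_0(W)-modules), is isomorphic to K if λ ∈ {0, p-3, p-4, p-5}, and is 0 otherwise. -/
/-!
Common setup: the Witt algebra `W` over `K` (char `p > 3`) has basis
`e_{-1}, e_0, ..., e_{p-2}` with `[e_i, e_j] = (j-i) e_{i+j}` (and `e_k = 0`
outside the range), and `p`-mapping `e_i^{[p]} = δ_{i0} e_i`.  A module with
`p`-character `χ` over `W` (resp. the subalgebra `W_0 = <e_0, ..., e_{p-2}>`)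
is given by a family of endomorphisms `ρ k` (`k : ℤ`, vanishing outside
`[lo, p-2]` where `lo = -1` for `W` and `lo = 0` for `W_0`) satisfying the
bracket relations and `(ρ i)^p - δ_{i0} ρ i = χ(e_i)^p • 1`.

The Baer Ext space `Ext(N, M)` of two such modules, in the category of
modules with `p`-character `χ`, is realized concretely: an extension
`0 → M → E → N → 0` admits a linear splitting `E ≃ M ⊕ N`, under which the
action of `e_k` is `(m, n) ↦ (ρM k m + c k n, ρN k n)` for a "cocycle"
`c : ℤ → (N →ₗ M)`; the conditions for `E` to be a module with `p`-character
`χ` are the cocycle conditions below, Baer equivalence corresponds to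
differing by a coboundary, and the Baer sum / scalar action correspond to the
linear structure on cocycles.  So `Ext(N, M) ≅ cocycles / coboundaries`.
-/

set_option maxHeartbeats 1000000
set_option synthInstance.maxHeartbeats 1000000

noncomputable section

/-- The coefficient `(-1)^j · (i!/(i-j)!) · ((j+1)λ - i + j)` of the action
`e_j · v_i = (coefficient) · v_{i-j}` on the reduced Verma module; it vanishes
for `j > i` since then `Nat.descFactorial i j = 0`. -/
def wCoef (K : Type) [Field K] (lam : K) (j i : ℕ) : K :=
  (-1 : K) ^ j * (Nat.descFactorial i j : K) * (((j : K) + 1) * lam - (i : K) + (j : K))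

/-- Matrices (in the basis `v_0, ..., v_{p-1}`) of the generators `e_j`
(`j : ℤ`) acting on the reduced Verma module `V_χ(λ)`; here `c = χ(e_{-1})^p`.
`e_{-1} v_i = v_{i+1}` for `i < p-1`, `e_{-1} v_{p-1} = c v_0`, and for
`0 ≤ j ≤ p-2`, `e_j v_i = (-1)^j (i!/(i-j)!) ((j+1)λ - i + j) v_{i-j}`. -/
def vermaMat (K : Type) [Field K] (p : ℕ) (c lam : K) : ℤ → Matrix (Fin p) (Fin p) K :=
  fun j =>
    if j = -1 then
      Matrix.of fun k l =>
        if (k : ℕ) = (l : ℕ) + 1 then 1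
        else if (k : ℕ) = 0 ∧ (l : ℕ) = p - 1 then c else 0
    else if 0 ≤ j ∧ j ≤ (p : ℤ) - 2 then
      Matrix.of fun k l =>
        if (l : ℕ) = (k : ℕ) + j.toNat then wCoef K lam j.toNat (l : ℕ) else 0
    else 0

/-- The action of the basis elements `e_j` (`j : ℤ`) on the reduced Verma
module `V_χ(λ)`, with `c = χ(e_{-1})^p`. -/
def vermaRho (K : Type) [Field K] (p : ℕ) (c lam : K) : ℤ → Module.End K (Fin p → K) :=
  fun j => Matrix.toLin' (vermaMat K p c lam j)

/-- The one-dimensional `W_0`-module `K_λ`: `e_0` acts by `λ`, all other `e_j` act by `0`. -/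
def oneDimRho (K : Type) [Field K] (lam : K) : ℤ → Module.End K K :=
  fun j => if j = 0 then lam • (1 : Module.End K K) else 0

/-- The one-dimensional trivial module: every basis element acts by `0`. -/
def trivRho (K : Type) [Field K] : ℤ → Module.End K K := fun _ => 0

/-- The coefficient `(-1)^(j+1) · ((i+1)!/(i-j)!)` of the action
`e_j · u_i = (coefficient) · u_{i-j}` on the `(p-1)`-dimensional simple module `S`. -/
def sCoef (K : Type) [Field K] (j i : ℕ) : K :=
  (-1 : K) ^ (j + 1) * (Nat.descFactorial (i + 1) (j + 1) : K)

/-- Matrices (in the basis `u_0, ..., u_{p-2}`) of the generators `e_j` acting on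
the `(p-1)`-dimensional simple restricted module `S = V_0(p-1)/Soc(V_0(p-1))`. -/
def sMat (K : Type) [Field K] (p : ℕ) : ℤ → Matrix (Fin (p - 1)) (Fin (p - 1)) K :=
  fun j =>
    if j = -1 then
      Matrix.of fun k l => if (k : ℕ) = (l : ℕ) + 1 then 1 else 0
    else if 0 ≤ j ∧ j ≤ (p : ℤ) - 2 then
      Matrix.of fun k l =>
        if (l : ℕ) = (k : ℕ) + j.toNat then sCoef K j.toNat (l : ℕ) else 0
    else 0

/-- The action of the basis elements `e_j` on the simple module `S`. -/
def sRho (K : Type) [Field K] (p : ℕ) : ℤ → Module.End K (Fin (p - 1) → K) :=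
  fun j => Matrix.toLin' (sMat K p j)

section ExtSpace

variable (K : Type) [Field K] (M N : Type) [AddCommGroup M] [Module K M]
  [AddCommGroup N] [Module K N]

/-- Constraint: a cocycle vanishes outside the index range `[lo, p-2]`. -/
def suppConstraint (p : ℕ) (lo k : ℤ) : (ℤ → N →ₗ[K] M) →ₗ[K] (N →ₗ[K] M) :=
  if k < lo ∨ (p : ℤ) - 2 < k then LinearMap.proj k else 0

variable {M N}

/-- Constraint on a cocycle coming from the bracket relation
`[e_i, e_j] = (j - i) e_{i+j}`:
`(j-i) c(i+j) = ρM i ∘ c j + c i ∘ ρN j - ρM j ∘ c i - c j ∘ ρN i`. -/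
def bracketConstraint (p : ℕ) (lo : ℤ) (ρM : ℤ → Module.End K M)
    (ρN : ℤ → Module.End K N) (i j : ℤ) :
    (ℤ → N →ₗ[K] M) →ₗ[K] (N →ₗ[K] M) :=
  if lo ≤ i ∧ i ≤ (p : ℤ) - 2 ∧ lo ≤ j ∧ j ≤ (p : ℤ) - 2 then
    ((j - i : ℤ) : K) • LinearMap.proj (i + j)
      - LinearMap.llcomp K N M M (ρM i) ∘ₗ LinearMap.proj j
      - LinearMap.lcomp K M (ρN j) ∘ₗ LinearMap.proj i
      + LinearMap.llcomp K N M M (ρM j) ∘ₗ LinearMap.proj i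
      + LinearMap.lcomp K M (ρN i) ∘ₗ LinearMap.proj j
  else 0

/-- Constraint on a cocycle expressing that the extension has `p`-character `χ`:
on the extension `E = M ⊕ N` the `(N → M)`-component of `(e_i)^p` is
`∑_{k<p} (ρM i)^k ∘ c i ∘ (ρN i)^(p-1-k)`, and this must agree with the
`(N → M)`-component of `e_i^{[p]} + χ(e_i)^p • 1`, which is `δ_{i0} c i`
(the scalar `χ(e_i)^p` contributes nothing off the diagonal, and the diagonal
blocks hold since `M`, `N` have `p`-character `χ`). -/
def pcharConstraint (p : ℕ) (lo : ℤ) (ρM : ℤ → Module.End K M)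
    (ρN : ℤ → Module.End K N) (i : ℤ) :
    (ℤ → N →ₗ[K] M) →ₗ[K] (N →ₗ[K] M) :=
  if lo ≤ i ∧ i ≤ (p : ℤ) - 2 then
    (∑ k ∈ Finset.range p,
        LinearMap.llcomp K N M M ((ρM i) ^ k) ∘ₗ
          LinearMap.lcomp K M ((ρN i) ^ (p - 1 - k)) ∘ₗ LinearMap.proj i)
      - (if i = 0 then (LinearMap.proj 0 : (ℤ → N →ₗ[K] M) →ₗ[K] (N →ₗ[K] M)) else 0)
  else 0

/-- The space of cocycles: families `c : ℤ → (N →ₗ M)` (the values of a linear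
map `W → Hom(N, M)` on the basis, `lo = -1` for `W` and `lo = 0` for `W_0`)
such that `M ⊕ N` with action `e_k (m, n) = (ρM k m + c k n, ρN k n)` is a
module with `p`-character `χ`. -/
def cocycles (p : ℕ) (lo : ℤ) (ρM : ℤ → Module.End K M) (ρN : ℤ → Module.End K N) :
    Submodule K (ℤ → N →ₗ[K] M) :=
  (⨅ k : ℤ, LinearMap.ker (suppConstraint K M N p lo k)) ⊓
    (⨅ i : ℤ, ⨅ j : ℤ, LinearMap.ker (bracketConstraint K p lo ρM ρN i j)) ⊓
    (⨅ i : ℤ, LinearMap.ker (pcharConstraint K p lo ρM ρN i))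

/-- The coboundaries: cocycles of the form `k ↦ ρM k ∘ f - f ∘ ρN k` for a
linear map `f : N → M`; these are exactly the cocycles of split extensions,
and two cocycles give Baer-equivalent extensions iff they differ by a
coboundary. -/
def coboundaries (p : ℕ) (lo : ℤ) (ρM : ℤ → Module.End K M) (ρN : ℤ → Module.End K N) :
    Submodule K (ℤ → N →ₗ[K] M) :=
  LinearMap.range (LinearMap.pi fun k : ℤ =>
    if lo ≤ k ∧ k ≤ (p : ℤ) - 2 then
      LinearMap.llcomp K N M M (ρM k) - LinearMap.lcomp K M (ρN k)
    else 0)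

/-- The Baer Ext space `Ext(N, M)` in the category of modules with
`p`-character `χ` (over `W` if `lo = -1`, over `W_0` if `lo = 0`), realized
as cocycles modulo coboundaries. -/
abbrev extSpace (p : ℕ) (lo : ℤ) (ρM : ℤ → Module.End K M) (ρN : ℤ → Module.End K N) :=
  (cocycles K p lo ρM ρN) ⧸
    (Submodule.comap (cocycles K p lo ρM ρN).subtype (coboundaries K p lo ρM ρN))

end ExtSpace

end

section DensityModules

variable {K : Type} [Field K]

/-- The `i`-th standard basis vector of `K^q`, which is `0` for `i ≥ q`. -/
def basisVec (K : Type) [Field K] (q i : ℕ) : Fin q → K := fun k => if (k : ℕ) = i then 1 else 0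

lemma basisVec_eq_zero {q i : ℕ} (h : q ≤ i) : basisVec K q i = 0 := by
  funext k
  have := k.2
  simp only [basisVec, Pi.zero_apply, ite_eq_right_iff]
  omega

lemma basisVec_ne_zero {q i : ℕ} (h : i < q) : basisVec K q i ≠ 0 := by
  intro h0
  have := congrFun h0 ⟨i, h⟩
  simp [basisVec] at this

lemma basisVec_val {q : ℕ} (i : Fin q) : basisVec K q i = Pi.single i 1 := by
  funext k
  simp [basisVec, Pi.single_apply, Fin.ext_iff]

lemma linearMap_ext_basisVec {q : ℕ} {M : Type} [AddCommGroup M] [Module K M]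
    {f g : (Fin q → K) →ₗ[K] M}
    (h : ∀ i < q, f (basisVec K q i) = g (basisVec K q i)) : f = g := by
  refine (Pi.basisFun K (Fin q)).ext fun i => ?_
  simpa [basisVec_val] using h i i.2

lemma exists_linearMap_basisVec {M : Type} [AddCommGroup M] [Module K M] (q : ℕ) (g : ℕ → M) :
    ∃ f : (Fin q → K) →ₗ[K] M, ∀ i < q, f (basisVec K q i) = g i := by
  refine ⟨(Pi.basisFun K (Fin q)).constr K fun i => g i, fun i hi => ?_⟩
  have h := (Pi.basisFun K (Fin q)).constr_basis K (fun i : Fin q => g i) ⟨i, hi⟩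
  rw [Pi.basisFun_apply, ← basisVec_val] at h
  exact h

lemma toLin'_basisVec {q : ℕ} (A : Matrix (Fin q) (Fin q) K) (i : Fin q) :
    Matrix.toLin' A (basisVec K q i) = fun k => A k i := by
  rw [basisVec_val, Matrix.toLin'_apply, Matrix.mulVec_single_one]
  rfl

/-- A family of operators on `K^q` acting on the standard basis by the formulas of the tensor
density module of weight `μ`. -/
structure IsDensityRep (p q : ℕ) (μ : K) (ρ : ℤ → Module.End K (Fin q → K)) : Prop where
  shift : ∀ i, ρ (-1) (basisVec K q i) = basisVec K q (i + 1)
  lower : ∀ j i : ℕ, j + 2 ≤ p → i < q →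
    ρ j (basisVec K q i) = wCoef K μ j i • basisVec K q (i - j)
  supp : ∀ k : ℤ, k < -1 ∨ (p : ℤ) - 2 < k → ρ k = 0
  top : ∀ j : ℕ, j + 2 ≤ p → wCoef K μ j q • basisVec K q (q - j) = 0

lemma sCoef_eq_wCoef (j i : ℕ) : sCoef K j i = wCoef K (-1) j i := by
  simp only [sCoef, wCoef, Nat.succ_descFactorial_succ]
  push_cast
  ring

lemma wCoef_of_lt (μ : K) {j i : ℕ} (h : i < j) : wCoef K μ j i = 0 := by
  simp [wCoef, Nat.descFactorial_of_lt h]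

lemma wCoef_sub_wCoef_succ (μ : K) (j i : ℕ) :
    wCoef K μ (j + 1) i - wCoef K μ (j + 1) (i + 1) = ((j : K) + 2) * wCoef K μ j i := by
  have h1 : ((Nat.descFactorial i (j + 1) : ℕ) : K)
      = ((i : K) - j) * (Nat.descFactorial i j : ℕ) := by
    rcases le_or_gt j i with h | h
    · rw [Nat.descFactorial_succ]; push_cast [h]; ring
    · rw [Nat.descFactorial_of_lt h, Nat.descFactorial_of_lt (by omega)]; simp
  simp only [wCoef, Nat.succ_descFactorial_succ, h1]
  push_cast
  ring

lemma isDensityRep_vermaRho (p : ℕ) [CharP K p] (hp : 3 < p) (μ : K) :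
    IsDensityRep p p μ (vermaRho K p 0 μ) where
  shift i := by
    rcases lt_or_ge i p with hi | hi
    · have := toLin'_basisVec (vermaMat K p 0 μ (-1)) ⟨i, hi⟩
      rw [vermaRho, this]
      funext k
      simp [vermaMat, basisVec]
    · rw [basisVec_eq_zero hi, basisVec_eq_zero (by omega), map_zero]
  lower j i hj hi := by
    have := toLin'_basisVec (vermaMat K p 0 μ j) ⟨i, hi⟩
    rw [vermaRho, this]
    funext k
    have h1 : ¬ ((j : ℤ) = -1) := by omega
    have h2 : (0 : ℤ) ≤ j ∧ (j : ℤ) ≤ (p : ℤ) - 2 := by omega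
    simp only [vermaMat, h1, if_false, if_pos h2, Matrix.of_apply, Int.toNat_natCast,
      Pi.smul_apply, basisVec, smul_eq_mul, mul_ite, mul_one, mul_zero]
    rcases lt_or_ge i j with h | h
    · rw [wCoef_of_lt _ h]; simp
    · congr 1
      simp only [eq_iff_iff]
      omega
  supp k hk := by
    have h1 : ¬ (k = -1) := by omega
    have h2 : ¬ (0 ≤ k ∧ k ≤ (p : ℤ) - 2) := by omega
    simp [vermaRho, vermaMat, h1, h2]
  top j hj := by
    rcases j with _ | j
    · rw [basisVec_eq_zero (by omega), smul_zero]
    · have : ((Nat.descFactorial p (j + 1) : ℕ) : K) = 0 := by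
        obtain ⟨q, rfl⟩ : ∃ q, p = q + 1 := ⟨p - 1, by omega⟩
        rw [Nat.succ_descFactorial_succ, Nat.cast_mul, CharP.cast_eq_zero, zero_mul]
      rw [wCoef, this, mul_zero, zero_mul, zero_smul]

lemma isDensityRep_sRho (p : ℕ) [CharP K p] (hp : 3 < p) :
    IsDensityRep p (p - 1) (-1 : K) (sRho K p) where
  shift i := by
    rcases lt_or_ge i (p - 1) with hi | hi
    · have := toLin'_basisVec (sMat K p (-1)) ⟨i, hi⟩
      rw [sRho, this]
      funext k
      simp [sMat, basisVec]
    · rw [basisVec_eq_zero hi, basisVec_eq_zero (by omega), map_zero]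
  lower j i hj hi := by
    have := toLin'_basisVec (sMat K p j) ⟨i, hi⟩
    rw [sRho, this]
    funext k
    have h1 : ¬ ((j : ℤ) = -1) := by omega
    have h2 : (0 : ℤ) ≤ j ∧ (j : ℤ) ≤ (p : ℤ) - 2 := by omega
    simp only [sMat, h1, if_false, if_pos h2, Matrix.of_apply, Int.toNat_natCast,
      Pi.smul_apply, basisVec, smul_eq_mul, mul_ite, mul_one, mul_zero, sCoef_eq_wCoef]
    rcases lt_or_ge i j with h | h
    · rw [wCoef_of_lt _ h]; simp
    · congr 1
      simp only [eq_iff_iff]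
      omega
  supp k hk := by
    have h1 : ¬ (k = -1) := by omega
    have h2 : ¬ (0 ≤ k ∧ k ≤ (p : ℤ) - 2) := by omega
    simp [sRho, sMat, h1, h2]
  top j hj := by
    have h1 : p - 1 + 1 = p := by omega
    rw [← sCoef_eq_wCoef, sCoef, h1]
    obtain ⟨q, rfl⟩ : ∃ q, p = q + 1 := ⟨p - 1, by omega⟩
    rw [Nat.succ_descFactorial_succ, Nat.cast_mul, CharP.cast_eq_zero, zero_mul, mul_zero,
      zero_smul]

namespace IsDensityRep

variable {p q : ℕ} {μ : K} {ρ : ℤ → Module.End K (Fin q → K)}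

lemma lower_le (h : IsDensityRep p q μ ρ) {j i : ℕ} (hj : j + 2 ≤ p) (hi : i ≤ q) :
    ρ j (basisVec K q i) = wCoef K μ j i • basisVec K q (i - j) := by
  rcases hi.lt_or_eq with hi | rfl
  · exact h.lower j i hj hi
  · rw [h.top j hj, basisVec_eq_zero le_rfl, map_zero]

lemma shift_pow (h : IsDensityRep p q μ ρ) (a i : ℕ) :
    (ρ (-1) ^ a) (basisVec K q i) = basisVec K q (i + a) := by
  induction a with
  | zero => simp
  | succ a ih => rw [pow_succ', Module.End.mul_apply, ih, h.shift, add_assoc]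

lemma shift_pow_eq_zero (h : IsDensityRep p q μ ρ) {a : ℕ} (ha : q ≤ a) : ρ (-1) ^ a = 0 :=
  linearMap_ext_basisVec fun i _ => by
    rw [h.shift_pow, basisVec_eq_zero (by omega), LinearMap.zero_apply]

/-- The relations `[e_{-1}, e_k] = (k + 1) e_{k - 1}`. -/
lemma comm_shift [CharP K p] (h : IsDensityRep p q μ ρ) (k : ℤ) :
    ρ (-1) ∘ₗ ρ k - ρ k ∘ₗ ρ (-1) = ((k : K) + 1) • ρ (k - 1) := by
  rcases lt_trichotomy k (-1) with hk | rfl | hk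
  · rw [h.supp k (by omega), h.supp (k - 1) (by omega)]; simp
  · simp
  · rcases lt_or_ge ((p : ℤ) - 2) k with hk2 | hk2
    · rw [h.supp k (Or.inr hk2)]
      rcases eq_or_ne k ((p : ℤ) - 1) with rfl | hk3
      · simp
      · rw [h.supp (k - 1) (by omega)]; simp
    · obtain ⟨j, rfl⟩ : ∃ j : ℕ, k = j := ⟨k.toNat, by omega⟩
      refine linearMap_ext_basisVec fun i hi => ?_
      simp only [LinearMap.sub_apply, LinearMap.comp_apply, LinearMap.smul_apply, Int.cast_natCast]
      rw [h.lower_le (by omega) hi.le, h.shift, h.lower_le (by omega) hi, map_smul, h.shift]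
      rcases j with _ | j
      · simp only [CharP.cast_eq_zero, zero_sub, h.shift, Nat.sub_zero, ← sub_smul]
        congr 1
        simp [wCoef]
      · rw [show ((j + 1 : ℕ) : ℤ) - 1 = (j : ℕ) by omega, h.lower_le (by omega) hi.le, smul_smul]
        rcases lt_trichotomy i j with hij | rfl | hij
        · rw [wCoef_of_lt _ (by omega), wCoef_of_lt _ (by omega), wCoef_of_lt _ hij]; simp
        · have := wCoef_sub_wCoef_succ μ i i
          rw [wCoef_of_lt μ (Nat.lt_succ_self i)] at this ⊢
          simp only [zero_smul, Nat.sub_self, zero_sub, ← neg_smul] at this ⊢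
          rw [this]; congr 1; push_cast; ring
        · rw [show i - (j + 1) + 1 = i - j by omega, Nat.succ_sub_succ, ← sub_smul,
            wCoef_sub_wCoef_succ]
          congr 1; push_cast; ring

lemma shift_apply [CharP K p] (h : IsDensityRep p q μ ρ) (k : ℤ) (y : Fin q → K) :
    ρ (-1) (ρ k y) = ρ k (ρ (-1) y) + ((k : K) + 1) • ρ (k - 1) y := by
  have := LinearMap.congr_fun (h.comm_shift k) y
  simp only [LinearMap.sub_apply, LinearMap.comp_apply, LinearMap.smul_apply] at this
  rw [← this, add_sub_cancel]

lemma lower_zero (h : IsDensityRep p q μ ρ) (hp : 3 < p) (hq : 0 < q) {k : ℤ} (hk : 0 ≤ k) :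
    ρ k (basisVec K q 0) = if k = 0 then μ • basisVec K q 0 else 0 := by
  rcases lt_or_ge ((p : ℤ) - 2) k with hk2 | hk2
  · rw [h.supp k (Or.inr hk2), if_neg (by omega), LinearMap.zero_apply]
  · obtain ⟨j, rfl⟩ : ∃ j : ℕ, k = j := ⟨k.toNat, by omega⟩
    rw [h.lower j 0 (by omega) hq]
    rcases j with _ | j
    · simp [wCoef]
    · rw [wCoef_of_lt _ (by omega), if_neg (by omega), zero_smul]

lemma lower_pow_eq_zero_of_lt (h : IsDensityRep p q μ ρ) {j : ℕ} (hj : j + 2 ≤ p) (a : ℕ) :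
    ∀ i < q, i < a * j → (ρ j ^ a) (basisVec K q i) = 0 := by
  induction a with
  | zero => intro i _ hi; omega
  | succ a ih =>
    intro i hiq hi
    rw [pow_succ, Module.End.mul_apply, h.lower j i hj hiq, map_smul]
    rcases lt_or_ge i j with hij | hij
    · rw [wCoef_of_lt _ hij, zero_smul]
    · rw [ih (i - j) (by omega) (by rw [Nat.succ_mul] at hi; omega), smul_zero]

lemma lower_pow_eq_zero (h : IsDensityRep p q μ ρ) {j a : ℕ} (hj : j + 2 ≤ p)
    (ha : q ≤ a * j) : ρ j ^ a = 0 :=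
  linearMap_ext_basisVec fun i hi => by
    rw [h.lower_pow_eq_zero_of_lt hj a i hi (hi.trans_le ha), LinearMap.zero_apply]

end IsDensityRep

section Propagation

variable {p q r : ℕ} {μ ν : K} {ρM : ℤ → Module.End K (Fin r → K)}
  {ρN : ℤ → Module.End K (Fin q → K)} {ρN' : ℤ → Module.End K (Fin p → K)}

lemma map_basisVec_eq_pow (hN : IsDensityRep p q ν ρN) {f : (Fin q → K) →ₗ[K] (Fin r → K)}
    (hf : ∀ n, ρM (-1) (f n) = f (ρN (-1) n)) (i : ℕ) :
    f (basisVec K q i) = (ρM (-1) ^ i) (f (basisVec K q 0)) := by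
  induction i with
  | zero => simp
  | succ i ih => rw [← hN.shift, ← hf, ih, pow_succ', Module.End.mul_apply]

/-- A family of defects which is propagated by `e_{-1}` and vanishes on the generator vanishes. -/
lemma defect_eq_zero (hN : IsDensityRep p q ν ρN)
    (D : ℤ → ℤ → (Fin q → K) →ₗ[K] (Fin r → K))
    (hD : ∀ i j n, ρM (-1) (D i j n) = D i j (ρN (-1) n) + ((i : K) + 1) • D (i - 1) j n
      + ((j : K) + 1) • D i (j - 1) n)
    (hl : ∀ j, D (-1) j = 0) (hr : ∀ i, D i (-1) = 0)
    (h0 : ∀ i j, 0 ≤ i → 0 ≤ j → D i j (basisVec K q 0) = 0) :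
    ∀ i j, -1 ≤ i → -1 ≤ j → D i j = 0 := by
  suffices H : ∀ (m : ℕ) (i j : ℤ), -1 ≤ i → -1 ≤ j → i + j + 2 = m → D i j = 0 from
    fun i j hi hj => H (i + j + 2).toNat i j hi hj (by omega)
  intro m
  induction m with
  | zero =>
    intro i j hi hj hm
    obtain rfl : i = -1 := by omega
    exact hl j
  | succ m ih =>
    intro i j hi hj hm
    rcases eq_or_ne i (-1) with rfl | hi'
    · exact hl j
    rcases eq_or_ne j (-1) with rfl | hj'
    · exact hr i
    have h1 := ih (i - 1) j (by omega) hj (by omega)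
    have h2 := ih i (j - 1) hi (by omega) (by omega)
    have hc : ∀ n, ρM (-1) (D i j n) = D i j (ρN (-1) n) := fun n => by
      rw [hD, h1, h2]; simp
    refine linearMap_ext_basisVec fun l _ => ?_
    rw [map_basisVec_eq_pow hN hc, h0 i j (by omega) (by omega), map_zero, LinearMap.zero_apply]

lemma IsDensityRep.bracket [CharP K p] (h : IsDensityRep p q ν ρN) (hp : 3 < p) (hq : 0 < q)
    {i j : ℤ} (hi : -1 ≤ i) (hj : -1 ≤ j) (y : Fin q → K) :
    ((j : K) - i) • ρN (i + j) y = ρN i (ρN j y) - ρN j (ρN i y) := by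
  have key := defect_eq_zero (ρM := ρN) h
    (fun i j => ((j : K) - i) • ρN (i + j) - ρN i ∘ₗ ρN j + ρN j ∘ₗ ρN i) ?_ ?_ ?_ ?_ i j hi hj
  · have := LinearMap.congr_fun key y
    simp only [LinearMap.add_apply, LinearMap.sub_apply, LinearMap.comp_apply,
      LinearMap.smul_apply, LinearMap.zero_apply] at this
    rw [← sub_eq_zero, ← this]
    abel
  · intro i j n
    simp only [LinearMap.add_apply, LinearMap.sub_apply, LinearMap.comp_apply,
      LinearMap.smul_apply, map_add, map_sub, map_smul, h.shift_apply, Int.cast_add,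
      Int.cast_sub, Int.cast_one, show i - 1 + j = i + j - 1 by ring,
      show i + (j - 1) = i + j - 1 by ring]
    module
  · intro j
    refine LinearMap.ext fun y => ?_
    simp only [LinearMap.add_apply, LinearMap.sub_apply, LinearMap.comp_apply,
      LinearMap.smul_apply, h.shift_apply j, LinearMap.zero_apply, neg_add_eq_sub, Int.cast_neg,
      Int.cast_one]
    module
  · intro i
    refine LinearMap.ext fun y => ?_
    simp only [LinearMap.add_apply, LinearMap.sub_apply, LinearMap.comp_apply,
      LinearMap.smul_apply, h.shift_apply i, LinearMap.zero_apply, ← sub_eq_add_neg, Int.cast_neg,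
      Int.cast_one]
    module
  · intro i j hi hj
    simp only [LinearMap.add_apply, LinearMap.sub_apply, LinearMap.comp_apply,
      LinearMap.smul_apply, h.lower_zero hp hq hi, h.lower_zero hp hq hj,
      h.lower_zero hp hq (add_nonneg hi hj)]
    by_cases hi0 : i = 0 <;> by_cases hj0 : j = 0
    · subst hi0 hj0; simp
    · subst hi0; simp [hj0, h.lower_zero hp hq hj]
    · subst hj0; simp [hi0, h.lower_zero hp hq hi]
    · have : i + j ≠ 0 := by omega
      simp [hi0, hj0, this]

lemma mem_cocycles_iff {M N : Type} [AddCommGroup M] [Module K M] [AddCommGroup N] [Module K N]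
    {p : ℕ} {ρM : ℤ → Module.End K M} {ρN : ℤ → Module.End K N} {c : ℤ → N →ₗ[K] M} :
    c ∈ cocycles K p (-1) ρM ρN ↔
      (∀ k : ℤ, k < -1 ∨ (p : ℤ) - 2 < k → c k = 0) ∧
      (∀ i j : ℤ, -1 ≤ i → i ≤ (p : ℤ) - 2 → -1 ≤ j → j ≤ (p : ℤ) - 2 → ∀ n,
        ((j : K) - i) • c (i + j) n - ρM i (c j n) - c i (ρN j n) + ρM j (c i n)
          + c j (ρN i n) = 0) ∧
      (∀ i : ℤ, -1 ≤ i → i ≤ (p : ℤ) - 2 → ∀ n,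
        ∑ k ∈ Finset.range p, (ρM i ^ k) (c i ((ρN i ^ (p - 1 - k)) n))
          = if i = 0 then c 0 n else 0) := by
  simp only [cocycles, Submodule.mem_inf, Submodule.mem_iInf, LinearMap.mem_ker, and_assoc]
  refine and_congr (forall_congr' fun k => ?_) (and_congr (forall_congr' fun i =>
    forall_congr' fun j => ?_) (forall_congr' fun i => ?_))
  · rw [suppConstraint]
    split_ifs with h <;> simp [h]
  · rw [bracketConstraint]
    split_ifs with h
    · rw [LinearMap.ext_iff]
      simp [h]
    · simp only [LinearMap.zero_apply, true_iff]
      intro h1 h2 h3 h4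
      exact absurd ⟨h1, h2, h3, h4⟩ h
  · rw [pcharConstraint]
    by_cases h : -1 ≤ i ∧ i ≤ (p : ℤ) - 2
    · rw [if_pos h, LinearMap.ext_iff]
      simp only [h.1, h.2, forall_const]
      refine forall_congr' fun n => ?_
      rw [← sub_eq_zero (b := ite _ _ _)]
      split_ifs with h0 <;> simp
    · rw [if_neg h]
      simp only [LinearMap.zero_apply, true_iff]
      intro h1 h2
      exact absurd ⟨h1, h2⟩ h

lemma mem_coboundaries_of_forall [CharP K p] (hM : IsDensityRep p r μ ρM)
    (hN : IsDensityRep p q ν ρN) {c : ℤ → (Fin q → K) →ₗ[K] (Fin r → K)}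
    (f : (Fin q → K) →ₗ[K] (Fin r → K))
    (hf : ∀ k n, c k n = ρM k (f n) - f (ρN k n)) : c ∈ coboundaries K p (-1) ρM ρN := by
  refine ⟨f, ?_⟩
  funext k
  refine LinearMap.ext fun n => ?_
  rw [LinearMap.pi_apply, hf]
  split_ifs with h
  · simp
  · have h' : k < -1 ∨ (p : ℤ) - 2 < k := by omega
    simp [hM.supp k h', hN.supp k h']

lemma exists_of_mem_coboundaries (hM : IsDensityRep p r μ ρM)
    (hN : IsDensityRep p q ν ρN) {c : ℤ → (Fin q → K) →ₗ[K] (Fin r → K)}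
    (hc : c ∈ coboundaries K p (-1) ρM ρN) :
    ∃ f : (Fin q → K) →ₗ[K] (Fin r → K), ∀ k n, c k n = ρM k (f n) - f (ρN k n) := by
  obtain ⟨f, rfl⟩ := hc
  refine ⟨f, fun k n => ?_⟩
  rw [LinearMap.pi_apply]
  split_ifs with h
  · simp
  · have h' : k < -1 ∨ (p : ℤ) - 2 < k := by omega
    simp [hM.supp k h', hN.supp k h']

/-- The relations `e_i^p = e_i^{[p]}`. -/
lemma IsDensityRep.pow_char [CharP K p] (h : IsDensityRep p q ν ρN) (hp : 3 < p) (hq : q ≤ p)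
    (hν : ν ^ p = ν) (hprime : p.Prime) {i : ℤ} (hi : -1 ≤ i) (hi2 : i ≤ (p : ℤ) - 2) :
    ρN i ^ p = if i = 0 then ρN 0 else 0 := by
  have := Fact.mk hprime
  rcases lt_trichotomy i 0 with h0 | rfl | h0
  · obtain rfl : i = -1 := by omega
    rw [h.shift_pow_eq_zero hq, if_neg (by omega)]
  · rw [if_pos rfl]
    refine linearMap_ext_basisVec fun l hl => ?_
    have h1 : ρN 0 (basisVec K q l) = (ν - l) • basisVec K q l := by
      have := h.lower 0 l (by omega) hl
      simpa [wCoef] using this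
    have h2 : ∀ a : ℕ, (ρN 0 ^ a) (basisVec K q l) = (ν - l) ^ a • basisVec K q l := by
      intro a
      induction a with
      | zero => simp
      | succ a ih => rw [pow_succ', Module.End.mul_apply, ih, map_smul, h1, smul_smul, pow_succ]
    have h3 : (l : K) ^ p = l := by
      have := map_natCast (frobenius K p) l
      rwa [frobenius_def] at this
    rw [h1, h2, sub_pow_char, hν, h3]
  · obtain ⟨j, rfl⟩ : ∃ j : ℕ, i = j := ⟨i.toNat, by omega⟩
    rw [h.lower_pow_eq_zero (by omega) (hq.trans (Nat.le_mul_of_pos_right p (by omega))),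
      if_neg (by omega)]

lemma coboundaries_le_cocycles [CharP K p] (hp : 3 < p) (hprime : p.Prime)
    (hM : IsDensityRep p r μ ρM) (hN : IsDensityRep p q ν ρN) (hr0 : 0 < r) (hr : r ≤ p)
    (hq0 : 0 < q) (hq : q ≤ p) (hμ : μ ^ p = μ) (hν : ν ^ p = ν) :
    coboundaries K p (-1) ρM ρN ≤ cocycles K p (-1) ρM ρN := by
  intro c hc
  obtain ⟨f, hf⟩ := exists_of_mem_coboundaries hM hN hc
  refine mem_cocycles_iff.2 ⟨fun k hk => ?_, fun i j hi _ hj _ n => ?_, fun i hi hi2 n => ?_⟩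
  · refine LinearMap.ext fun n => ?_
    simp [hf, hM.supp k hk, hN.supp k hk]
  · simp only [hf, map_sub, smul_sub, hM.bracket hp hr0 hi hj]
    rw [← map_smul f, hN.bracket hp hq0 hi hj, map_sub]
    abel
  · let F : ℕ → Fin r → K := fun k => (ρM i ^ k) (f ((ρN i ^ (p - k)) n))
    have h1 : ∀ k ∈ Finset.range p,
        (ρM i ^ k) (c i ((ρN i ^ (p - 1 - k)) n)) = F (k + 1) - F k := by
      intro k hk
      rw [Finset.mem_range] at hk
      simp only [F, hf, map_sub, pow_succ, Module.End.mul_apply]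
      rw [show p - k = (p - 1 - k) + 1 by omega, show p - (k + 1) = p - 1 - k by omega, pow_succ']
      rfl
    rw [Finset.sum_congr rfl h1, Finset.sum_range_sub]
    simp only [F, Nat.sub_self, pow_zero, Module.End.one_apply, Nat.sub_zero,
      hM.pow_char hp hr hμ hprime hi hi2, hN.pow_char hp hq hν hprime hi hi2]
    split_ifs with h0
    · rw [hf]
    · simp

/-- Solving `h = e_{-1} f - f e_{-1}` with a prescribed value of `f` on the generator. -/
lemma exists_shift_primitive (hM : IsDensityRep p r μ ρM) (hN : IsDensityRep p q ν ρN)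
    (hq0 : 0 < q) (hr : r ≤ q) (h : (Fin q → K) →ₗ[K] (Fin r → K))
    (hh : ∑ k ∈ Finset.range q, (ρM (-1) ^ k) (h ((ρN (-1) ^ (q - 1 - k)) (basisVec K q 0))) = 0)
    (m : Fin r → K) :
    ∃ f : (Fin q → K) →ₗ[K] (Fin r → K), f (basisVec K q 0) = m ∧
      ∀ n, h n = ρM (-1) (f n) - f (ρN (-1) n) := by
  let g : ℕ → Fin r → K := fun i => (ρM (-1) ^ i) m
    - ∑ k ∈ Finset.range i, (ρM (-1) ^ k) (h (basisVec K q (i - 1 - k)))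
  have hg : ∀ i, g (i + 1) = ρM (-1) (g i) - h (basisVec K q i) := by
    intro i
    simp only [g, map_sub, map_sum, Finset.sum_range_succ', pow_succ', Module.End.mul_apply,
      pow_zero, Module.End.one_apply, Nat.add_sub_cancel, Nat.sub_zero, sub_add_eq_sub_sub]
    congr 2
    refine Finset.sum_congr rfl fun k _ => ?_
    rw [show i - (k + 1) = i - 1 - k by omega]
  have hgq : g q = 0 := by
    simp only [g, hM.shift_pow_eq_zero hr, LinearMap.zero_apply, zero_sub, neg_eq_zero]
    simpa only [hN.shift_pow, zero_add] using hh
  obtain ⟨f, hf⟩ := exists_linearMap_basisVec (K := K) q g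
  refine ⟨f, by rw [hf 0 hq0]; simp [g], fun n => ?_⟩
  suffices H : h = (ρM (-1)).comp f - f.comp (ρN (-1)) by
    exact LinearMap.congr_fun H n
  refine linearMap_ext_basisVec (K := K) fun i hi => ?_
  rw [LinearMap.sub_apply, LinearMap.comp_apply, LinearMap.comp_apply, hN.shift, hf i hi]
  have : f (basisVec K q (i + 1)) = g (i + 1) := by
    rcases (Nat.succ_le_of_lt hi).lt_or_eq with h' | h'
    · exact hf _ h'
    · rw [Nat.succ_eq_add_one] at h'
      rw [h', hgq, basisVec_eq_zero le_rfl, map_zero]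
  rw [this, hg]
  abel

/-- The operator `(x_j) ↦ (e_{-1} x_j - (j + 1) x_{j - 1})` on sequences, up to the shift term. -/
def sequenceLower (K V : Type) [Field K] [AddCommGroup V] [Module K V] :
    Module.End K (ℕ → V) :=
  LinearMap.pi fun j => ((j : K) + 1) • if j = 0 then 0 else LinearMap.proj (j - 1)

lemma sequenceLower_pow_apply_of_lt {V : Type} [AddCommGroup V] [Module K V] (x : ℕ → V) (a : ℕ) :
    ∀ j < a, (sequenceLower K V ^ a) x j = 0 := by
  induction a with
  | zero => intro j hj; omega
  | succ a ih =>
    intro j hj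
    rw [pow_succ', Module.End.mul_apply, sequenceLower, LinearMap.pi_apply, LinearMap.smul_apply]
    split_ifs with h
    · simp
    · rw [LinearMap.proj_apply, ← sequenceLower, ih (j - 1) (by omega), smul_zero]

/-- The values `c_j v_l` of the cochain with `c_j v_0 = x_j` that is compatible with `e_{-1}`. -/
lemma exists_sequence {V : Type} [AddCommGroup V] [Module K V] [Nontrivial V] [CharP K p]
    (hprime : p.Prime) (e : Module.End K V) (he : e ^ p = 0) (x : ℕ → V) :
    ∃ g : ℕ → ℕ → V, (∀ j, g j 0 = x j) ∧ (∀ l, g 0 (l + 1) = e (g 0 l)) ∧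
      (∀ j l, g (j + 1) (l + 1) = e (g (j + 1) l) - ((j : K) + 2) • g j l) ∧
      ∀ j < p, g j p = 0 := by
  have := Fact.mk hprime
  let L : Module.End K (ℕ → V) := LinearMap.pi fun j => e ∘ₗ LinearMap.proj j
  have hL : ∀ a y j, (L ^ a) y j = (e ^ a) (y j) := by
    intro a
    induction a with
    | zero => simp
    | succ a ih => intro y j; rw [pow_succ, Module.End.mul_apply, ih, pow_succ]; rfl
  have hcomm : Commute L (sequenceLower K V) := by
    refine LinearMap.ext fun y => funext fun j => ?_
    simp only [Module.End.mul_apply, L, sequenceLower, LinearMap.pi_apply, LinearMap.comp_apply,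
      LinearMap.proj_apply, LinearMap.smul_apply, map_smul]
    split_ifs <;> simp
  have : CharP (Module.End K (ℕ → V)) p :=
    charP_of_injective_algebraMap (algebraMap K (Module.End K (ℕ → V))).injective p
  refine ⟨fun j l => ((L - sequenceLower K V) ^ l) x j, fun j => by simp, fun l => ?_,
    fun j l => ?_, fun j hj => ?_⟩
  · simp only [pow_succ', Module.End.mul_apply, LinearMap.sub_apply, Pi.sub_apply]
    simp [L, sequenceLower]
  · simp only [pow_succ', Module.End.mul_apply, LinearMap.sub_apply, Pi.sub_apply]
    simp [L, sequenceLower]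
    congr 1
    ring
  · simp only [sub_pow_char_of_commute p hcomm, LinearMap.sub_apply, Pi.sub_apply, hL,
      he, sequenceLower_pow_apply_of_lt x p j hj, LinearMap.zero_apply, sub_zero]

lemma exists_shift_cochain [CharP K p] (hp : 3 < p) (hprime : p.Prime)
    (hM : IsDensityRep p r μ ρM) (hN : IsDensityRep p p ν ρN') (hr0 : 0 < r) (hr : r ≤ p)
    (x : ℕ → Fin r → K) :
    ∃ c : ℤ → (Fin p → K) →ₗ[K] (Fin r → K),
      (∀ k : ℤ, k < 0 ∨ (p : ℤ) - 2 < k → c k = 0) ∧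
      (∀ j : ℕ, j + 2 ≤ p → c j (basisVec K p 0) = x j) ∧
      ∀ k n, ρM (-1) (c k n) = c k (ρN' (-1) n) + ((k : K) + 1) • c (k - 1) n := by
  have : Nontrivial (Fin r → K) := ⟨_, _, basisVec_ne_zero hr0⟩
  obtain ⟨g, hg0, hgz, hgs, hgp⟩ := exists_sequence hprime (ρM (-1)) (hM.shift_pow_eq_zero hr) x
  choose c hc using fun j => exists_linearMap_basisVec (K := K) p (g j)
  have hc' : ∀ j < p, ∀ i ≤ p, c j (basisVec K p i) = g j i := by
    intro j hj i hi
    rcases hi.lt_or_eq with hi | rfl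
    · exact hc j i hi
    · rw [hgp j hj, basisVec_eq_zero le_rfl, map_zero]
  have hsupp : ∀ k : ℤ, k < 0 ∨ (p : ℤ) - 2 < k →
      (if 0 ≤ k ∧ k ≤ (p : ℤ) - 2 then c k.toNat else 0) = 0 := fun k hk => if_neg (by omega)
  have hval : ∀ j : ℕ, j + 2 ≤ p →
      (if 0 ≤ (j : ℤ) ∧ (j : ℤ) ≤ (p : ℤ) - 2 then c (j : ℤ).toNat else 0) = c j := fun j hj => by
    rw [if_pos (by omega), Int.toNat_natCast]
  refine ⟨fun k => if 0 ≤ k ∧ k ≤ (p : ℤ) - 2 then c k.toNat else 0, hsupp, fun j hj => ?_,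
    fun k n => ?_⟩
  · simp only [hval j hj]
    rw [hc' j (by omega) 0 (by omega), hg0]
  · beta_reduce
    rcases lt_or_ge k 0 with hk | hk
    · rw [hsupp k (Or.inl hk), hsupp (k - 1) (Or.inl (by omega))]; simp
    rcases lt_or_ge ((p : ℤ) - 2) k with hk2 | hk2
    · rw [hsupp k (Or.inr hk2)]
      rcases eq_or_ne k ((p : ℤ) - 1) with rfl | hk3
      · simp
      · rw [hsupp (k - 1) (by omega)]; simp
    obtain ⟨j, rfl⟩ : ∃ j : ℕ, k = j := ⟨k.toNat, by omega⟩
    rw [hval j (by omega)]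
    rcases j with _ | j
    · rw [hsupp _ (Or.inl (by omega))]
      suffices H : (ρM (-1)).comp (c 0) = (c 0).comp (ρN' (-1)) by
        simpa using LinearMap.congr_fun H n
      refine linearMap_ext_basisVec (K := K) fun i hi => ?_
      rw [LinearMap.comp_apply, LinearMap.comp_apply, hN.shift, hc' 0 (by omega) i hi.le,
        hc' 0 (by omega) (i + 1) hi, hgz]
    · rw [show ((j + 1 : ℕ) : ℤ) - 1 = (j : ℕ) by omega, hval j (by omega)]
      suffices H : (ρM (-1)).comp (c (j + 1)) =
          (c (j + 1)).comp (ρN' (-1)) + ((((j + 1 : ℕ) : ℤ) : K) + 1) • c j from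
        LinearMap.congr_fun H n
      refine linearMap_ext_basisVec (K := K) fun i hi => ?_
      rw [LinearMap.add_apply, LinearMap.smul_apply, LinearMap.comp_apply, LinearMap.comp_apply,
        hN.shift, hc' (j + 1) (by omega) i hi.le, hc' (j + 1) (by omega) (i + 1) hi, hgs,
        hc' j (by omega) i hi.le]
      push_cast
      module

/-- Frobenius reciprocity: a cocycle of `W_0` with values in `S` extends to one of `W`. -/
lemma exists_cocycle [CharP K p] (hp : 3 < p) (hprime : p.Prime)
    {ρS : ℤ → Module.End K (Fin (p - 1) → K)}
    (hM : IsDensityRep p (p - 1) μ ρS) (hN : IsDensityRep p p ν ρN') (x : ℕ → Fin (p - 1) → K)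
    (hx0 : x 0 = 0) (hxt : ∀ j, p - 2 < j → x j = 0)
    (hwt : ∀ j, ρS 0 (x j) = (ν + j) • x j)
    (hlt : ∀ i j : ℕ, 1 ≤ i → i < j → j + 2 ≤ p →
      ((j : K) - i) • x (i + j) = ρS i (x j) - ρS j (x i))
    (h1 : x 1 = 0 ∨ (ν = 0 ∧ ρS (-1) (x 1) = 0)) :
    ∃ c ∈ cocycles K p (-1) ρS ρN', c (-1) = 0 ∧
      ∀ j : ℕ, j + 2 ≤ p → c j (basisVec K p 0) = x j := by
  have hx : ∀ i j : ℕ, 1 ≤ i → 1 ≤ j → i + 2 ≤ p → j + 2 ≤ p →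
      ((j : K) - i) • x (i + j) = ρS i (x j) - ρS j (x i) := by
    intro i j hi hj hi2 hj2
    rcases lt_trichotomy i j with h | rfl | h
    · exact hlt i j hi h hj2
    · simp
    · rw [← neg_sub (ρS j (x i)), ← hlt j i hj h hi2, add_comm j i, ← neg_smul, neg_sub]
  obtain ⟨c, hs, hv, hc⟩ := exists_shift_cochain hp hprime hM hN (by omega) (by omega) x
  have hm1 : c (-1) = 0 := hs _ (Or.inl (by omega))
  have hc0 : c 0 = 0 := by
    refine linearMap_ext_basisVec fun l _ => ?_
    have h : ∀ n, ρS (-1) (c 0 n) = c 0 (ρN' (-1) n) := fun n => by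
      rw [hc 0 n, zero_sub, hm1]; simp
    rw [map_basisVec_eq_pow hN h, show (0 : ℤ) = (0 : ℕ) by rfl, hv 0 (by omega), hx0, map_zero,
      LinearMap.zero_apply]
  have hv' : ∀ j : ℕ, c j (basisVec K p 0) = x j := by
    intro j
    rcases lt_or_ge (p - 2) j with h | h
    · rw [hs j (by omega), hxt j h, LinearMap.zero_apply]
    · exact hv j (by omega)
  refine ⟨c, mem_cocycles_iff.2 ⟨fun k hk => hs k (by omega), fun i j hi _ hj _ n => ?_,
    fun i hi hi2 n => ?_⟩, hm1, hv⟩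
  · have key := defect_eq_zero (ρM := ρS) hN
      (fun i j => ((j : K) - i) • c (i + j) - (ρS i).comp (c j) - (c i).comp (ρN' j)
        + (ρS j).comp (c i) + (c j).comp (ρN' i)) ?_ ?_ ?_ ?_ i j hi hj
    · exact LinearMap.congr_fun key n
    · intro i j n
      simp only [LinearMap.add_apply, LinearMap.sub_apply, LinearMap.comp_apply,
        LinearMap.smul_apply, map_add, map_sub, map_smul, hM.shift_apply, hN.shift_apply, hc,
        Int.cast_add, Int.cast_sub, Int.cast_one, show i - 1 + j = i + j - 1 by ring,
        show i + (j - 1) = i + j - 1 by ring]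
      module
    · intro j
      refine LinearMap.ext fun y => ?_
      simp only [LinearMap.add_apply, LinearMap.sub_apply, LinearMap.comp_apply,
        LinearMap.smul_apply, hc j, LinearMap.zero_apply, neg_add_eq_sub, Int.cast_neg,
        Int.cast_one, hm1, map_zero]
      module
    · intro i
      refine LinearMap.ext fun y => ?_
      simp only [LinearMap.add_apply, LinearMap.sub_apply, LinearMap.comp_apply,
        LinearMap.smul_apply, hc i, LinearMap.zero_apply, ← sub_eq_add_neg, Int.cast_neg,
        Int.cast_one, hm1, map_zero]
      module
    · intro i j hi hj
      obtain ⟨i, rfl⟩ := Int.eq_ofNat_of_zero_le hi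
      obtain ⟨j, rfl⟩ := Int.eq_ofNat_of_zero_le hj
      simp only [LinearMap.add_apply, LinearMap.sub_apply, LinearMap.comp_apply,
        LinearMap.smul_apply, hN.lower_zero hp (by omega) hi, hN.lower_zero hp (by omega) hj,
        ← Nat.cast_add, hv', Int.cast_natCast, Nat.cast_eq_zero]
      by_cases hi0 : i = 0
      · subst hi0
        by_cases hj0 : j = 0
        · subst hj0; simp [hx0, hc0]
        · simp [hx0, hc0, hj0, hwt, hv']
          module
      by_cases hj0 : j = 0
      · subst hj0; simp [hx0, hc0, hi0, hwt, hv']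
        module
      rw [if_neg hi0, if_neg hj0, map_zero, map_zero]
      by_cases hi2 : i + 2 ≤ p
      · by_cases hj2 : j + 2 ≤ p
        · rw [hx i j (by omega) (by omega) hi2 hj2]
          module
        · rw [hxt (i + j) (by omega), hxt j (by omega), hM.supp j (by omega)]; simp
      · rw [hxt (i + j) (by omega), hxt i (by omega), hM.supp i (by omega)]; simp
  · rcases lt_trichotomy i 0 with h0 | rfl | h0
    · obtain rfl : i = -1 := by omega
      simp [hm1]
    · simp [hc0]
    rw [if_neg (by omega)]
    obtain ⟨j, rfl⟩ := Int.eq_ofNat_of_zero_le h0.le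
    refine Finset.sum_eq_zero fun k hk => ?_
    rw [Finset.mem_range] at hk
    rcases eq_or_ne j 1 with rfl | hj1
    · have hc1 : ∀ n, ρS (-1) (c (1 : ℕ) n) = c (1 : ℕ) (ρN' (-1) n) := fun n => by
        rw [hc, show ((1 : ℕ) : ℤ) - 1 = 0 by rfl, hc0]; simp
      rcases h1 with h1 | ⟨rfl, h1⟩
      · have : c (1 : ℕ) = 0 := by
          refine linearMap_ext_basisVec fun l _ => ?_
          rw [map_basisVec_eq_pow hN hc1, hv', h1, map_zero, LinearMap.zero_apply]
        rw [this, LinearMap.zero_apply, map_zero]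
      · rcases eq_or_ne k (p - 1) with rfl | hk1
        · rw [hM.lower_pow_eq_zero (by omega) (by omega), LinearMap.zero_apply]
        · obtain ⟨a, ha⟩ : ∃ a, p - 1 - k = a + 1 := ⟨p - 2 - k, by omega⟩
          have : c (1 : ℕ) ∘ₗ ρN' (1 : ℕ) = 0 := by
            refine linearMap_ext_basisVec (K := K) fun l hl => ?_
            rw [LinearMap.comp_apply, hN.lower 1 l (by omega) hl, map_smul,
              map_basisVec_eq_pow hN hc1, hv', LinearMap.zero_apply]
            rcases l with _ | _ | l
            · rw [wCoef_of_lt _ (by omega), zero_smul]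
            · simp [wCoef]
            · rw [show l + 1 + 1 - 1 = l + 1 by omega, pow_succ, Module.End.mul_apply, h1,
                map_zero, smul_zero]
          rw [ha, pow_succ', Module.End.mul_apply]
          have := LinearMap.congr_fun this ((ρN' (1 : ℕ) ^ a) n)
          rw [LinearMap.comp_apply, LinearMap.zero_apply] at this
          rw [this, map_zero]
    · rcases lt_or_ge (2 * k) (p - 1) with h | h
      · have h2 : p ≤ (p - 1 - k) * 2 := by
          rcases hprime.eq_two_or_odd with h' | h' <;> omega
        rw [hN.lower_pow_eq_zero (by omega) (h2.trans (Nat.mul_le_mul_left _ (by omega))),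
          LinearMap.zero_apply, map_zero, map_zero]
      · rw [hM.lower_pow_eq_zero (by omega)
          ((show p - 1 ≤ k * 2 by omega).trans (Nat.mul_le_mul_left _ (by omega))),
          LinearMap.zero_apply]

end Propagation

section SimpleModule

variable {p : ℕ} {ν : K} {ρS : ℤ → Module.End K (Fin (p - 1) → K)}
  {ρV : ℤ → Module.End K (Fin p → K)}

lemma natCast_ne_zero_of_lt [CharP K p] {a : ℕ} (h0 : 0 < a) (h : a < p) : (a : K) ≠ 0 := by
  rw [Ne, CharP.cast_eq_zero_iff K p]
  exact fun hd => absurd (Nat.le_of_dvd h0 hd) (by omega)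

lemma weight_apply (hp : 3 < p) (hM : IsDensityRep p (p - 1) (-1) ρS) (y : Fin (p - 1) → K)
    (k : Fin (p - 1)) : ρS 0 y k = -((k : K) + 1) * y k := by
  have : LinearMap.proj k ∘ₗ ρS 0
      = (-(((k : ℕ) : K) + 1)) • (LinearMap.proj k : (Fin (p - 1) → K) →ₗ[K] K) := by
    refine linearMap_ext_basisVec fun i hi => ?_
    have h := hM.lower 0 i (by omega) hi
    rw [Nat.cast_zero] at h
    rw [LinearMap.comp_apply, h]
    simp only [wCoef, basisVec, Nat.sub_zero, LinearMap.smul_apply, LinearMap.proj_apply,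
      Pi.smul_apply, smul_eq_mul, pow_zero, Nat.descFactorial_zero]
    split_ifs with hk
    · rw [hk]; push_cast; ring
    · simp
  exact LinearMap.congr_fun this y

lemma weight_pow_apply (hp : 3 < p) (hM : IsDensityRep p (p - 1) (-1) ρS) (a : ℕ)
    (y : Fin (p - 1) → K) (k : Fin (p - 1)) :
    (ρS 0 ^ a) y k = (-((k : K) + 1)) ^ a * y k := by
  induction a with
  | zero => simp
  | succ a ih => rw [pow_succ', Module.End.mul_apply, weight_apply hp hM, ih]; ring

lemma weight_basisVec (hp : 3 < p) (hM : IsDensityRep p (p - 1) (-1) ρS) (m : ℕ) :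
    ρS 0 (basisVec K (p - 1) m) = (-((m : K) + 1)) • basisVec K (p - 1) m := by
  funext k
  rw [weight_apply hp hM, Pi.smul_apply, smul_eq_mul, basisVec]
  split_ifs with h
  · rw [h]
  · simp

/-- A nonzero weight vector of `S` is a multiple of a standard basis vector. -/
lemma exists_smul_basisVec [CharP K p] (hp : 3 < p) (hM : IsDensityRep p (p - 1) (-1) ρS) {κ : K}
    {y : Fin (p - 1) → K} (hy : ρS 0 y = κ • y) (hy0 : y ≠ 0) :
    ∃ m < p - 1, κ = -((m : K) + 1) ∧ ∃ a : K, y = a • basisVec K (p - 1) m := by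
  obtain ⟨m, hm⟩ := Function.ne_iff.1 hy0
  have hk : ∀ k, y k ≠ 0 → κ = -((k : K) + 1) := fun k hk => by
    have := congrFun hy k
    rw [weight_apply hp hM, Pi.smul_apply, smul_eq_mul] at this
    exact (mul_right_cancel₀ hk this).symm
  refine ⟨m, m.2, hk m hm, y m, ?_⟩
  funext k
  simp only [basisVec, Pi.smul_apply, smul_eq_mul, mul_ite, mul_one, mul_zero]
  split_ifs with h
  · rw [Fin.ext h]
  · by_contra h0
    have h1 := (hk m hm).symm.trans (hk k h0)
    rw [neg_inj, add_left_inj] at h1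
    have hm2 := m.2
    have hk2 := k.2
    exact h (CharP.natCast_injOn_Iio K p (show (k : ℕ) < p by omega)
      (show (m : ℕ) < p by omega) h1.symm)

lemma exists_smul_basisVec_of_weight [CharP K p] (hp : 3 < p)
    (hM : IsDensityRep p (p - 1) (-1) ρS) {y : Fin (p - 1) → K} {m : ℕ} (hm : m < p - 1)
    (hy : ρS 0 y = (-((m : K) + 1)) • y) : ∃ a : K, y = a • basisVec K (p - 1) m := by
  rcases eq_or_ne y 0 with rfl | hy0
  · exact ⟨0, by simp⟩
  obtain ⟨m', hm', h, a, ha⟩ := exists_smul_basisVec hp hM hy hy0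
  rw [neg_inj, add_left_inj] at h
  obtain rfl : m = m' := CharP.natCast_injOn_Iio K p (show m < p by omega)
      (show m' < p by omega) h
  exact ⟨a, ha⟩

lemma eq_zero_of_weight_zero [CharP K p] (hp : 3 < p) (hM : IsDensityRep p (p - 1) (-1) ρS)
    {y : Fin (p - 1) → K} (hy : ρS 0 y = (0 : K) • y) : y = 0 := by
  by_contra hy0
  obtain ⟨m, hm, h, -⟩ := exists_smul_basisVec hp hM hy hy0
  have := natCast_ne_zero_of_lt (K := K) (p := p) (Nat.succ_pos m) (by omega)
  rw [eq_comm, neg_eq_zero] at h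
  exact this (by exact_mod_cast h)

lemma lower_one_basisVec (hp : 3 < p) (hM : IsDensityRep p (p - 1) (-1) ρS) {m : ℕ}
    (hm : m < p - 1) :
    ρS 1 (basisVec K (p - 1) m) = (((m : K) + 1) * m) • basisVec K (p - 1) (m - 1) := by
  have := hM.lower 1 m (by omega) hm
  rw [Nat.cast_one] at this
  rw [this]
  congr 1
  simp only [wCoef, Nat.descFactorial_one]
  push_cast
  ring

lemma eq_zero_of_lower_one_eq_zero [CharP K p] (hp : 3 < p)
    (hM : IsDensityRep p (p - 1) (-1) ρS) {κ : K} {y : Fin (p - 1) → K}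
    (hy : ρS 0 y = κ • y) (hκ : κ ≠ -1) (h1 : ρS 1 y = 0) : y = 0 := by
  by_contra hy0
  obtain ⟨m, hm, rfl, a, rfl⟩ := exists_smul_basisVec hp hM hy hy0
  have hm0 : m ≠ 0 := by rintro rfl; simp at hκ
  have ha : a ≠ 0 := by rintro rfl; simp at hy0
  rw [map_smul, lower_one_basisVec hp hM hm, smul_smul] at h1
  rcases smul_eq_zero.1 h1 with h | h
  · have h2 := natCast_ne_zero_of_lt (K := K) (p := p) (Nat.pos_of_ne_zero hm0) (by omega)
    have h3 := natCast_ne_zero_of_lt (K := K) (p := p) (Nat.succ_pos m) (by omega)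
    push_cast at h3
    exact mul_ne_zero ha (mul_ne_zero h3 h2) h
  · exact basisVec_ne_zero (by omega) h

/-- A cocycle normalised to vanish on `e_{-1}`, and on `e_0` at the generator. -/
structure IsNormalCocycle (ρS : ℤ → Module.End K (Fin (p - 1) → K))
    (ρV : ℤ → Module.End K (Fin p → K)) (c : ℤ → (Fin p → K) →ₗ[K] (Fin (p - 1) → K)) :
    Prop where
  mem : c ∈ cocycles K p (-1) ρS ρV
  neg_one : c (-1) = 0
  zero : c 0 (basisVec K p 0) = 0

namespace IsNormalCocycle

variable {c : ℤ → (Fin p → K) →ₗ[K] (Fin (p - 1) → K)}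

lemma sub_const_smul {c' : ℤ → (Fin p → K) →ₗ[K] (Fin (p - 1) → K)} (hc : IsNormalCocycle ρS ρV c)
    (hc' : IsNormalCocycle ρS ρV c') (a : K) : IsNormalCocycle ρS ρV (c - a • c') where
  mem := sub_mem hc.mem (Submodule.smul_mem _ _ hc'.mem)
  neg_one := by simp [hc.neg_one, hc'.neg_one]
  zero := by simp [hc.zero, hc'.zero]

lemma supp (hc : IsNormalCocycle ρS ρV c) {k : ℤ} (hk : k < -1 ∨ (p : ℤ) - 2 < k) : c k = 0 :=
  (mem_cocycles_iff.1 hc.mem).1 k hk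

lemma shift (hc : IsNormalCocycle ρS ρV c) (hp : 3 < p) {k : ℤ} (hk : -1 ≤ k)
    (hk2 : k ≤ (p : ℤ) - 2) (n : Fin p → K) :
    ρS (-1) (c k n) = c k (ρV (-1) n) + ((k : K) + 1) • c (k - 1) n := by
  have := (mem_cocycles_iff.1 hc.mem).2.1 (-1) k le_rfl (by omega) hk hk2 n
  rw [hc.neg_one, LinearMap.zero_apply, LinearMap.zero_apply, map_zero, Int.cast_neg,
    Int.cast_one, sub_neg_eq_add, neg_add_eq_sub] at this
  rw [← sub_eq_zero, ← neg_eq_zero, ← this]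
  abel

lemma weight (hc : IsNormalCocycle ρS ρV c) (hp : 3 < p) (hN : IsDensityRep p p ν ρV) (j : ℕ)
    (hj : j + 2 ≤ p) :
    ρS 0 (c j (basisVec K p 0)) = (ν + j) • c j (basisVec K p 0) := by
  have := (mem_cocycles_iff.1 hc.mem).2.1 0 j (by omega) (by omega) (by omega) (by omega)
    (basisVec K p 0)
  rw [hc.zero, map_zero, hN.lower_zero hp (by omega) le_rfl, if_pos rfl, map_smul, zero_add,
    hN.lower_zero hp (by omega) (by omega)] at this
  have h0 : c 0 (if (j : ℤ) = 0 then ν • basisVec K p 0 else 0) = 0 := by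
    split_ifs
    · rw [map_smul, hc.zero, smul_zero]
    · rw [map_zero]
  rw [h0, Int.cast_zero, Int.cast_natCast, sub_zero, sub_zero, add_zero] at this
  rw [← sub_eq_zero, ← neg_eq_zero, ← this]
  module

lemma bracket (hc : IsNormalCocycle ρS ρV c) (hp : 3 < p) (hN : IsDensityRep p p ν ρV) {i j : ℕ}
    (hi : 1 ≤ i) (hj : 1 ≤ j) (hi2 : i + 2 ≤ p) (hj2 : j + 2 ≤ p) :
    ((j : K) - i) • c (i + j : ℕ) (basisVec K p 0)
      = ρS i (c j (basisVec K p 0)) - ρS j (c i (basisVec K p 0)) := by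
  have := (mem_cocycles_iff.1 hc.mem).2.1 i j (by omega) (by omega) (by omega) (by omega)
    (basisVec K p 0)
  rw [hN.lower_zero hp (by omega) (by omega), hN.lower_zero hp (by omega) (by omega),
    if_neg (by omega), if_neg (by omega), map_zero, map_zero, sub_zero, add_zero] at this
  rw [← sub_eq_zero, ← this]
  push_cast
  abel

lemma eq_zero_of_forall (hc : IsNormalCocycle ρS ρV c) (hp : 3 < p)
    (hN : IsDensityRep p p ν ρV) (h : ∀ j : ℕ, j + 2 ≤ p → c j (basisVec K p 0) = 0) : c = 0 := by
  have H : ∀ j : ℕ, c ((j : ℤ) - 1) = 0 := by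
    intro j
    induction j with
    | zero => simpa using hc.neg_one
    | succ j ih =>
      rw [Nat.cast_succ, add_sub_cancel_right]
      by_cases hj : j + 2 ≤ p
      · have hs : ∀ n, ρS (-1) (c j n) = c j (ρV (-1) n) := fun n => by
          rw [hc.shift hp (by omega) (by omega), ih, LinearMap.zero_apply, smul_zero, add_zero]
        refine linearMap_ext_basisVec fun i _ => ?_
        rw [map_basisVec_eq_pow hN hs, h j hj, map_zero, LinearMap.zero_apply]
      · exact hc.supp (by omega)
  funext k
  rcases lt_or_ge k (-1) with hk | hk
  · exact hc.supp (Or.inl hk)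
  · have := H (k + 1).toNat
    rwa [show (((k + 1).toNat : ℕ) : ℤ) - 1 = k by omega] at this

lemma zero_of_lt {j : ℕ} (hc : IsNormalCocycle ρS ρV c) (h : ¬ j + 2 ≤ p) :
    c j (basisVec K p 0) = 0 := by
  rw [hc.supp (by omega), LinearMap.zero_apply]

lemma lower_one_of_one_eq_zero (hc : IsNormalCocycle ρS ρV c) (hp : 3 < p)
    (hN : IsDensityRep p p ν ρV) (h1 : c 1 (basisVec K p 0) = 0) {j : ℕ} (hj : 1 ≤ j)
    (hj2 : j + 2 ≤ p) :
    ρS 1 (c j (basisVec K p 0)) = ((j : K) - 1) • c (j + 1 : ℕ) (basisVec K p 0) := by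
  have := hc.bracket hp hN le_rfl hj (by omega) hj2
  rw [Nat.cast_one, Nat.cast_one, h1, map_zero, sub_zero, add_comm 1 j] at this
  exact this.symm

lemma eq_zero_of_one_two [CharP K p] (hc : IsNormalCocycle ρS ρV c) (hp : 3 < p)
    (hN : IsDensityRep p p ν ρV) (h1 : c 1 (basisVec K p 0) = 0)
    (h2 : c 2 (basisVec K p 0) = 0) : c = 0 := by
  refine hc.eq_zero_of_forall hp hN fun j => ?_
  rcases j with _ | _ | j
  · exact fun _ => hc.zero
  · exact fun _ => h1
  induction j with
  | zero => exact fun _ => h2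
  | succ j ih =>
    intro hj
    have := hc.lower_one_of_one_eq_zero hp hN h1 (j := j + 1 + 1) (by omega) (by omega)
    rw [ih (by omega), map_zero, eq_comm] at this
    refine (smul_eq_zero.1 this).resolve_left ?_
    have h := natCast_ne_zero_of_lt (K := K) (p := p) (Nat.succ_pos j) (by omega)
    push_cast at h ⊢
    rwa [add_sub_cancel_right]

lemma eq_zero_of_one [CharP K p] (hc : IsNormalCocycle ρS ρV c) (hp : 3 < p)
    (hM : IsDensityRep p (p - 1) (-1) ρS) (hN : IsDensityRep p p ν ρV) (hν : ν = 0 ∨ ν = -1)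
    (h1 : c 1 (basisVec K p 0) = 0) : c = 0 := by
  have H : ∀ d j : ℕ, 2 ≤ j → p ≤ d + j → c j (basisVec K p 0) = 0 := by
    intro d
    induction d with
    | zero => exact fun j hj hd => hc.zero_of_lt (by omega)
    | succ d ih =>
      intro j hj hd
      by_cases hj2 : j + 2 ≤ p
      · refine eq_zero_of_lower_one_eq_zero hp hM (hc.weight hp hN j hj2) ?_ ?_
        · rw [Ne, eq_neg_iff_add_eq_zero]
          rcases hν with rfl | rfl
          · have h := natCast_ne_zero_of_lt (K := K) (p := p) (Nat.succ_pos j) (by omega)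
            push_cast at h
            rwa [zero_add]
          · have h := natCast_ne_zero_of_lt (K := K) (p := p) (a := j) (by omega) (by omega)
            rwa [neg_add_cancel_comm]
        · rw [hc.lower_one_of_one_eq_zero hp hN h1 (by omega) hj2, ih (j + 1) (by omega) (by omega),
            smul_zero]
      · exact hc.zero_of_lt hj2
  exact hc.eq_zero_of_one_two hp hN h1 (H p 2 le_rfl (by omega))

end IsNormalCocycle

lemma exists_gauge [CharP K p] (hp : 3 < p) (hprime : p.Prime)
    (hM : IsDensityRep p (p - 1) (-1) ρS) (hN : IsDensityRep p p ν ρV) (hν : ν ^ p = ν)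
    {c : ℤ → (Fin p → K) →ₗ[K] (Fin (p - 1) → K)} (hc : c ∈ cocycles K p (-1) ρS ρV)
    (m : Fin (p - 1) → K) :
    ∃ c' ∈ cocycles K p (-1) ρS ρV, c - c' ∈ coboundaries K p (-1) ρS ρV ∧ c' (-1) = 0 ∧
      c' 0 (basisVec K p 0) = c 0 (basisVec K p 0) - (ρS 0 m - ν • m) ∧
      ∀ j : ℕ, 1 ≤ j → j + 2 ≤ p →
        c' j (basisVec K p 0) = c j (basisVec K p 0) - ρS j m := by
  have h1 : ((-1 : K)) ^ p = -1 := (hprime.odd_of_ne_two (by omega)).neg_one_pow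
  have hh := (mem_cocycles_iff.1 hc).2.2 (-1) le_rfl (by omega) (basisVec K p 0)
  rw [if_neg (by omega)] at hh
  obtain ⟨f, hf0, hf⟩ := exists_shift_primitive hM hN (by omega) (by omega) (c (-1)) hh m
  have hd : (fun k => ρS k ∘ₗ f - f ∘ₗ ρV k) ∈ coboundaries K p (-1) ρS ρV :=
    mem_coboundaries_of_forall hM hN f fun k n => rfl
  refine ⟨c - fun k => ρS k ∘ₗ f - f ∘ₗ ρV k, sub_mem hc (coboundaries_le_cocycles hp hprime hM hN
    (by omega) (by omega) (by omega) le_rfl h1 hν hd), by rwa [sub_sub_cancel], ?_, ?_, ?_⟩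
  · refine LinearMap.ext fun n => ?_
    simp [hf]
  · simp [hN.lower_zero hp (by omega) le_rfl, hf0]
  · intro j hj hj2
    simp [hN.lower_zero hp (by omega) (Int.natCast_nonneg j), hf0, show j ≠ 0 by omega]

lemma exists_isNormalCocycle [CharP K p] (hp : 3 < p) (hprime : p.Prime)
    (hM : IsDensityRep p (p - 1) (-1) ρS) (hN : IsDensityRep p p ν ρV) (hν : ν ^ p = ν)
    {c : ℤ → (Fin p → K) →ₗ[K] (Fin (p - 1) → K)} (hc : c ∈ cocycles K p (-1) ρS ρV) :
    ∃ c', IsNormalCocycle ρS ρV c' ∧ c - c' ∈ coboundaries K p (-1) ρS ρV := by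
  obtain ⟨c', hc', hcc, h1, h0, -⟩ := exists_gauge hp hprime hM hN hν hc
    fun k => c 0 (basisVec K p 0) k / (-((k : K) + 1) - ν)
  refine ⟨c', ⟨hc', h1, ?_⟩, hcc⟩
  rw [h0]
  funext k
  rw [Pi.sub_apply, Pi.sub_apply, Pi.smul_apply, weight_apply hp hM, smul_eq_mul, ← sub_mul]
  rcases eq_or_ne (-((k : K) + 1) - ν) 0 with hk | hk
  · have hpow : ∀ a, (ρV 0 ^ a) (basisVec K p 0) = ν ^ a • basisVec K p 0 := by
      intro a
      induction a with
      | zero => simp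
      | succ a ih =>
        rw [pow_succ', Module.End.mul_apply, ih, map_smul, hN.lower_zero hp (by omega) le_rfl,
          if_pos rfl, smul_smul, pow_succ]
    have := congrFun ((mem_cocycles_iff.1 hc).2.2 0 (by omega) (by omega) (basisVec K p 0)) k
    rw [if_pos rfl, Finset.sum_apply, Finset.sum_congr rfl (g := fun _ =>
      ν ^ (p - 1) * c 0 (basisVec K p 0) k)] at this
    · rw [hk, zero_mul, ← this]; simp
    · intro a ha
      rw [hpow, map_smul, map_smul, Pi.smul_apply, weight_pow_apply hp hM, sub_eq_zero.1 hk,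
        smul_eq_mul, ← mul_assoc, ← pow_add]
      congr 2
      have := Finset.mem_range.1 ha
      omega
  · rw [mul_div_cancel₀ _ hk, sub_self, Pi.zero_apply]

namespace IsNormalCocycle

variable {c : ℤ → (Fin p → K) →ₗ[K] (Fin (p - 1) → K)}

lemma exists_one_eq_zero [CharP K p] (hc : IsNormalCocycle ρS ρV c) (hp : 3 < p)
    (hprime : p.Prime) (hM : IsDensityRep p (p - 1) (-1) ρS) (hN : IsDensityRep p p ν ρV)
    (hν : ν ^ p = ν) {n : ℕ} (hn : ν = -((n : K) + 1)) (hn1 : 1 ≤ n) (hnp : n + 2 ≤ p) :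
    ∃ c', IsNormalCocycle ρS ρV c' ∧ c - c' ∈ coboundaries K p (-1) ρS ρV ∧
      c' 1 (basisVec K p 0) = 0 := by
  have hw := hc.weight hp hN 1 (by omega)
  obtain ⟨a, ha⟩ := exists_smul_basisVec_of_weight hp hM (m := n - 1) (by omega) (hw.trans (by
    congr 1; rw [hn]; push_cast [hn1]; ring))
  obtain ⟨c', hc', hcc, h1, h0, hj⟩ := exists_gauge hp hprime hM hN hν hc.mem
    ((a / (((n : K) + 1) * n)) • basisVec K (p - 1) n)
  refine ⟨c', ⟨hc', h1, ?_⟩, hcc, ?_⟩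
  · rw [h0, hc.zero, map_smul, weight_basisVec hp hM, hn]
    module
  · have h2 := natCast_ne_zero_of_lt (K := K) (p := p) hn1 (by omega)
    have h3 := natCast_ne_zero_of_lt (K := K) (p := p) (Nat.succ_pos n) (by omega)
    push_cast at h3
    have := hj 1 le_rfl (by omega)
    rw [Nat.cast_one] at this ha
    rw [this, ha, map_smul, lower_one_basisVec hp hM (by omega), smul_smul,
      div_mul_cancel₀ _ (mul_ne_zero h3 h2), sub_self]

lemma exists_lower_eq (hc : IsNormalCocycle ρS ρV c) (hp : 3 < p)
    (hM : IsDensityRep p (p - 1) (-1) ρS) (hN : IsDensityRep p p ν ρV)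
    (h : c ∈ coboundaries K p (-1) ρS ρV) :
    ∃ m, ρS 0 m = ν • m ∧ ∀ j : ℕ, 1 ≤ j → j + 2 ≤ p → c j (basisVec K p 0) = ρS j m := by
  obtain ⟨f, hf⟩ := exists_of_mem_coboundaries hM hN h
  refine ⟨f (basisVec K p 0), ?_, fun j hj hj2 => ?_⟩
  · have := hf 0 (basisVec K p 0)
    rwa [hc.zero, hN.lower_zero hp (by omega) le_rfl, if_pos rfl, map_smul, eq_comm,
      sub_eq_zero] at this
  · rw [hf, hN.lower_zero hp (by omega) (by omega), if_neg (by omega), map_zero, sub_zero]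

lemma two_eq_zero [CharP K p] (hc : IsNormalCocycle ρS ρV c) (hp : 3 < p)
    (hM : IsDensityRep p (p - 1) (-1) ρS) (hN : IsDensityRep p p ν ρV) {t : ℕ}
    (hn : ν = -((t : K) + 6)) (htp : t + 7 ≤ p) (h1 : c 1 (basisVec K p 0) = 0) :
    c 2 (basisVec K p 0) = 0 := by
  obtain ⟨a, ha⟩ := exists_smul_basisVec_of_weight hp hM (m := t + 3) (by omega)
    ((hc.weight hp hN 2 (by omega)).trans (by congr 1; rw [hn]; push_cast; ring))
  have e3 := hc.lower_one_of_one_eq_zero hp hN h1 (j := 2) (by omega) (by omega)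
  have e4 := hc.lower_one_of_one_eq_zero hp hN h1 (j := 3) (by omega) (by omega)
  have e5 := hc.lower_one_of_one_eq_zero hp hN h1 (j := 4) (by omega) (by omega)
  have e := hc.bracket hp hN (i := 2) (j := 3) (by omega) (by omega) (by omega) (by omega)
  have d2 := hM.lower 2 (t + 2) (by omega) (by omega)
  have d3 := hM.lower 3 (t + 3) (by omega) (by omega)
  have b3 := lower_one_basisVec hp hM (m := t + 3) (by omega)
  have b2 := lower_one_basisVec hp hM (m := t + 2) (by omega)
  have b1 := lower_one_basisVec hp hM (m := t + 1) (by omega)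
  simp only [show t + 3 - 1 = t + 2 by omega, show t + 2 - 1 = t + 1 by omega,
    Nat.add_sub_cancel, Nat.reduceAdd] at b3 b2 b1 d2 d3 e e3 e4 e5
  have e3' : c (3 : ℕ) (basisVec K p 0) = ρS 1 (c (2 : ℕ) (basisVec K p 0)) := by
    rw [e3]; push_cast; module
  have key : ρS 1 (ρS 1 (ρS 1 (c (2 : ℕ) (basisVec K p 0))))
      = (6 : K) • (ρS (2 : ℕ) (ρS 1 (c (2 : ℕ) (basisVec K p 0)))
        - ρS (3 : ℕ) (c (2 : ℕ) (basisVec K p 0))) := by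
    rw [← e3', e4, map_smul, e5, ← e]
    push_cast
    module
  simp only [ha, map_smul, b3, b2, b1, d2, d3, smul_smul, ← sub_smul, wCoef,
    Nat.descFactorial_succ, Nat.descFactorial_zero] at key
  rw [← sub_eq_zero, ← sub_smul] at key
  have h0 := (smul_eq_zero.1 key).resolve_right (basisVec_ne_zero (by omega))
  simp only [show t + 3 - 1 = t + 2 by omega, show t + 2 - 1 = t + 1 by omega,
    show t + 3 - 2 = t + 1 by omega, Nat.sub_zero] at h0
  push_cast at h0
  have hz : a * (((t + 1 : ℕ) : K) * ((t + 2 : ℕ) : K) * ((t + 3 : ℕ) : K) * ((t + 4 : ℕ) : K)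
      * ((t + 5 : ℕ) : K) * ((t + 6 : ℕ) : K)) = 0 := by
    rw [← h0]
    push_cast
    ring
  have hne : ∀ i, 1 ≤ i → i ≤ 6 → ((t + i : ℕ) : K) ≠ 0 := fun i hi hi2 =>
    natCast_ne_zero_of_lt (p := p) (by omega) (by omega)
  have ha0 : a = 0 := by
    refine (mul_eq_zero.1 hz).resolve_right ?_
    simp only [mul_ne_zero_iff]
    refine ⟨⟨⟨⟨⟨?_, ?_⟩, ?_⟩, ?_⟩, ?_⟩, ?_⟩ <;> exact hne _ (by omega) (by omega)
  rw [ha0, zero_smul] at ha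
  exact_mod_cast ha

end IsNormalCocycle

lemma neg_one_pow_mul_descFactorial_mul_factorial [CharP K p] {j : ℕ} (hj : j + 1 ≤ p) (k : ℕ) :
    (-1 : K) ^ k * ((p - (j + 1)).descFactorial k : K) * (j.factorial : K)
      = ((j + k).factorial : K) := by
  induction k with
  | zero => simp
  | succ k ih =>
    rw [Nat.descFactorial_succ, ← add_assoc, Nat.factorial_succ, Nat.cast_mul _ (j + k).factorial,
      ← ih]
    rcases le_or_gt k (p - (j + 1)) with h | h
    · push_cast [h, hj]
      rw [CharP.cast_eq_zero]
      ring
    · rw [Nat.descFactorial_of_lt h]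
      simp

/-- The nonsplit extension of `V_0(0)` by `S`. -/
lemma exists_isNormalCocycle_zero [CharP K p] (hp : 3 < p) (hprime : p.Prime)
    (hM : IsDensityRep p (p - 1) (-1) ρS) (hN : IsDensityRep p p (0 : K) ρV) :
    ∃ c, IsNormalCocycle ρS ρV c ∧ c 1 (basisVec K p 0) = (2 : K) • basisVec K (p - 1) (p - 2) := by
  have hfac : ∀ j, p - 2 < j → ((j + 1).factorial : K) = 0 := fun j hj => by
    rw [CharP.cast_eq_zero_iff K p, hprime.dvd_factorial]
    omega
  have key := exists_cocycle hp hprime hM hN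
    (fun j => if j = 0 then 0 else ((j + 1).factorial : K) • basisVec K (p - 1) (p - 1 - j))
    (if_pos rfl) (fun j hj => by rw [hfac j hj, zero_smul, ite_self]) ?_ ?_
    (Or.inr ⟨rfl, ?_⟩)
  · obtain ⟨c, hc, h1, hv⟩ := key
    refine ⟨c, ⟨hc, h1, ?_⟩, ?_⟩
    · simpa using hv 0 (by omega)
    · simpa [Nat.factorial, show p - 1 - 1 = p - 2 by omega] using hv 1 (by omega)
  · intro j
    rcases lt_or_ge (p - 2) j with h | h
    · simp only [hfac j h, zero_smul, ite_self, map_zero, smul_zero]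
    split_ifs with h0
    · simp
    rw [map_smul, weight_basisVec hp hM, smul_comm, show p - 1 - j = p - (j + 1) by omega]
    congr 2
    push_cast [show j + 1 ≤ p by omega]
    rw [CharP.cast_eq_zero]
    ring
  · intro i j hi hij hj
    have hw : ∀ i j : ℕ, 1 ≤ i → 1 ≤ j → i + 2 ≤ p → j + 2 ≤ p →
        ((j + 1).factorial : K) * wCoef K (-1) i (p - 1 - j)
          = ((j : K) + 1) * j * ((i + j).factorial : K) := by
      intro i j hi hj hi2 hj2
      obtain ⟨j, rfl⟩ := Nat.exists_eq_add_of_le' hj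
      have := neg_one_pow_mul_descFactorial_mul_factorial (K := K) (p := p) (j := j) (by omega)
        (i + 1)
      rw [← sCoef_eq_wCoef, sCoef, show p - 1 - (j + 1) + 1 = p - (j + 1) by omega,
        show i + (j + 1) = j + (i + 1) by omega, ← this, Nat.factorial_succ, Nat.factorial_succ]
      push_cast
      ring
    simp only [show i ≠ 0 by omega, show j ≠ 0 by omega, show i + j ≠ 0 by omega, if_false]
    rw [map_smul, map_smul, hM.lower i _ (by omega) (by omega), hM.lower j _ hj (by omega),
      smul_smul, smul_smul, smul_smul, hw i j hi (by omega) (by omega) hj,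
      hw j i (by omega) hi hj (by omega), show p - 1 - j - i = p - 1 - (i + j) by omega,
      show p - 1 - i - j = p - 1 - (i + j) by omega, ← sub_smul, Nat.factorial_succ,
      add_comm j i]
    congr 1
    push_cast
    ring
  · rw [if_neg one_ne_zero, map_smul, hM.shift, basisVec_eq_zero (by omega), smul_zero]

/-- The nonsplit extensions of `V_0(p-3)`, `V_0(p-4)` and `V_0(p-5)` by `S`. -/
lemma exists_isNormalCocycle_two [CharP K p] (hp : 3 < p) (hprime : p.Prime)
    (hM : IsDensityRep p (p - 1) (-1) ρS) (hN : IsDensityRep p p ν ρV) {n : ℕ} (hn2 : 2 ≤ n)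
    (hn4 : n ≤ 4) (hnp : n + 2 ≤ p) (hν : ν = -((n : K) + 1)) :
    ∃ c, IsNormalCocycle ρS ρV c ∧ c 1 (basisVec K p 0) = 0 ∧
      c 2 (basisVec K p 0) = basisVec K (p - 1) (n - 2) := by
  let a : ℕ → K := fun j => if j = 2 then 1 else if j = 3 then (n - 1) * (n - 2)
    else if j = 4 then 3 * (n - 2) * (n - 3) else 0
  have ha : ∀ j, n < j → a j = 0 := by
    intro j hj
    simp only [a]
    split_ifs with h2 h3 h4
    · omega
    · obtain rfl : n = 2 := by omega
      simp
    · obtain rfl | rfl : n = 2 ∨ n = 3 := by omega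
      all_goals simp
    · rfl
  have key := exists_cocycle hp hprime hM hN
    (fun j => a j • basisVec K (p - 1) (n - j)) (by simp [a])
    (fun j hj => by rw [ha j (by omega), zero_smul]) ?_ ?_ (Or.inl (by simp [a]))
  · obtain ⟨c, hc, h1, hv⟩ := key
    refine ⟨c, ⟨hc, h1, ?_⟩, ?_, ?_⟩
    · simpa [a] using hv 0 (by omega)
    · simpa [a] using hv 1 (by omega)
    · simpa [a] using hv 2 (by omega)
  · intro j
    rcases lt_or_ge n j with h | h
    · simp [ha j h]
    rw [map_smul, weight_basisVec hp hM, smul_comm, hν]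
    congr 2
    push_cast [h]
    ring
  · intro i j hi hij hj
    rcases lt_or_ge n (i + j) with h | h
    · have hz : ∀ i j : ℕ, i + 2 ≤ p → n < i + j → ρS i (a j • basisVec K (p - 1) (n - j)) = 0 := by
        intro i j hi h
        rcases lt_or_ge n j with h' | h'
        · rw [ha j h', zero_smul, map_zero]
        · rw [map_smul, hM.lower i _ hi (by omega), wCoef_of_lt _ (by omega), zero_smul, smul_zero]
      rw [hz i j (by omega) h, hz j i hj (by omega), ha _ h]
      simp
    · obtain ⟨rfl, rfl | rfl⟩ : i = 1 ∧ (j = 2 ∨ j = 3) := by omega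
      · rw [map_smul, hM.lower 1 _ (by omega) (by omega), show n - 2 - 1 = n - (1 + 2) by omega]
        simp only [a, wCoef, Nat.descFactorial_one]
        push_cast [hn2]
        simp
        module
      · obtain rfl : n = 4 := by omega
        rw [map_smul, hM.lower 1 _ (by omega) (by omega)]
        simp [a, wCoef]
        module

end SimpleModule

lemma finrank_extSpace_eq_zero {M N : Type} [AddCommGroup M] [Module K M] [AddCommGroup N]
    [Module K N] {p : ℕ} {lo : ℤ} {ρM : ℤ → Module.End K M} {ρN : ℤ → Module.End K N}
    (h : cocycles K p lo ρM ρN ≤ coboundaries K p lo ρM ρN) :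
    Module.finrank K (extSpace K p lo ρM ρN) = 0 := by
  have : Subsingleton (extSpace K p lo ρM ρN) :=
    Submodule.Quotient.subsingleton_iff.2 (eq_top_iff.2 fun x _ => h x.2)
  exact Module.finrank_zero_of_subsingleton

lemma finrank_extSpace_eq_one {M N : Type} [AddCommGroup M] [Module K M] [AddCommGroup N]
    [Module K N] {p : ℕ} {lo : ℤ} {ρM : ℤ → Module.End K M} {ρN : ℤ → Module.End K N}
    {c₀ : ℤ → N →ₗ[K] M} (hc₀ : c₀ ∈ cocycles K p lo ρM ρN)
    (hb : c₀ ∉ coboundaries K p lo ρM ρN)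
    (h : ∀ c ∈ cocycles K p lo ρM ρN, ∃ a : K, c - a • c₀ ∈ coboundaries K p lo ρM ρN) :
    Module.finrank K (extSpace K p lo ρM ρN) = 1 := by
  refine finrank_eq_one (Submodule.Quotient.mk ⟨c₀, hc₀⟩) ?_ fun w => ?_
  · rw [Ne, Submodule.Quotient.mk_eq_zero]
    exact hb
  · obtain ⟨⟨c, hc⟩, rfl⟩ := Submodule.Quotient.mk_surjective _ w
    obtain ⟨a, ha⟩ := h c hc
    refine ⟨a, ?_⟩
    rw [← Submodule.Quotient.mk_smul, eq_comm, Submodule.Quotient.eq]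
    exact ha

/-- `V_0(0)` has a one-dimensional space of extensions by `S`. -/
lemma finrank_extSpace_zero {p : ℕ} [CharP K p] (hp : 3 < p) (hprime : p.Prime) :
    Module.finrank K (extSpace K p (-1) (sRho K p) (vermaRho K p 0 0)) = 1 := by
  have hM := isDensityRep_sRho (K := K) p hp
  have hN := isDensityRep_vermaRho (K := K) p hp 0
  obtain ⟨c₀, hc₀, h1⟩ := exists_isNormalCocycle_zero hp hprime hM hN
  have h2 : (2 : K) ≠ 0 := by
    exact_mod_cast natCast_ne_zero_of_lt (K := K) (p := p) two_pos (by omega)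
  refine finrank_extSpace_eq_one hc₀.mem (fun hb => ?_) fun c hc => ?_
  · obtain ⟨m, hm, hj⟩ := hc₀.exists_lower_eq hp hM hN hb
    have := hj 1 le_rfl (by omega)
    rw [eq_zero_of_weight_zero hp hM hm, map_zero, Nat.cast_one, h1] at this
    exact smul_ne_zero h2 (basisVec_ne_zero (by omega)) this
  · obtain ⟨c', hc', hcc⟩ := exists_isNormalCocycle hp hprime hM hN (zero_pow hprime.ne_zero) hc
    obtain ⟨a, ha⟩ := exists_smul_basisVec_of_weight hp hM (m := p - 2) (by omega)
      ((hc'.weight hp hN 1 (by omega)).trans (by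
        congr 1; push_cast [show 2 ≤ p by omega]; rw [CharP.cast_eq_zero]; ring))
    rw [Nat.cast_one] at ha
    refine ⟨a / 2, ?_⟩
    have := (hc'.sub_const_smul hc₀ (a / 2)).eq_zero_of_one hp hM hN (Or.inl rfl) (by
      simp [h1, ha, smul_smul, h2])
    rwa [← sub_eq_zero.1 this]

/-- For `λ = -(n + 1)` with `2 ≤ n ≤ 4`, the space of extensions is one-dimensional. -/
lemma finrank_extSpace_of_le_four {p : ℕ} [CharP K p] (hp : 3 < p) (hprime : p.Prime) {lam : K}
    (hlam : lam ^ p = lam) {n : ℕ} (hn : lam = -((n : K) + 1)) (hnp : n + 2 ≤ p) (hn2 : 2 ≤ n)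
    (hn4 : n ≤ 4) :
    Module.finrank K (extSpace K p (-1) (sRho K p) (vermaRho K p 0 lam)) = 1 := by
  have hM := isDensityRep_sRho (K := K) p hp
  have hN := isDensityRep_vermaRho (K := K) p hp lam
  obtain ⟨c₀, hc₀, h1, h2⟩ := exists_isNormalCocycle_two hp hprime hM hN hn2 hn4 hnp hn
  refine finrank_extSpace_eq_one hc₀.mem (fun hb => ?_) fun c hc => ?_
  · obtain ⟨m, hm, hj⟩ := hc₀.exists_lower_eq hp hM hN hb
    have hm1 := hj 1 le_rfl (by omega)
    have hm2 := hj 2 (by omega) (by omega)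
    rw [Nat.cast_one, h1] at hm1
    rw [eq_zero_of_lower_one_eq_zero hp hM hm ?_ hm1.symm, map_zero, Nat.cast_ofNat, h2] at hm2
    · exact basisVec_ne_zero (by omega) hm2
    · rw [hn, Ne, neg_inj, add_eq_right]
      exact natCast_ne_zero_of_lt (p := p) (by omega) (by omega)
  · obtain ⟨c₁, hc₁, hcc₁⟩ := exists_isNormalCocycle hp hprime hM hN hlam hc
    obtain ⟨c', hc', hcc', hc1⟩ :=
      hc₁.exists_one_eq_zero hp hprime hM hN hlam hn (by omega) hnp
    obtain ⟨a, ha⟩ := exists_smul_basisVec_of_weight hp hM (m := n - 2) (by omega)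
      ((hc'.weight hp hN 2 (by omega)).trans (by congr 1; rw [hn]; push_cast [hn2]; ring))
    rw [Nat.cast_ofNat] at ha
    have := (hc'.sub_const_smul hc₀ a).eq_zero_of_one_two hp hN (by simp [h1, hc1]) (by simp [h2, ha])
    refine ⟨a, ?_⟩
    rw [← sub_eq_zero.1 this, ← sub_add_sub_cancel c c₁ c']
    exact add_mem hcc₁ hcc'

/-- For `λ = -(n + 1)` with `n ≤ 1` or `5 ≤ n`, all extensions split. -/
lemma finrank_extSpace_of_five_le {p : ℕ} [CharP K p] (hp : 3 < p) (hprime : p.Prime) {lam : K}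
    (hlam : lam ^ p = lam) {n : ℕ} (hn : lam = -((n : K) + 1)) (hnp : n + 2 ≤ p)
    (hn5 : n ≤ 1 ∨ 5 ≤ n) :
    Module.finrank K (extSpace K p (-1) (sRho K p) (vermaRho K p 0 lam)) = 0 := by
  have hM := isDensityRep_sRho (K := K) p hp
  have hN := isDensityRep_vermaRho (K := K) p hp lam
  refine finrank_extSpace_eq_zero fun c hc => ?_
  obtain ⟨c₁, hc₁, hcc₁⟩ := exists_isNormalCocycle hp hprime hM hN hlam hc
  rcases Nat.eq_zero_or_pos n with rfl | hn1
  · have hl : lam = -1 := by rw [hn, Nat.cast_zero, zero_add]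
    have h1 := eq_zero_of_weight_zero hp hM ((hc₁.weight hp hN 1 (by omega)).trans (by
      congr 1; rw [hl]; push_cast; ring))
    rwa [hc₁.eq_zero_of_one hp hM hN (Or.inr hl) (by exact_mod_cast h1), sub_zero] at hcc₁
  · obtain ⟨c', hc', hcc', hc1⟩ := hc₁.exists_one_eq_zero hp hprime hM hN hlam hn hn1 hnp
    have h2 : c' 2 (basisVec K p 0) = 0 := by
      rcases hn5 with hn5 | hn5
      · obtain rfl : n = 1 := by omega
        exact_mod_cast eq_zero_of_weight_zero hp hM ((hc'.weight hp hN 2 (by omega)).trans (by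
          congr 1; rw [hn]; push_cast; ring))
      · obtain ⟨t, rfl⟩ := Nat.exists_eq_add_of_le' hn5
        exact hc'.two_eq_zero hp hM hN (t := t) (by rw [hn]; push_cast; ring) (by omega) hc1
    rw [hc'.eq_zero_of_one_two hp hN hc1 h2, sub_zero] at hcc'
    simpa using add_mem hcc₁ hcc'

lemma exists_eq_neg_natCast_add_one {p : ℕ} [CharP K p] (hprime : p.Prime) {lam : K}
    (hlam : lam ^ p = lam) : ∃ n < p, lam = -((n : K) + 1) := by
  have := Fact.mk hprime
  obtain ⟨z, rfl⟩ := (mem_bot_iff_intCast p K).1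
    ((Subfield.mem_bot_iff_pow_eq_self K p).2 hlam)
  have hp : (0 : ℤ) < p := by exact_mod_cast hprime.pos
  refine ⟨((-z - 1) % p).toNat, ?_, ?_⟩
  · have := Int.emod_lt_of_pos (-z - 1) hp
    omega
  · have h := (CharP.intCast_eq_intCast K p).2 (Int.mod_modEq (-z - 1) p)
    rw [← Int.cast_natCast, Int.toNat_of_nonneg (Int.emod_nonneg _ hp.ne'), h]
    push_cast
    ring

end DensityModules

open scoped Classical in
/-- For `χ = 0` and `λ ∈ F_p`, in the category of restricted `W`-modules,
`Ext(V_0(λ), S) ≅ K` if `λ ∈ {0, p-3, p-4, p-5}` and `Ext(V_0(λ), S) = 0` otherwise. -/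
theorem ext_verma_S
    (K : Type) [Field K] [IsAlgClosed K] (p : ℕ) [CharP K p] (hp : 3 < p)
    (lam : K) (hlam : lam ^ p = lam) :
    Module.finrank K (extSpace K p (-1) (sRho K p) (vermaRho K p 0 lam))
      = if lam = 0 ∨ lam = (p : K) - 3 ∨ lam = (p : K) - 4 ∨ lam = (p : K) - 5
        then 1 else 0 := by
  have hprime : p.Prime := (CharP.char_is_prime_or_zero K p).resolve_right (by omega)
  have hp5 : 5 ≤ p := by
    by_contra h
    obtain rfl : p = 4 := by omega
    exact absurd hprime (by decide)
  obtain ⟨n, hnp, hn⟩ := exists_eq_neg_natCast_add_one hprime hlam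
  have hinj : ∀ m < p, lam = (p : K) - (m + 1) ↔ n = m := fun m hm => by
    rw [hn, CharP.cast_eq_zero K p, zero_sub, neg_inj, add_left_inj]
    exact (CharP.natCast_injOn_Iio K p).eq_iff hnp hm
  have h0 : lam = 0 ↔ n + 1 = p := by
    rw [hn, neg_eq_zero, ← Nat.cast_succ, CharP.cast_eq_zero_iff K p]
    exact ⟨fun h => le_antisymm hnp (Nat.le_of_dvd n.succ_pos h), fun h => h.symm.dvd⟩
  have h3 : lam = (p : K) - 3 ↔ n = 2 := by rw [← hinj 2 (by omega)]; norm_num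
  have h4 : lam = (p : K) - 4 ↔ n = 3 := by rw [← hinj 3 (by omega)]; norm_num
  have h5 : lam = (p : K) - 5 ↔ n = 4 := by rw [← hinj 4 (by omega)]; norm_num
  rw [h0, h3, h4, h5]
  split_ifs with h
  · rcases eq_or_ne (n + 1) p with h' | h'
    · obtain rfl := h0.2 h'
      exact finrank_extSpace_zero hp hprime
    · exact finrank_extSpace_of_le_four hp hprime hlam hn (by omega) (by omega) (by omega)
  · exact finrank_extSpace_of_five_le hp hprime hlam hn (by omega) (by omega)
end

section
/- Let χ = 0 and λ ∈ F_p. Then Ext(S, V_0(λ)), taken in the category of restricted W-modules (U_0(W)-modules), is isomorphic to K if λ ∈ {2, 3, 4, p-1}, and is 0 otherwise. -/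
/-!
Common setup: the Witt algebra `W` over `K` (char `p > 3`) has basis
`e_{-1}, e_0, ..., e_{p-2}` with `[e_i, e_j] = (j-i) e_{i+j}` (and `e_k = 0`
outside the range), and `p`-mapping `e_i^{[p]} = δ_{i0} e_i`.  A module with
`p`-character `χ` over `W` (resp. the subalgebra `W_0 = <e_0, ..., e_{p-2}>`)
is given by a family of endomorphisms `ρ k` (`k : ℤ`, vanishing outside
`[lo, p-2]` where `lo = -1` for `W` and `lo = 0` for `W_0`) satisfying the
bracket relations and `(ρ i)^p - δ_{i0} ρ i = χ(e_i)^p • 1`.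

The Baer Ext space `Ext(N, M)` of two such modules, in the category of
modules with `p`-character `χ`, is realized concretely: an extension
`0 → M → E → N → 0` admits a linear splitting `E ≃ M ⊕ N`, under which the
action of `e_k` is `(m, n) ↦ (ρM k m + c k n, ρN k n)` for a "cocycle"
`c : ℤ → (N →ₗ M)`; the conditions for `E` to be a module with `p`-character
`χ` are the cocycle conditions below, Baer equivalence corresponds to
differing by a coboundary, and the Baer sum / scalar action correspond to the
linear structure on cocycles.  So `Ext(N, M) ≅ cocycles / coboundaries`.
-/

set_option maxHeartbeats 1000000
set_option synthInstance.maxHeartbeats 1000000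

namespace WittExt

section Coordinates

variable {K : Type} [Field K]

/-- The `k`-th coordinate functional on `Fin n → K`, extended by `0` to `k ≥ n`. -/
def coord (K : Type) [Field K] (n k : ℕ) : (Fin n → K) →ₗ[K] K :=
  if h : k < n then LinearMap.proj ⟨k, h⟩ else 0

theorem coord_of_lt {n k : ℕ} (h : k < n) (x : Fin n → K) : coord K n k x = x ⟨k, h⟩ := by
  simp [coord, h]

theorem coord_of_le {n k : ℕ} (h : n ≤ k) (x : Fin n → K) : coord K n k x = 0 := by
  simp [coord, Nat.not_lt.2 h]

theorem coord_ext {n : ℕ} {x y : Fin n → K} (h : ∀ k < n, coord K n k x = coord K n k y) :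
    x = y := by
  ext k
  simpa [coord_of_lt] using h k k.2

theorem sum_ite_eq_coord {n : ℕ} (a : ℕ → K) (m : ℕ) (x : Fin n → K) :
    ∑ l : Fin n, (if (l : ℕ) = m then a l else 0) * x l = a m * coord K n m x := by
  by_cases h : m < n
  · rw [Finset.sum_eq_single ⟨m, h⟩]
    · simp [coord_of_lt h]
    · intro b _ hb
      have : (b : ℕ) ≠ m := fun hbm => hb (Fin.ext hbm)
      simp [this]
    · simp
  · rw [coord_of_le (not_lt.1 h), mul_zero]
    refine Finset.sum_eq_zero fun l _ => ?_
    have : (l : ℕ) ≠ m := by omega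
    simp [this]

variable {p : ℕ} {lam : K}

theorem coord_vermaRho_neg_one_zero (x : Fin p → K) :
    coord K p 0 (vermaRho K p 0 lam (-1) x) = 0 := by
  by_cases h : 0 < p
  · simp [coord_of_lt h, vermaRho, vermaMat, Matrix.mulVec, dotProduct]
  · exact coord_of_le (not_lt.1 h) _

theorem coord_vermaRho_neg_one_succ {k : ℕ} (h : k + 1 < p) (x : Fin p → K) :
    coord K p (k + 1) (vermaRho K p 0 lam (-1) x) = coord K p k x := by
  have := sum_ite_eq_coord (fun _ => (1 : K)) k x
  simp only [one_mul] at this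
  rw [← this]
  simp [coord_of_lt h, vermaRho, vermaMat, Matrix.mulVec, dotProduct, eq_comm]

theorem coord_vermaRho_natCast {j k : ℕ} (hj : j + 2 ≤ p) (hk : k < p) (x : Fin p → K) :
    coord K p k (vermaRho K p 0 lam j x) = wCoef K lam j (k + j) * coord K p (k + j) x := by
  rw [← sum_ite_eq_coord (wCoef K lam j)]
  have h1 : ¬ ((j : ℤ) = -1) := by omega
  have h2 : (j : ℤ) ≤ (p : ℤ) - 2 := by omega
  simp [coord_of_lt hk, vermaRho, vermaMat, Matrix.mulVec, dotProduct, h1, h2]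

theorem vermaRho_of_gt {j : ℤ} (h : j < -1 ∨ (p : ℤ) - 2 < j) : vermaRho K p 0 lam j = 0 := by
  have h1 : ¬ (0 ≤ j ∧ j ≤ (p : ℤ) - 2) := by omega
  by_cases h2 : j = -1
  · subst h2
    ext x k
    have := k.2
    have : p = 0 := by omega
    omega
  · simp [vermaRho, vermaMat, h1, h2]

theorem coord_sRho_neg_one_zero (x : Fin (p - 1) → K) :
    coord K (p - 1) 0 (sRho K p (-1) x) = 0 := by
  by_cases h : 0 < p - 1
  · simp [coord_of_lt h, sRho, sMat, Matrix.mulVec, dotProduct]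
  · exact coord_of_le (not_lt.1 h) _

theorem coord_sRho_neg_one_succ {k : ℕ} (h : k + 1 < p - 1) (x : Fin (p - 1) → K) :
    coord K (p - 1) (k + 1) (sRho K p (-1) x) = coord K (p - 1) k x := by
  have := sum_ite_eq_coord (fun _ => (1 : K)) k x
  simp only [one_mul] at this
  rw [← this]
  simp [coord_of_lt h, sRho, sMat, Matrix.mulVec, dotProduct, eq_comm]

theorem coord_sRho_natCast {j k : ℕ} (hj : j + 2 ≤ p) (hk : k < p - 1) (x : Fin (p - 1) → K) :
    coord K (p - 1) k (sRho K p j x) = sCoef K j (k + j) * coord K (p - 1) (k + j) x := by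
  rw [← sum_ite_eq_coord (sCoef K j)]
  have h1 : ¬ ((j : ℤ) = -1) := by omega
  have h2 : (j : ℤ) ≤ (p : ℤ) - 2 := by omega
  simp [coord_of_lt hk, sRho, sMat, Matrix.mulVec, dotProduct, h1, h2]

theorem sRho_of_gt {j : ℤ} (h : j < -1 ∨ (p : ℤ) - 2 < j) : sRho K p j = 0 := by
  have h1 : ¬ (0 ≤ j ∧ j ≤ (p : ℤ) - 2) := by omega
  by_cases h2 : j = -1
  · subst h2
    ext x k
    have := k.2
    omega
  · simp [sRho, sMat, h1, h2]

end Coordinates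

section Commutators

variable {K : Type} [Field K] {p : ℕ} {lam : K}

theorem wCoef_succ (j n : ℕ) :
    wCoef K lam (j + 1) n - wCoef K lam (j + 1) (n + 1)
      = ((j : K) + 2) * wCoef K lam j n := by
  have h1 : ((n.descFactorial (j + 1) : ℕ) : K) = ((n : K) - j) * (n.descFactorial j : K) := by
    rcases le_or_gt j n with h | h
    · rw [Nat.descFactorial_succ]; push_cast [h]; ring
    · rw [Nat.descFactorial_of_lt h, Nat.descFactorial_of_lt (by omega)]; simp
  simp only [wCoef, h1, Nat.succ_descFactorial_succ]
  push_cast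
  ring

theorem sCoef_succ (j n : ℕ) :
    sCoef K (j + 1) n - sCoef K (j + 1) (n + 1) = ((j : K) + 2) * sCoef K j n := by
  have h1 : (((n + 1).descFactorial (j + 2) : ℕ) : K)
      = ((n : K) - j) * ((n + 1).descFactorial (j + 1) : K) := by
    rcases le_or_gt j n with h | h
    · rw [Nat.descFactorial_succ, show n + 1 - (j + 1) = n - j by omega]
      push_cast [h]; ring
    · rw [Nat.descFactorial_of_lt (by omega), Nat.descFactorial_of_lt (by omega)]; simp
  simp only [sCoef, Nat.succ_descFactorial_succ (n + 1)]
  rw [show j + 1 + 1 = j + 2 by omega, h1]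
  push_cast
  ring

theorem vermaRho_zero_coord {k : ℕ} (hp : 2 ≤ p) (x : Fin p → K) :
    coord K p k (vermaRho K p 0 lam 0 x) = (lam - k) * coord K p k x := by
  by_cases hk : k < p
  · have := coord_vermaRho_natCast (lam := lam) (j := 0) (by omega) hk x
    simpa [wCoef] using this
  · simp [coord_of_le (not_lt.1 hk)]

theorem sRho_zero_coord {k : ℕ} (hp : 2 ≤ p) (x : Fin (p - 1) → K) :
    coord K (p - 1) k (sRho K p 0 x) = -((k : K) + 1) * coord K (p - 1) k x := by
  by_cases hk : k < p - 1
  · have := coord_sRho_natCast (j := 0) (by omega) hk x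
    simpa [sCoef] using this
  · simp [coord_of_le (not_lt.1 hk)]

variable [CharP K p]

theorem vermaRho_commutator (hp : 3 < p) (j : ℤ) (hj : 0 ≤ j) :
    vermaRho K p 0 lam (-1) * vermaRho K p 0 lam j - vermaRho K p 0 lam j * vermaRho K p 0 lam (-1)
      = ((j : K) + 1) • vermaRho K p 0 lam (j - 1) := by
  obtain ⟨j, rfl⟩ := Int.eq_ofNat_of_zero_le hj
  have hpK : (p : K) = 0 := CharP.cast_eq_zero K p
  refine LinearMap.ext fun x => coord_ext fun k hk => ?_
  simp only [LinearMap.sub_apply, Module.End.mul_apply, LinearMap.smul_apply, map_sub, map_smul,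
    smul_eq_mul, Int.cast_natCast]
  rcases Nat.eq_zero_or_pos j with rfl | hj0
  · rcases k with _ | k
    · simp [coord_vermaRho_neg_one_zero, vermaRho_zero_coord (show 2 ≤ p by omega)]
    · simp only [coord_vermaRho_neg_one_succ hk, vermaRho_zero_coord (show 2 ≤ p by omega),
        Nat.cast_zero, zero_sub, zero_add]
      simp
      ring
  obtain ⟨j, rfl⟩ : ∃ i, j = i + 1 := ⟨j - 1, by omega⟩
  rcases le_or_gt (j + 3) p with h | h
  · have e : (((j + 1 : ℕ) : ℤ) - 1) = (j : ℕ) := by push_cast; ring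
    have key : coord K p k (vermaRho K p 0 lam ((j + 1 : ℕ) : ℤ) (vermaRho K p 0 lam (-1) x))
        = wCoef K lam (j + 1) (k + j + 1) * coord K p (k + j) x := by
      rw [coord_vermaRho_natCast (by omega) hk, ← add_assoc]
      rcases lt_trichotomy (k + j + 1) p with h1 | h1 | h1
      · rw [coord_vermaRho_neg_one_succ h1]
      · have h2 : ((k + j + 1 : ℕ) : K) = 0 := by rw [h1, hpK]
        rw [coord_of_le h1.ge, wCoef, Nat.succ_descFactorial_succ]
        push_cast at h2 ⊢
        simp [h2]
      · rw [coord_of_le h1.le, coord_of_le (by omega)]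
    have key2 : coord K p k (vermaRho K p 0 lam (-1) (vermaRho K p 0 lam ((j + 1 : ℕ) : ℤ) x))
        = wCoef K lam (j + 1) (k + j) * coord K p (k + j) x := by
      rcases k with _ | k
      · rw [coord_vermaRho_neg_one_zero]
        simp [wCoef]
      · rw [coord_vermaRho_neg_one_succ hk, coord_vermaRho_natCast (by omega) (by omega)]
        rw [show k + 1 + j = k + (j + 1) by omega]
    rw [key, key2, e, coord_vermaRho_natCast (by omega) hk, ← sub_mul, wCoef_succ]
    push_cast; ring
  · rw [vermaRho_of_gt (j := ((j + 1 : ℕ) : ℤ)) (by omega)]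
    rcases eq_or_ne (j + 2) p with h1 | h1
    · have : ((j + 1 : ℕ) : K) + 1 = 0 := by rw [← hpK, ← h1]; push_cast; ring
      rw [this]; simp
    · rw [vermaRho_of_gt (j := ((j + 1 : ℕ) : ℤ) - 1) (by omega)]
      simp

theorem sRho_commutator (hp : 3 < p) (j : ℤ) (hj : 0 ≤ j) :
    sRho K p (-1) * sRho K p j - sRho K p j * sRho K p (-1) = ((j : K) + 1) • sRho K p (j - 1) := by
  obtain ⟨j, rfl⟩ := Int.eq_ofNat_of_zero_le hj
  have hpK : (p : K) = 0 := CharP.cast_eq_zero K p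
  refine LinearMap.ext fun x => coord_ext fun k hk => ?_
  simp only [LinearMap.sub_apply, Module.End.mul_apply, LinearMap.smul_apply, map_sub, map_smul,
    smul_eq_mul, Int.cast_natCast]
  rcases Nat.eq_zero_or_pos j with rfl | hj0
  · rcases k with _ | k
    · simp [coord_sRho_neg_one_zero, sRho_zero_coord (show 2 ≤ p by omega)]
    · simp [coord_sRho_neg_one_succ hk, sRho_zero_coord (show 2 ≤ p by omega)]
      ring
  obtain ⟨j, rfl⟩ : ∃ i, j = i + 1 := ⟨j - 1, by omega⟩
  rcases le_or_gt (j + 3) p with h | h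
  · have e : (((j + 1 : ℕ) : ℤ) - 1) = (j : ℕ) := by push_cast; ring
    have key : coord K (p - 1) k (sRho K p ((j + 1 : ℕ) : ℤ) (sRho K p (-1) x))
        = sCoef K (j + 1) (k + j + 1) * coord K (p - 1) (k + j) x := by
      rw [coord_sRho_natCast (by omega) hk, ← add_assoc]
      rcases lt_trichotomy (k + j + 1) (p - 1) with h1 | h1 | h1
      · rw [coord_sRho_neg_one_succ h1]
      · have h2 : ((k + j + 1 + 1 : ℕ) : K) = 0 := by
          rw [show k + j + 1 + 1 = p by omega, hpK]
        rw [coord_of_le h1.ge, sCoef, Nat.succ_descFactorial_succ]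
        push_cast at h2 ⊢
        simp [h2]
      · rw [coord_of_le h1.le, coord_of_le (by omega)]
    have key2 : coord K (p - 1) k (sRho K p (-1) (sRho K p ((j + 1 : ℕ) : ℤ) x))
        = sCoef K (j + 1) (k + j) * coord K (p - 1) (k + j) x := by
      rcases k with _ | k
      · rw [coord_sRho_neg_one_zero]
        simp [sCoef]
      · rw [coord_sRho_neg_one_succ hk, coord_sRho_natCast (by omega) (by omega)]
        rw [show k + 1 + j = k + (j + 1) by omega]
    rw [key, key2, e, coord_sRho_natCast (by omega) hk, ← sub_mul, sCoef_succ]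
    push_cast; ring
  · rw [sRho_of_gt (j := ((j + 1 : ℕ) : ℤ)) (by omega)]
    rcases eq_or_ne (j + 2) p with h1 | h1
    · have : ((j + 1 : ℕ) : K) + 1 = 0 := by rw [← hpK, ← h1]; push_cast; ring
      rw [this]; simp
    · rw [sRho_of_gt (j := ((j + 1 : ℕ) : ℤ) - 1) (by omega)]
      simp

end Commutators

section Extension

variable {K : Type} [Field K]

/-- Suppose `R (-1)` acts on the operators `R j` as `e_{-1}` does on the `e_j` of the Witt algebra,
and that a set of functionals together with its translates under `R (-1)` separates points.
Then the bracket relations for `i, j ≥ 0` need only be tested on these functionals. -/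
theorem bracket_of_separating {E : Type} [AddCommGroup E] [Module K E] (R : ℤ → Module.End K E)
    (Q : Set (E →ₗ[K] K))
    (hD : ∀ j : ℤ, 0 ≤ j → R (-1) * R j - R j * R (-1) = ((j : K) + 1) • R (j - 1))
    (hsep : ∀ x, (∀ q ∈ Q, ∀ m : ℕ, q ((R (-1) ^ m) x) = 0) → x = 0)
    (hQ : ∀ q ∈ Q, ∀ i j : ℤ, 0 ≤ i → 0 ≤ j → ∀ x,
      q ((R i * R j - R j * R i - ((j - i : ℤ) : K) • R (i + j)) x) = 0)
    (i j : ℤ) (hi : 0 ≤ i) (hj : 0 ≤ j) :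
    R i * R j - R j * R i = ((j - i : ℤ) : K) • R (i + j) := by
  set B : ℤ → ℤ → Module.End K E :=
    fun i j => R i * R j - R j * R i - ((j - i : ℤ) : K) • R (i + j) with hB
  have hB1 : ∀ j, 0 ≤ j → B (-1) j = 0 := fun j hj => by
    simp only [hB, hD j hj, sub_neg_eq_add, Int.cast_add, Int.cast_one, neg_add_eq_sub, sub_self]
  have hB2 : ∀ j, 0 ≤ j → B j (-1) = 0 := fun j hj => by
    simp only [hB, show j + -1 = j - 1 by ring, ← neg_sub (R (-1) * R j), hD j hj]
    push_cast
    module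
  have hrec : ∀ i j, 0 ≤ i → 0 ≤ j → R (-1) * B i j
      = B i j * R (-1) + ((i : K) + 1) • B (i - 1) j + ((j : K) + 1) • B i (j - 1) := by
    intro i j hi hj
    have h1 := hD i hi
    have h2 := hD j hj
    have h3 := hD (i + j) (by omega)
    simp only [hB, show i - 1 + j = i + j - 1 by ring, show i + (j - 1) = i + j - 1 by ring]
    have e1 : ((i : K) + 1) • (R (i - 1) * R j - R j * R (i - 1))
        = (R (-1) * R i - R i * R (-1)) * R j - R j * (R (-1) * R i - R i * R (-1)) := by
      rw [h1, smul_mul_assoc, mul_smul_comm, smul_sub]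
    have e2 : ((j : K) + 1) • (R i * R (j - 1) - R (j - 1) * R i)
        = R i * (R (-1) * R j - R j * R (-1)) - (R (-1) * R j - R j * R (-1)) * R i := by
      rw [h2, smul_mul_assoc, mul_smul_comm, smul_sub]
    rw [smul_sub _ (R (i - 1) * R j - R j * R (i - 1)),
      smul_sub _ (R i * R (j - 1) - R (j - 1) * R i), e1, e2]
    rw [mul_sub (R (-1)), sub_mul _ _ (R (-1)), mul_smul_comm, smul_mul_assoc,
      eq_add_of_sub_eq h3]
    push_cast
    simp only [mul_sub, sub_mul, mul_assoc]
    module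
  have key : ∀ m : ℕ, ∀ q ∈ Q, ∀ i j, 0 ≤ i → 0 ≤ j → ∀ x,
      q ((R (-1) ^ m) (B i j x)) = 0 := by
    intro m
    induction m with
    | zero => intro q hq i j hi hj x; exact hQ q hq i j hi hj x
    | succ m ih =>
      intro q hq i j hi hj x
      have hrx := congrArg (fun T : Module.End K E => T x) (hrec i j hi hj)
      simp only [Module.End.mul_apply, LinearMap.add_apply, LinearMap.smul_apply] at hrx
      rw [pow_succ, Module.End.mul_apply, hrx]
      simp only [map_add, map_smul, ih q hq i j hi hj, zero_add]
      have hI : q ((R (-1) ^ m) (B (i - 1) j x)) = 0 := by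
        rcases eq_or_lt_of_le hi with rfl | hi
        · simp [hB1 j hj]
        · exact ih q hq _ _ (by omega) hj x
      have hJ : q ((R (-1) ^ m) (B i (j - 1) x)) = 0 := by
        rcases eq_or_lt_of_le hj with rfl | hj
        · simp [hB2 i hi]
        · exact ih q hq _ _ hi (by omega) x
      rw [hI, hJ]; simp
  have : B i j = 0 := LinearMap.ext fun x => hsep _ fun q hq m => key m q hq i j hi hj x
  exact sub_eq_zero.1 this

/-- The block upper triangular endomorphism `(m, x) ↦ (A m + c x, B x)`. -/
def extEnd {M N : Type} [AddCommGroup M] [Module K M] [AddCommGroup N] [Module K N]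
    (A : Module.End K M) (c : N →ₗ[K] M) (B : Module.End K N) : Module.End K (M × N) :=
  (A ∘ₗ LinearMap.fst K M N + c ∘ₗ LinearMap.snd K M N).prod (B ∘ₗ LinearMap.snd K M N)

section Blocks

variable {M N : Type} [AddCommGroup M] [Module K M] [AddCommGroup N] [Module K N]

@[simp]
theorem extEnd_apply (A : Module.End K M) (c : N →ₗ[K] M) (B : Module.End K N) (x : M × N) :
    extEnd A c B x = (A x.1 + c x.2, B x.2) := rfl

theorem extEnd_pow_apply (A : Module.End K M) (c : N →ₗ[K] M) (B : Module.End K N) (n : ℕ)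
    (x : M × N) :
    (extEnd A c B ^ n) x = ((A ^ n) x.1
      + ∑ k ∈ Finset.range n, (A ^ k) (c ((B ^ (n - 1 - k)) x.2)), (B ^ n) x.2) := by
  induction n with
  | zero => simp
  | succ n ih =>
    rw [pow_succ', Module.End.mul_apply, ih, extEnd_apply, Finset.sum_range_succ']
    refine Prod.ext ?_ ?_
    · simp only [map_add, map_sum, pow_succ', Module.End.mul_apply, add_assoc, pow_zero,
        Module.End.one_apply, Nat.add_sub_cancel, Nat.sub_zero]
      congr 2
      refine Finset.sum_congr rfl fun k _ => ?_
      rw [show n - (k + 1) = n - 1 - k by omega]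
    · simp [pow_succ']

end Blocks

variable {p : ℕ} {lam : K}

theorem coord_vermaRho_neg_one_pow {k m : ℕ} (h : k + m < p) (x : Fin p → K) :
    coord K p (k + m) ((vermaRho K p 0 lam (-1) ^ m) x) = coord K p k x := by
  induction m with
  | zero => simp
  | succ m ih =>
    rw [pow_succ', Module.End.mul_apply, ← add_assoc, coord_vermaRho_neg_one_succ (by omega),
      ih (by omega)]

theorem coord_sRho_neg_one_pow {k m : ℕ} (h : k + m < p - 1) (x : Fin (p - 1) → K) :
    coord K (p - 1) (k + m) ((sRho K p (-1) ^ m) x) = coord K (p - 1) k x := by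
  induction m with
  | zero => simp
  | succ m ih =>
    rw [pow_succ', Module.End.mul_apply, ← add_assoc, coord_sRho_neg_one_succ (by omega),
      ih (by omega)]

theorem eq_zero_of_coord_top (hp : 3 < p) (x : (Fin p → K) × (Fin (p - 1) → K))
    (h1 : ∀ m : ℕ, coord K p (p - 1) ((extEnd (vermaRho K p 0 lam (-1)) 0 (sRho K p (-1)) ^ m) x).1
      = 0)
    (h2 : ∀ m : ℕ,
      coord K (p - 1) (p - 2) ((extEnd (vermaRho K p 0 lam (-1)) 0 (sRho K p (-1)) ^ m) x).2
      = 0) : x = 0 := by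
  simp only [extEnd_pow_apply, LinearMap.zero_apply, map_zero, Finset.sum_const_zero,
    add_zero] at h1 h2
  refine Prod.ext (coord_ext fun k hk => ?_) (coord_ext fun k hk => ?_)
  · rw [← coord_vermaRho_neg_one_pow (lam := lam) (m := p - 1 - k) (by omega),
      show k + (p - 1 - k) = p - 1 by omega, h1]
    simp
  · rw [← coord_sRho_neg_one_pow (m := p - 2 - k) (by omega),
      show k + (p - 2 - k) = p - 2 by omega, h2]
    simp

variable [CharP K p]

/-- The top coordinate of `V_0(λ)` is a `W_0`-equivariant map onto the character `λ + 1`. -/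
theorem coord_top_vermaRho (hp : 3 < p) {i : ℤ} (hi : 0 ≤ i) (x : Fin p → K) :
    coord K p (p - 1) (vermaRho K p 0 lam i x)
      = (if i = 0 then lam + 1 else 0) * coord K p (p - 1) x := by
  have hpK : (p : K) = 0 := CharP.cast_eq_zero K p
  split_ifs with h
  · subst h
    rw [vermaRho_zero_coord (by omega), Nat.cast_sub (by omega), hpK]
    simp
  · by_cases h2 : (p : ℤ) - 2 < i
    · simp [vermaRho_of_gt (Or.inr h2)]
    · obtain ⟨i, rfl⟩ := Int.eq_ofNat_of_zero_le hi
      rw [coord_vermaRho_natCast (by omega) (by omega), coord_of_le (by omega)]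
      simp

/-- The top coordinate of `S` is a `W_0`-equivariant map onto the character `1`. -/
theorem coord_top_sRho (hp : 3 < p) {i : ℤ} (hi : 0 ≤ i) (x : Fin (p - 1) → K) :
    coord K (p - 1) (p - 2) (sRho K p i x)
      = (if i = 0 then 1 else 0) * coord K (p - 1) (p - 2) x := by
  have hpK : (p : K) = 0 := CharP.cast_eq_zero K p
  split_ifs with h
  · subst h
    rw [sRho_zero_coord (by omega), Nat.cast_sub (by omega), hpK]
    push_cast; ring
  · by_cases h2 : (p : ℤ) - 2 < i
    · simp [sRho_of_gt (Or.inr h2)]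
    · obtain ⟨i, rfl⟩ := Int.eq_ofNat_of_zero_le hi
      rw [coord_sRho_natCast (by omega) (by omega), coord_of_le (by omega)]
      simp

/-- The bracket relations on an extension normalised at `e_{-1}` follow from those of the
`W_0`-module extension obtained by taking top coordinates. -/
theorem extEnd_bracket (hp : 3 < p) (c : ℤ → (Fin (p - 1) → K) →ₗ[K] (Fin p → K))
    (hc : c (-1) = 0)
    (hcD : ∀ j : ℤ, 0 ≤ j → ∀ x, vermaRho K p 0 lam (-1) (c j x) - c j (sRho K p (-1) x)
      = ((j : K) + 1) • c (j - 1) x)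
    (hγ : ∀ i j : ℤ, 0 ≤ i → 0 ≤ j → ∀ x, ((j - i : ℤ) : K) * coord K p (p - 1) (c (i + j) x)
      = (if i = 0 then lam + 1 else 0) * coord K p (p - 1) (c j x)
        + coord K p (p - 1) (c i (sRho K p j x))
        - (if j = 0 then lam + 1 else 0) * coord K p (p - 1) (c i x)
        - coord K p (p - 1) (c j (sRho K p i x)))
    (i j : ℤ) (hi : 0 ≤ i) (hj : 0 ≤ j) :
    extEnd (vermaRho K p 0 lam i) (c i) (sRho K p i)
        * extEnd (vermaRho K p 0 lam j) (c j) (sRho K p j)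
      - extEnd (vermaRho K p 0 lam j) (c j) (sRho K p j)
        * extEnd (vermaRho K p 0 lam i) (c i) (sRho K p i)
      = ((j - i : ℤ) : K) •
        extEnd (vermaRho K p 0 lam (i + j)) (c (i + j)) (sRho K p (i + j)) := by
  refine bracket_of_separating
    (fun i => extEnd (vermaRho K p 0 lam i) (c i) (sRho K p i))
    {coord K p (p - 1) ∘ₗ LinearMap.fst K _ _, coord K (p - 1) (p - 2) ∘ₗ LinearMap.snd K _ _}
    (fun j hj => ?_) (fun x hx => ?_) (fun q hq i j hi hj x => ?_) i j hi hj
  · refine LinearMap.ext fun x => Prod.ext ?_ ?_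
    · have h1 := congrArg (fun T : Module.End K _ => T x.1)
        (vermaRho_commutator (lam := lam) hp j hj)
      have h2 := hcD j hj x.2
      simp only [LinearMap.sub_apply, Module.End.mul_apply, LinearMap.smul_apply] at h1
      simp only [LinearMap.sub_apply, Module.End.mul_apply, LinearMap.smul_apply, extEnd_apply,
        Prod.fst_sub, Prod.smul_fst, smul_add, ← h1, ← h2, hc, LinearMap.zero_apply, map_add,
        add_zero]
      abel
    · exact congrArg (fun T : Module.End K _ => T x.2) (sRho_commutator hp j hj)
  · simp only [hc] at hx
    exact eq_zero_of_coord_top hp x (fun m => hx _ (Set.mem_insert _ _) m)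
      (fun m => hx _ (Set.mem_insert_of_mem _ rfl) m)
  · rcases hq with rfl | rfl
    · have := hγ i j hi hj x.2
      have hs : ((j - i : ℤ) : K) * (if i + j = 0 then lam + 1 else 0) = 0 := by
        split_ifs with h
        · rw [show j - i = 0 by omega]; simp
        · simp
      simp only [LinearMap.sub_apply, Module.End.mul_apply, LinearMap.smul_apply, extEnd_apply,
        LinearMap.comp_apply, LinearMap.fst_apply,
        map_sub, map_add, map_smul, smul_eq_mul, coord_top_vermaRho hp hi,
        coord_top_vermaRho hp hj, coord_top_vermaRho hp (add_nonneg hi hj)]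
      linear_combination (-1 : K) * this - coord K p (p - 1) x.1 * hs
    · have hs : ((j - i : ℤ) : K) * (if i + j = 0 then (1 : K) else 0) = 0 := by
        split_ifs with h
        · rw [show j - i = 0 by omega]; simp
        · simp
      simp only [LinearMap.sub_apply, Module.End.mul_apply, LinearMap.smul_apply, extEnd_apply,
        LinearMap.comp_apply, LinearMap.snd_apply,
        map_sub, map_smul, smul_eq_mul, coord_top_sRho hp hi,
        coord_top_sRho hp hj, coord_top_sRho hp (add_nonneg hi hj)]
      linear_combination - coord K (p - 1) (p - 2) x.2 * hs

theorem module_bracket (hp : 3 < p) (i j : ℤ) (hi : -1 ≤ i) (hj : -1 ≤ j) :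
    (∀ x, vermaRho K p 0 lam i (vermaRho K p 0 lam j x)
      - vermaRho K p 0 lam j (vermaRho K p 0 lam i x)
      = ((j - i : ℤ) : K) • vermaRho K p 0 lam (i + j) x) ∧
    (∀ x, sRho K p i (sRho K p j x) - sRho K p j (sRho K p i x)
      = ((j - i : ℤ) : K) • sRho K p (i + j) x) := by
  have hV : ∀ j : ℤ, 0 ≤ j → ∀ x, vermaRho K p 0 lam (-1) (vermaRho K p 0 lam j x)
      - vermaRho K p 0 lam j (vermaRho K p 0 lam (-1) x)
      = ((j : K) + 1) • vermaRho K p 0 lam (j - 1) x := fun j hj x =>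
    congrArg (fun T : Module.End K _ => T x) (vermaRho_commutator (lam := lam) hp j hj)
  have hS : ∀ j : ℤ, 0 ≤ j → ∀ x, sRho K p (-1) (sRho K p j x) - sRho K p j (sRho K p (-1) x)
      = ((j : K) + 1) • sRho K p (j - 1) x := fun j hj x =>
    congrArg (fun T : Module.End K _ => T x) (sRho_commutator (K := K) hp j hj)
  rcases eq_or_lt_of_le hi with rfl | hi
  · rcases eq_or_lt_of_le hj with rfl | hj
    · simp
    · rw [show -1 + j = j - 1 by ring]
      simp only [hV j (by omega), hS j (by omega)]
      simp
  · rcases eq_or_lt_of_le hj with rfl | hj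
    · have e : ((-1 - i : ℤ) : K) = -((i : K) + 1) := by push_cast; ring
      simp only [e, neg_smul, ← sub_eq_add_neg, ← hV i (by omega), ← hS i (by omega)]
      simp
    · have := extEnd_bracket (lam := lam) hp 0 rfl (by simp) (by simp) i j (by omega) (by omega)
      refine ⟨fun x => ?_, fun x => ?_⟩
      · have h := congrArg (fun T : Module.End K _ => (T (x, 0)).1) this
        simpa using h
      · have h := congrArg (fun T : Module.End K _ => (T (0, x)).2) this
        simpa using h

end Extension

section Weights

variable {K : Type} [Field K] {p : ℕ}

/-- The falling product `τ (τ - 1) ⋯ (τ - n + 1)`. -/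
def fall (τ : K) (n : ℕ) : K := ∏ t ∈ Finset.range n, (τ - t)

/-- `F` is a weight vector of weight `-τ` in the dual of `S`. -/
def IsWeight (τ : K) (F : (Fin (p - 1) → K) →ₗ[K] K) : Prop :=
  ∀ x, F (sRho K p 0 x) = τ * F x

theorem sCoef_eq_prod (j m : ℕ) :
    sCoef K j (m + j) = ∏ t ∈ Finset.range (j + 1), (-((m : K) + 1) - t) := by
  rw [sCoef, add_assoc, Nat.add_descFactorial_eq_ascFactorial, Nat.ascFactorial_eq_prod_range,
    Nat.cast_prod, ← Finset.card_range (j + 1), ← Finset.prod_const, Finset.card_range,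
    ← Finset.prod_mul_distrib]
  refine Finset.prod_congr rfl fun t _ => ?_
  push_cast; ring

theorem apply_eq_sum (F : (Fin (p - 1) → K) →ₗ[K] K) (x : Fin (p - 1) → K) :
    F x = ∑ k, x k * F (Pi.single k 1) := by
  rw [LinearMap.pi_apply_eq_sum_univ F x]
  refine Finset.sum_congr rfl fun k _ => ?_
  rw [smul_eq_mul]
  congr 2
  ext i
  simp [Pi.single_apply, eq_comm]

theorem sRho_zero_single (hp : 3 < p) (k : Fin (p - 1)) :
    sRho K p 0 (Pi.single k 1) = (-((k : K) + 1)) • Pi.single k 1 := by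
  refine coord_ext fun l hl => ?_
  rw [sRho_zero_coord (by omega), map_smul, coord_of_lt hl, smul_eq_mul]
  by_cases h : (⟨l, hl⟩ : Fin (p - 1)) = k
  · subst h; simp
  · simp [h]

theorem sRho_zero_pow_single (hp : 3 < p) (k : Fin (p - 1)) (m : ℕ) :
    (sRho K p 0 ^ m) (Pi.single k 1) = (-((k : K) + 1)) ^ m • Pi.single k 1 := by
  induction m with
  | zero => simp
  | succ m ih =>
    rw [pow_succ', Module.End.mul_apply, ih, map_smul, sRho_zero_single hp, smul_smul, ← pow_succ]

namespace IsWeight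

variable {τ : K} {F G : (Fin (p - 1) → K) →ₗ[K] K}

theorem sub (hF : IsWeight τ F) (hG : IsWeight τ G) : IsWeight τ (F - G) := fun x => by
  simp only [LinearMap.sub_apply, hF x, hG x, mul_sub]

theorem smul (a : K) (hF : IsWeight τ F) : IsWeight τ (a • F) := fun x => by
  simp only [LinearMap.smul_apply, hF x, smul_eq_mul]; ring

theorem mul_single (hp : 3 < p) (hF : IsWeight τ F) (k : Fin (p - 1)) :
    (τ + ((k : K) + 1)) * F (Pi.single k 1) = 0 := by
  have := hF (Pi.single k 1)
  rw [sRho_zero_single hp, map_smul, smul_eq_mul] at this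
  linear_combination -this

variable [CharP K p]

theorem comp_sRho (hp : 3 < p) (hF : IsWeight τ F) {j : ℤ} (hj : 0 ≤ j) :
    IsWeight (τ - j) (F ∘ₗ sRho K p j) := fun x => by
  have h := (module_bracket (lam := (0 : K)) hp 0 j (by omega) (by omega)).2 x
  have h2 := congrArg F h
  simp only [map_sub, map_smul, smul_eq_mul, hF (sRho K p j x), zero_add, sub_zero] at h2
  simp only [LinearMap.comp_apply]
  linear_combination -h2

theorem apply_sRho_one (hp : 3 < p) (hF : IsWeight τ F) {j : ℕ} (hj : j + 2 ≤ p) :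
    F (sRho K p j 1) = fall τ (j + 1) * F 1 := by
  have hpK : (p : K) = 0 := CharP.cast_eq_zero K p
  rw [apply_eq_sum F 1, apply_eq_sum F, Finset.mul_sum]
  refine Finset.sum_congr rfl fun k _ => ?_
  rcases mul_eq_zero.1 (hF.mul_single hp k) with h | h
  · have hτ : τ = -((k : K) + 1) := by linear_combination h
    have e : sRho K p j 1 k = sCoef K j (k + j) := by
      rw [← coord_of_lt k.2 (sRho K p j 1), coord_sRho_natCast hj k.2]
      by_cases hk : (k : ℕ) + j < p - 1
      · rw [coord_of_lt hk]; simp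
      · rw [coord_of_le (not_lt.1 hk), mul_zero, sCoef_eq_prod]
        refine (Finset.prod_eq_zero (i := p - 1 - k) (Finset.mem_range.2 (by omega)) ?_).symm
        rw [Nat.cast_sub (by omega), Nat.cast_sub (by omega), hpK]
        push_cast; ring
    rw [e, sCoef_eq_prod, ← hτ]
    simp [fall]
  · simp [h]

theorem eq_zero (hp : 3 < p) (hF : IsWeight τ F) (h1 : F 1 = 0) : F = 0 := by
  have hsingle : ∀ k, F (Pi.single k 1) = 0 := by
    intro k
    by_contra hk
    have hk' := (mul_eq_zero.1 (hF.mul_single hp k)).resolve_right hk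
    rw [apply_eq_sum F, Finset.sum_eq_single k] at h1
    · exact hk (by simpa using h1)
    · intro l _ hlk
      rcases mul_eq_zero.1 (hF.mul_single hp l) with h | h
      · refine absurd (Fin.ext ?_) hlk
        have hkl : ((l : ℕ) : K) = ((k : ℕ) : K) := by linear_combination h - hk'
        exact CharP.natCast_injOn_Iio K p (Set.mem_Iio.2 (by omega)) (Set.mem_Iio.2 (by omega)) hkl
      · simp [h]
    · simp
  refine LinearMap.ext fun x => ?_
  rw [apply_eq_sum]
  simp [hsingle]

theorem eq_zero_of_weight_zero (hp : 3 < p) (hF : IsWeight (0 : K) F) : F = 0 := by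
  refine LinearMap.ext fun x => ?_
  rw [apply_eq_sum]
  refine Finset.sum_eq_zero fun k _ => ?_
  have hk : ((k + 1 : ℕ) : K) ≠ 0 := fun h => by
    have := Nat.le_of_dvd (by omega) ((CharP.cast_eq_zero_iff K p _).1 h)
    omega
  have := hF.mul_single hp k
  rw [zero_add, mul_eq_zero] at this
  rw [this.resolve_left (by exact_mod_cast hk), mul_zero]

end IsWeight

theorem exists_natCast_eq [CharP K p] (hp : 3 < p) {x : K} (hx : x ^ p = x) :
    ∃ n < p, (n : K) = x := by
  have hprime : p.Prime := (CharP.char_is_prime_or_zero K p).resolve_right (by omega)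
  have : Fact p.Prime := ⟨hprime⟩
  obtain ⟨n, hn⟩ := (mem_bot_iff_intCast p K).1
    ((Subfield.mem_bot_iff_pow_eq_self K p).2 hx)
  refine ⟨(n : ZMod p).val, ZMod.val_lt _, ?_⟩
  rw [← hn, ← ZMod.cast_eq_val, ZMod.cast_intCast (dvd_refl p)]

theorem exists_isWeight [CharP K p] (hp : 3 < p) {τ : K} (hτ : τ ^ p = τ) {a : K}
    (ha : τ = 0 → a = 0) : ∃ F : (Fin (p - 1) → K) →ₗ[K] K, IsWeight τ F ∧ F 1 = a := by
  have hpK : (p : K) = 0 := CharP.cast_eq_zero K p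
  obtain ⟨n, hn, rfl⟩ := exists_natCast_eq hp hτ
  rcases Nat.eq_zero_or_pos n with rfl | h0
  · exact ⟨0, fun x => by simp, by simp [ha (by simp)]⟩
  · refine ⟨a • coord K (p - 1) (p - 1 - n), IsWeight.smul _ fun x => ?_, ?_⟩
    · rw [sRho_zero_coord (by omega), Nat.cast_sub (by omega), Nat.cast_sub (by omega), hpK]
      push_cast; ring
    · simp [coord_of_lt (show p - 1 - n < p - 1 by omega)]

end Weights

section Cocycles

variable {K : Type} [Field K] {p : ℕ}

theorem mem_cocycles_iff {M N : Type} [AddCommGroup M] [Module K M] [AddCommGroup N] [Module K N]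
    {ρM : ℤ → Module.End K M} {ρN : ℤ → Module.End K N} {c : ℤ → N →ₗ[K] M} :
    c ∈ cocycles K p (-1) ρM ρN ↔
      (∀ k, k < -1 ∨ (p : ℤ) - 2 < k → c k = 0) ∧
      (∀ i j, -1 ≤ i → i ≤ (p : ℤ) - 2 → -1 ≤ j → j ≤ (p : ℤ) - 2 → ∀ x,
        ((j - i : ℤ) : K) • c (i + j) x
          = ρM i (c j x) + c i (ρN j x) - ρM j (c i x) - c j (ρN i x)) ∧
      (∀ i, -1 ≤ i → i ≤ (p : ℤ) - 2 → ∀ x,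
        ∑ k ∈ Finset.range p, (ρM i ^ k) (c i ((ρN i ^ (p - 1 - k)) x))
          = if i = 0 then c 0 x else 0) := by
  simp only [cocycles, Submodule.mem_inf, Submodule.mem_iInf, LinearMap.mem_ker, and_assoc]
  refine and_congr (forall_congr' fun k => ?_) (and_congr ?_ (forall_congr' fun i => ?_))
  · by_cases h : k < -1 ∨ (p : ℤ) - 2 < k <;> simp [suppConstraint, h]
  · refine forall_congr' fun i => forall_congr' fun j => ?_
    by_cases h : -1 ≤ i ∧ i ≤ (p : ℤ) - 2 ∧ -1 ≤ j ∧ j ≤ (p : ℤ) - 2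
    · rw [bracketConstraint, if_pos h]
      simp only [h.1, h.2.1, h.2.2.1, h.2.2.2, forall_true_left, LinearMap.ext_iff]
      refine forall_congr' fun x => ?_
      rw [← sub_eq_zero (a := ((j - i : ℤ) : K) • c (i + j) x)]
      simp only [LinearMap.add_apply, LinearMap.sub_apply, LinearMap.smul_apply,
        LinearMap.comp_apply, LinearMap.proj_apply, LinearMap.llcomp_apply,
        LinearMap.lcomp_apply, LinearMap.zero_apply]
      refine Eq.congr ?_ rfl
      abel
    · simp only [bracketConstraint, if_neg h, LinearMap.zero_apply, true_iff]
      intro h1 h2 h3 h4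
      exact absurd ⟨h1, h2, h3, h4⟩ h
  · by_cases h : -1 ≤ i ∧ i ≤ (p : ℤ) - 2
    · rw [pcharConstraint, if_pos h]
      simp only [h.1, h.2, forall_true_left, LinearMap.ext_iff]
      refine forall_congr' fun x => ?_
      simp only [LinearMap.sub_apply, LinearMap.sum_apply, LinearMap.comp_apply,
        LinearMap.proj_apply, LinearMap.llcomp_apply, LinearMap.lcomp_apply,
        LinearMap.zero_apply, sub_eq_zero]
      split_ifs <;> simp
    · simp only [pcharConstraint, if_neg h, LinearMap.zero_apply, true_iff]
      intro h1 h2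
      exact absurd ⟨h1, h2⟩ h

variable {lam : K}

/-- The coboundary of a linear map `f : S → V_0(λ)`. -/
def delta (lam : K) (f : (Fin (p - 1) → K) →ₗ[K] (Fin p → K)) :
    ℤ → (Fin (p - 1) → K) →ₗ[K] (Fin p → K) :=
  fun k => vermaRho K p 0 lam k ∘ₗ f - f ∘ₗ sRho K p k

theorem mem_coboundaries_iff {c : ℤ → (Fin (p - 1) → K) →ₗ[K] (Fin p → K)} :
    c ∈ coboundaries K p (-1) (vermaRho K p 0 lam) (sRho K p) ↔ ∃ f, delta lam f = c := by
  rw [coboundaries, LinearMap.mem_range]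
  refine exists_congr fun f => Eq.congr ?_ rfl
  funext k
  rw [LinearMap.pi_apply]
  split_ifs with h
  · rfl
  · rw [delta, vermaRho_of_gt (by omega), sRho_of_gt (by omega)]
    simp

/-- A cocycle (not necessarily restricted) which vanishes on `e_{-1}` and whose value on `e_0` has
zero top coordinate. -/
structure IsNormal (lam : K) (c : ℤ → (Fin (p - 1) → K) →ₗ[K] (Fin p → K)) : Prop where
  supp : ∀ k, k < -1 ∨ (p : ℤ) - 2 < k → c k = 0
  bracket : ∀ i j, -1 ≤ i → i ≤ (p : ℤ) - 2 → -1 ≤ j → j ≤ (p : ℤ) - 2 → ∀ x,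
    ((j - i : ℤ) : K) • c (i + j) x = vermaRho K p 0 lam i (c j x) + c i (sRho K p j x)
      - vermaRho K p 0 lam j (c i x) - c j (sRho K p i x)
  neg_one : c (-1) = 0
  top_zero : ∀ x, coord K p (p - 1) (c 0 x) = 0

/-- The top coordinate of `c j` as a functional on `S`. -/
def top (c : ℤ → (Fin (p - 1) → K) →ₗ[K] (Fin p → K)) (j : ℤ) : (Fin (p - 1) → K) →ₗ[K] K :=
  coord K p (p - 1) ∘ₗ c j

theorem top_apply (c : ℤ → (Fin (p - 1) → K) →ₗ[K] (Fin p → K)) (j : ℤ) (x : Fin (p - 1) → K) :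
    top c j x = coord K p (p - 1) (c j x) := rfl

namespace IsNormal

variable {c d : ℤ → (Fin (p - 1) → K) →ₗ[K] (Fin p → K)}

theorem sub_smul (hc : IsNormal lam c) (hd : IsNormal lam d) (a : K) :
    IsNormal lam (c - a • d) where
  supp k hk := by simp [hc.supp k hk, hd.supp k hk]
  bracket i j h1 h2 h3 h4 x := by
    have e1 := hc.bracket i j h1 h2 h3 h4 x
    have e2 := hd.bracket i j h1 h2 h3 h4 x
    simp only [Pi.sub_apply, Pi.smul_apply, LinearMap.sub_apply, LinearMap.smul_apply, smul_sub,
      map_sub, map_smul, smul_comm _ a, e1, e2]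
    module
  neg_one := by simp [hc.neg_one, hd.neg_one]
  top_zero x := by simp [hc.top_zero, hd.top_zero]

theorem top_nonpos (hc : IsNormal lam c) {j : ℤ} (hj : j ≤ 0) : top c j = 0 := by
  refine LinearMap.ext fun x => ?_
  rw [top_apply]
  rcases eq_or_lt_of_le hj with rfl | hj
  · exact hc.top_zero x
  · rcases eq_or_ne j (-1) with rfl | h
    · simp [hc.neg_one]
    · simp [hc.supp j (by omega)]

theorem eq_zero_of_top (hc : IsNormal lam c) (h : ∀ j, top c j = 0) : c = 0 := by
  have key : ∀ m, ∀ k j, k + m + 1 = p → ∀ x, coord K p k (c j x) = 0 := by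
    intro m
    induction m with
    | zero =>
      intro k j hk x
      obtain rfl : k = p - 1 := by omega
      exact LinearMap.congr_fun (h j) x
    | succ m ih =>
      intro k j hk x
      by_cases hj : j ≤ -1 ∨ (p : ℤ) - 2 < j
      · have : c j = 0 := by
          rcases eq_or_ne j (-1) with rfl | h
          · exact hc.neg_one
          · exact hc.supp j (by omega)
        simp [this]
      · have := congrArg (coord K p (k + 1))
          (hc.bracket (-1) j (by omega) (by omega) (by omega) (by omega) x)
        simp only [map_sub, map_smul, hc.neg_one, LinearMap.zero_apply, map_zero,
          ih (k + 1) _ (by omega), smul_zero, coord_vermaRho_neg_one_succ (show k + 1 < p by omega),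
          sub_zero, add_zero] at this
        exact this.symm
  refine funext fun j => LinearMap.ext fun x => coord_ext fun k hk => ?_
  simpa using key (p - 1 - k) k j (by omega) x

theorem top_of_gt (hc : IsNormal lam c) {j : ℕ} (hj : p < j + 2) : top c j 1 = 0 := by
  simp [top_apply, hc.supp j (by omega)]

variable [CharP K p]

theorem isWeight (hp : 3 < p) (hc : IsNormal lam c) (j : ℤ) :
    IsWeight (lam + 1 - j) (top c j) := fun x => by
  by_cases hj : j ≤ 0 ∨ (p : ℤ) - 2 < j
  · have : top c j = 0 := by
      rcases hj with hj | hj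
      · exact hc.top_nonpos hj
      · simp [top, hc.supp j (Or.inr hj)]
    simp [this]
  · have := congrArg (coord K p (p - 1))
      (hc.bracket 0 j (by omega) (by omega) (by omega) (by omega) x)
    simp only [map_sub, map_add, map_smul, hc.top_zero, zero_add, sub_zero, smul_eq_mul,
      coord_top_vermaRho hp le_rfl, coord_top_vermaRho hp (show 0 ≤ j by omega),
      if_true, mul_zero] at this
    rw [top_apply, top_apply]
    linear_combination this

theorem eq_zero (hp : 3 < p) (hc : IsNormal lam c) (h : ∀ j : ℕ, 1 ≤ j → top c j 1 = 0) :
    c = 0 := by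
  refine hc.eq_zero_of_top fun j => ?_
  rcases le_or_gt j 0 with hj | hj
  · exact hc.top_nonpos hj
  · obtain ⟨j, rfl⟩ := Int.eq_ofNat_of_zero_le hj.le
    exact (hc.isWeight hp j).eq_zero hp (h j (by omega))

theorem top_rel (hp : 3 < p) (hc : IsNormal lam c) {i j : ℕ} (hi : 1 ≤ i) (hi' : i + 2 ≤ p)
    (hj : 1 ≤ j) (hj' : j + 2 ≤ p) :
    ((j : K) - i) * top c (i + j : ℕ) 1
      = fall (lam + 1 - i) (j + 1) * top c i 1 - fall (lam + 1 - j) (i + 1) * top c j 1 := by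
  have := congrArg (coord K p (p - 1))
    (hc.bracket i j (by omega) (by omega) (by omega) (by omega) 1)
  have h1 := (hc.isWeight hp i).apply_sRho_one hp hj'
  have h2 := (hc.isWeight hp j).apply_sRho_one hp hi'
  simp only [Int.cast_natCast, top_apply] at h1 h2
  simp only [map_sub, map_add, map_smul, smul_eq_mul,
    coord_top_vermaRho hp (Int.natCast_nonneg i), coord_top_vermaRho hp (Int.natCast_nonneg j),
    h1, h2, if_neg (show ((i : ℕ) : ℤ) ≠ 0 by omega), if_neg (show ((j : ℕ) : ℤ) ≠ 0 by omega)]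
    at this
  simp only [top_apply]
  push_cast at this ⊢
  linear_combination this

theorem top_of_eq (hp : 3 < p) (hc : IsNormal lam c) {j : ℕ} (hj : lam + 1 = j) :
    top c j 1 = 0 := by
  have := hc.isWeight hp j
  rw [hj, Int.cast_natCast, sub_self] at this
  rw [this.eq_zero_of_weight_zero hp, LinearMap.zero_apply]

end IsNormal

theorem sRho_neg_one_pow_eq_zero {n : ℕ} (hn : p - 1 ≤ n) : sRho K p (-1) ^ n = 0 := by
  have key : ∀ m k, k < m → ∀ x, coord K (p - 1) k ((sRho K p (-1) ^ m) x) = 0 := by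
    intro m
    induction m with
    | zero => intro k hk; omega
    | succ m ih =>
      intro k hk x
      rw [pow_succ', Module.End.mul_apply]
      rcases k with _ | k
      · exact coord_sRho_neg_one_zero _
      · by_cases h : k + 1 < p - 1
        · rw [coord_sRho_neg_one_succ h, ih k (by omega)]
        · exact coord_of_le (not_lt.1 h) _
  refine LinearMap.ext fun x => coord_ext fun k hk => ?_
  rw [key n k (by omega)]
  simp

theorem sRho_pos_pow_eq_zero {i : ℕ} (hi : 1 ≤ i) (hi' : i + 2 ≤ p) {n : ℕ} (hn : p - 1 ≤ n) :
    sRho K p i ^ n = 0 := by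
  have key : ∀ m k, p - 1 ≤ k + m → ∀ x, coord K (p - 1) k ((sRho K p i ^ m) x) = 0 := by
    intro m
    induction m with
    | zero => intro k hk x; exact coord_of_le hk _
    | succ m ih =>
      intro k hk x
      rw [pow_succ', Module.End.mul_apply]
      by_cases h : k < p - 1
      · rw [coord_sRho_natCast hi' h, ih (k + i) (by omega), mul_zero]
      · exact coord_of_le (not_lt.1 h) _
  refine LinearMap.ext fun x => coord_ext fun k hk => ?_
  rw [key n k (by omega)]
  simp

/-- Solve `e_{-1} f - f e_{-1} = d` for `f : S → V_0(λ)` with prescribed top coordinate. -/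
theorem exists_primitive (hp : 3 < p) (d : (Fin (p - 1) → K) →ₗ[K] (Fin p → K))
    (F : (Fin (p - 1) → K) →ₗ[K] K)
    (hd : ∀ x, ∑ t ∈ Finset.range p, coord K p t (d ((sRho K p (-1) ^ t) x)) = 0) :
    ∃ f : (Fin (p - 1) → K) →ₗ[K] (Fin p → K),
      (∀ x, vermaRho K p 0 lam (-1) (f x) - f (sRho K p (-1) x) = d x) ∧
      ∀ x, coord K p (p - 1) (f x) = F x := by
  let f : (Fin (p - 1) → K) →ₗ[K] (Fin p → K) := LinearMap.pi fun k : Fin p =>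
    (∑ t ∈ Finset.range (p - 1 - k), coord K p (k + 1 + t) ∘ₗ d ∘ₗ (sRho K p (-1) ^ t))
      + F ∘ₗ (sRho K p (-1) ^ (p - 1 - k))
  have hf : ∀ k, k < p → ∀ x, coord K p k (f x)
      = ∑ t ∈ Finset.range (p - 1 - k), coord K p (k + 1 + t) (d ((sRho K p (-1) ^ t) x))
        + F ((sRho K p (-1) ^ (p - 1 - k)) x) := fun k hk x => by
    simp [f, coord_of_lt hk]
  have hpow : ∀ n x, (sRho K p (-1) ^ n) (sRho K p (-1) x) = (sRho K p (-1) ^ (n + 1)) x :=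
    fun n x => by rw [pow_succ, Module.End.mul_apply]
  refine ⟨f, fun x => coord_ext fun k hk => ?_, fun x => ?_⟩
  · rw [map_sub]
    rcases k with _ | k
    · have hx : ∑ t ∈ Finset.range (p - 1 + 1), coord K p t (d ((sRho K p (-1) ^ t) x)) = 0 := by
        rw [Nat.sub_add_cancel (by omega)]
        exact hd x
      rw [Finset.sum_range_succ', pow_zero, Module.End.one_apply] at hx
      rw [coord_vermaRho_neg_one_zero, hf 0 hk]
      simp only [hpow, Nat.sub_zero, sRho_neg_one_pow_eq_zero (K := K) (p := p)
        (n := p - 1 + 1) (by omega), LinearMap.zero_apply, map_zero, add_zero]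
      rw [Finset.sum_congr rfl fun t _ => by rw [show 0 + 1 + t = t + 1 by omega]]
      linear_combination -hx
    · rw [coord_vermaRho_neg_one_succ hk, hf k (by omega), hf (k + 1) hk,
        show p - 1 - k = p - 1 - (k + 1) + 1 by omega, Finset.sum_range_succ']
      simp only [hpow, pow_zero, Module.End.one_apply, add_zero]
      rw [Finset.sum_congr rfl fun t _ => by rw [show k + 1 + (t + 1) = k + 1 + 1 + t by omega]]
      ring
  · simp [hf (p - 1) (by omega)]

theorem coord_top_vermaRho_neg_one_pow {m : ℕ} (hm : m < p) (y : Fin p → K) :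
    coord K p (p - 1) ((vermaRho K p 0 lam (-1) ^ m) y) = coord K p (p - 1 - m) y := by
  rw [← coord_vermaRho_neg_one_pow (lam := lam) (k := p - 1 - m) (m := m) (by omega),
    show p - 1 - m + m = p - 1 by omega]

variable [CharP K p]

theorem sub_delta_bracket (hp : 3 < p) {c : ℤ → (Fin (p - 1) → K) →ₗ[K] (Fin p → K)}
    (f : (Fin (p - 1) → K) →ₗ[K] (Fin p → K))
    {i j : ℤ} (hi : -1 ≤ i) (hj : -1 ≤ j) (x : Fin (p - 1) → K)
    (h : ((j - i : ℤ) : K) • c (i + j) x = vermaRho K p 0 lam i (c j x) + c i (sRho K p j x)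
      - vermaRho K p 0 lam j (c i x) - c j (sRho K p i x)) :
    ((j - i : ℤ) : K) • (c - delta lam f) (i + j) x
      = vermaRho K p 0 lam i ((c - delta lam f) j x) + (c - delta lam f) i (sRho K p j x)
      - vermaRho K p 0 lam j ((c - delta lam f) i x) - (c - delta lam f) j (sRho K p i x) := by
  have hV := (module_bracket (lam := lam) hp i j hi hj).1 (f x)
  have hS := congrArg f ((module_bracket (lam := lam) hp i j hi hj).2 x)
  rw [map_smul, map_sub] at hS
  simp only [Pi.sub_apply, delta, LinearMap.sub_apply, LinearMap.comp_apply, smul_sub, map_sub, h,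
    ← hV, ← hS]
  abel

/-- Every cocycle can be normalised by subtracting a coboundary. -/
theorem exists_isNormal (hp : 3 < p) {c : ℤ → (Fin (p - 1) → K) →ₗ[K] (Fin p → K)}
    (hc : c ∈ cocycles K p (-1) (vermaRho K p 0 lam) (sRho K p)) :
    ∃ f, IsNormal lam (c - delta lam f) := by
  obtain ⟨hsupp, hbr, hchar⟩ := mem_cocycles_iff.1 hc
  have hd : ∀ x, ∑ t ∈ Finset.range p, coord K p t (c (-1) ((sRho K p (-1) ^ t) x)) = 0 := by
    intro x
    have := congrArg (coord K p (p - 1)) (hchar (-1) le_rfl (by omega) x)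
    rw [map_sum, if_neg (by norm_num), map_zero] at this
    rw [← Finset.sum_range_reflect, ← this]
    refine Finset.sum_congr rfl fun k hk => ?_
    rw [coord_top_vermaRho_neg_one_pow (Finset.mem_range.1 hk)]
  have hres : ∀ k : Fin (p - 1), lam + 1 + ((k : K) + 1) = 0 →
      coord K p (p - 1) (c 0 (Pi.single k 1)) = 0 := by
    intro k hk
    have := congrArg (coord K p (p - 1)) (hchar 0 (by omega) (by omega) (Pi.single k 1))
    rw [if_pos rfl, map_sum] at this
    rw [← this]
    have hpow : ∀ m y, coord K p (p - 1) ((vermaRho K p 0 lam 0 ^ m) y)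
        = (lam + 1) ^ m * coord K p (p - 1) y := by
      intro m y
      induction m with
      | zero => simp
      | succ m ih =>
        rw [pow_succ', Module.End.mul_apply, coord_top_vermaRho hp le_rfl, ih, if_pos rfl]
        ring
    have hterm : ∀ m ∈ Finset.range p, coord K p (p - 1) ((vermaRho K p 0 lam 0 ^ m)
        (c 0 ((sRho K p 0 ^ (p - 1 - m)) (Pi.single k 1))))
        = (lam + 1) ^ (p - 1) * coord K p (p - 1) (c 0 (Pi.single k 1)) := by
      intro m hm
      have hm := Finset.mem_range.1 hm
      rw [hpow, sRho_zero_pow_single hp, map_smul, map_smul, smul_eq_mul, ← mul_assoc,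
        show -((k : K) + 1) = lam + 1 by linear_combination -hk, ← pow_add,
        show m + (p - 1 - m) = p - 1 by omega]
    rw [Finset.sum_congr rfl hterm]
    simp
  obtain ⟨F, hF⟩ : ∃ F : (Fin (p - 1) → K) →ₗ[K] K,
      ∀ x, (lam + 1) * F x - F (sRho K p 0 x) = coord K p (p - 1) (c 0 x) := by
    let F : (Fin (p - 1) → K) →ₗ[K] K := ∑ k : Fin (p - 1),
      (coord K p (p - 1) (c 0 (Pi.single k 1)) / (lam + 1 + ((k : K) + 1))) • LinearMap.proj k
    have hFs : ∀ k : Fin (p - 1), F (Pi.single k 1)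
        = coord K p (p - 1) (c 0 (Pi.single k 1)) / (lam + 1 + ((k : K) + 1)) := by
      intro k
      simp [F, Pi.single_apply]
    refine ⟨F, fun x => ?_⟩
    have : (lam + 1) • F - F ∘ₗ sRho K p 0 = coord K p (p - 1) ∘ₗ c 0 := by
      refine LinearMap.pi_ext' fun k => LinearMap.ext_ring ?_
      simp only [LinearMap.comp_apply, LinearMap.sub_apply, LinearMap.smul_apply, smul_eq_mul,
        LinearMap.coe_single, sRho_zero_single hp, map_smul, hFs]
      by_cases h : lam + 1 + ((k : K) + 1) = 0
      · simp [h, hres k h]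
      · field_simp
        ring
    exact LinearMap.congr_fun this x
  obtain ⟨f, hf1, hf2⟩ := exists_primitive (lam := lam) hp (c (-1)) F hd
  refine ⟨f, ⟨fun k hk => ?_, fun i j hi hi' hj hj' x => ?_, ?_, fun x => ?_⟩⟩
  · simp [delta, hsupp k hk, vermaRho_of_gt hk, sRho_of_gt hk]
  · exact sub_delta_bracket hp f hi hj x (hbr i j hi hi' hj hj' x)
  · refine LinearMap.ext fun x => ?_
    simp [delta, hf1]
  · simp [delta, coord_top_vermaRho hp le_rfl, hf2, ← hF]

/-- Away from the weights `0` and `1`, the top value at `e_1` can be normalised to zero. -/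
theorem IsNormal.exists_top_one_eq_zero (hp : 3 < p) (hlam : (lam + 1) ^ p = lam + 1)
    {c : ℤ → (Fin (p - 1) → K) →ₗ[K] (Fin p → K)} (hc : IsNormal lam c)
    (h0 : lam + 1 ≠ 0) (h1 : lam ≠ 0) :
    ∃ f, IsNormal lam (c - delta lam f) ∧ top (c - delta lam f) 1 1 = 0 := by
  obtain ⟨F, hF, hF1⟩ := exists_isWeight hp hlam (a := -top c 1 1 / ((lam + 1) * lam))
    (fun h => absurd h h0)
  obtain ⟨f, hf1, hf2⟩ := exists_primitive (lam := lam) hp 0 F (by simp)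
  refine ⟨f, ⟨fun k hk => ?_, fun i j hi hi' hj hj' x => ?_, ?_, fun x => ?_⟩, ?_⟩
  · simp [delta, hc.supp k hk, vermaRho_of_gt hk, sRho_of_gt hk]
  · exact sub_delta_bracket hp f hi hj x (hc.bracket i j hi hi' hj hj' x)
  · refine LinearMap.ext fun x => ?_
    have := hf1 x
    rw [LinearMap.zero_apply, sub_eq_zero] at this
    simp [delta, this, hc.neg_one]
  · simp [delta, coord_top_vermaRho hp le_rfl, hf2, hc.top_zero, hF x]
  · have := hF.apply_sRho_one hp (j := 1) (by omega)
    rw [Nat.cast_one] at this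
    rw [top_apply, Pi.sub_apply, LinearMap.sub_apply, map_sub, ← top_apply]
    simp only [delta, LinearMap.sub_apply, LinearMap.comp_apply, map_sub, hf2, this,
      coord_top_vermaRho hp zero_le_one, hF1]
    simp only [fall, Finset.prod_range_succ, Finset.prod_range_zero]
    push_cast
    field_simp
    ring

end Cocycles

section Lift

variable {K : Type} [Field K] {p : ℕ}

theorem add_pow_char_algebra [CharP K p] (hp : 3 < p) {A : Type} [Ring A] [Algebra K A] {x y : A}
    (h : Commute x y) : (x + y) ^ p = x ^ p + y ^ p := by
  have : Fact p.Prime := ⟨(CharP.char_is_prime_or_zero K p).resolve_right (by omega)⟩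
  cases subsingleton_or_nontrivial A
  · exact Subsingleton.elim _ _
  · have : CharP A p := charP_of_injective_algebraMap (algebraMap K A).injective p
    exact add_pow_char_of_commute _ h

theorem sub_pow_char_algebra [CharP K p] (hp : 3 < p) {A : Type} [Ring A] [Algebra K A] {x y : A}
    (h : Commute x y) : (x - y) ^ p = x ^ p - y ^ p := by
  have : Fact p.Prime := ⟨(CharP.char_is_prime_or_zero K p).resolve_right (by omega)⟩
  cases subsingleton_or_nontrivial A
  · exact Subsingleton.elim _ _
  · have : CharP A p := charP_of_injective_algebraMap (algebraMap K A).injective p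
    exact sub_pow_char_of_commute _ h

variable (K p) in
/-- Precomposition of a family of functionals on `S` with `e_{-1}`. -/
def precomp : Module.End K (ℤ → (Fin (p - 1) → K) →ₗ[K] K) :=
  LinearMap.pi fun j => LinearMap.lcomp K K (sRho K p (-1)) ∘ₗ LinearMap.proj j

variable (K p) in
/-- The operator `a ↦ (j ↦ (j + 1) a_{j-1})` on families of functionals on `S`. -/
def raise : Module.End K (ℤ → (Fin (p - 1) → K) →ₗ[K] K) :=
  LinearMap.pi fun j => ((j : K) + 1) • LinearMap.proj (j - 1)

theorem precomp_apply (a : ℤ → (Fin (p - 1) → K) →ₗ[K] K) (j : ℤ) :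
    precomp K p a j = a j ∘ₗ sRho K p (-1) := rfl

theorem raise_apply (a : ℤ → (Fin (p - 1) → K) →ₗ[K] K) (j : ℤ) :
    raise K p a j = ((j : K) + 1) • a (j - 1) := rfl

theorem commute_precomp_raise : Commute (precomp K p) (raise K p) :=
  LinearMap.ext fun a => by
    funext j
    rw [Module.End.mul_apply, Module.End.mul_apply]
    simp only [precomp_apply, raise_apply, LinearMap.smul_comp]

theorem precomp_pow_apply (n : ℕ) (a : ℤ → (Fin (p - 1) → K) →ₗ[K] K) (j : ℤ) :
    (precomp K p ^ n) a j = a j ∘ₗ (sRho K p (-1) ^ n) := by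
  induction n with
  | zero => rfl
  | succ n ih =>
    rw [pow_succ', Module.End.mul_apply, precomp_apply, ih, LinearMap.comp_assoc,
      ← Module.End.mul_eq_comp, ← pow_succ]

theorem raise_pow_apply (n : ℕ) (a : ℤ → (Fin (p - 1) → K) →ₗ[K] K) (j : ℤ) :
    (raise K p ^ n) a j = (∏ t ∈ Finset.range n, ((j : K) + 1 - t)) • a (j - n) := by
  induction n generalizing j with
  | zero => simp
  | succ n ih =>
    rw [pow_succ', Module.End.mul_apply, raise_apply, ih, smul_smul, Finset.prod_range_succ',
      show j - 1 - (n : ℤ) = j - (n + 1 : ℕ) by push_cast; ring, mul_comm]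
    congr 2
    · refine Finset.prod_congr rfl fun t _ => ?_
      push_cast; ring
    · simp

/-- The operator on families of functionals passing from the `k`-th to the `(k-1)`-st coordinates
of a cocycle vanishing at `e_{-1}`. -/
def step (γ : ℤ → (Fin (p - 1) → K) →ₗ[K] K) (m : ℕ) : ℤ → (Fin (p - 1) → K) →ₗ[K] K :=
  ((precomp K p + raise K p) ^ m) γ

theorem step_succ_apply (γ : ℤ → (Fin (p - 1) → K) →ₗ[K] K) (m : ℕ) (j : ℤ)
    (x : Fin (p - 1) → K) :
    step γ (m + 1) j x = step γ m j (sRho K p (-1) x) + ((j : K) + 1) * step γ m (j - 1) x := by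
  rw [step, pow_succ', Module.End.mul_apply]
  rfl

theorem step_nonpos {γ : ℤ → (Fin (p - 1) → K) →ₗ[K] K} (h : ∀ j, j ≤ 0 → γ j = 0)
    (m : ℕ) {j : ℤ} (hj : j ≤ 0) : step γ m j = 0 := by
  induction m generalizing j with
  | zero => simpa [step] using h j hj
  | succ m ih =>
    refine LinearMap.ext fun x => ?_
    rw [step_succ_apply, ih hj, ih (by omega)]
    simp

theorem step_of_gt [CharP K p] {γ : ℤ → (Fin (p - 1) → K) →ₗ[K] K}
    (h : ∀ j, (p : ℤ) - 2 < j → γ j = 0) (m : ℕ) {j : ℤ} (hj : (p : ℤ) - 2 < j) :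
    step γ m j = 0 := by
  induction m generalizing j with
  | zero => simpa [step] using h j hj
  | succ m ih =>
    refine LinearMap.ext fun x => ?_
    rw [step_succ_apply, ih hj]
    rcases eq_or_ne j (p - 1) with rfl | hj'
    · simp
    · rw [ih (by omega)]
      simp

theorem step_char [CharP K p] (hp : 3 < p) {γ : ℤ → (Fin (p - 1) → K) →ₗ[K] K}
    (h0 : ∀ j, j ≤ 0 → γ j = 0) (htop : ∀ j, (p : ℤ) - 2 < j → γ j = 0) (j : ℤ) :
    step γ p j = 0 := by
  by_cases hj : (p : ℤ) - 2 < j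
  · exact step_of_gt htop p hj
  · rw [step, add_pow_char_algebra (K := K) (x := precomp K p) (y := raise K p) hp
        commute_precomp_raise,
      LinearMap.add_apply,
      Pi.add_apply, precomp_pow_apply, raise_pow_apply, sRho_neg_one_pow_eq_zero (by omega),
      h0 (j - p) (by omega)]
    simp

variable {lam : K} [CharP K p]

/-- If `e_{-1}, e_0, …` satisfy the bracket relations, then `e_i ^ p` commutes with `e_{-1}` for
`i ≥ 1`. -/
theorem commute_pow_char (hp : 3 < p) {E : Type} [AddCommGroup E] [Module K E]
    (R : ℤ → Module.End K E) (hR : ∀ k, (p : ℤ) - 2 < k → R k = 0)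
    (hbr : ∀ i j : ℤ, -1 ≤ i → -1 ≤ j → R i * R j - R j * R i = ((j - i : ℤ) : K) • R (i + j))
    {i : ℤ} (hi : 1 ≤ i) : Commute (R i ^ p) (R (-1)) := by
  have key : ∀ k : ℕ, ∃ a : K,
      ((LinearMap.mulLeft K (R i) - LinearMap.mulRight K (R i)) ^ k) (R (-1))
        = a • R (k * i - 1) := by
    intro k
    induction k with
    | zero => exact ⟨1, by simp⟩
    | succ k ih =>
      obtain ⟨a, ha⟩ := ih
      refine ⟨a * ((k * i - 1 - i : ℤ) : K), ?_⟩
      have hk : (0 : ℤ) ≤ k * i := by positivity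
      have := hbr i (k * i - 1) (by omega) (by omega)
      rw [pow_succ', Module.End.mul_apply, ha, map_smul, LinearMap.sub_apply,
        LinearMap.mulLeft_apply, LinearMap.mulRight_apply, this, smul_smul]
      congr 2
      push_cast; ring
  obtain ⟨a, ha⟩ := key p
  have hpi : (p : ℤ) ≤ p * i := le_mul_of_one_le_right (by positivity) hi
  rw [sub_pow_char_algebra (K := K) hp (LinearMap.commute_mulLeft_right (R := K) (R i) (R i)),
    hR (p * i - 1) (by omega), smul_zero, LinearMap.pow_mulLeft, LinearMap.pow_mulRight,
    LinearMap.sub_apply, LinearMap.mulLeft_apply, LinearMap.mulRight_apply, sub_eq_zero] at ha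
  exact ha

/-- A family of top coordinates satisfying the `W_0`-relations comes from a normal cocycle. -/
theorem exists_lift (hp : 3 < p) {γ : ℤ → (Fin (p - 1) → K) →ₗ[K] K}
    (h0 : ∀ j, j ≤ 0 → γ j = 0) (htop : ∀ j, (p : ℤ) - 2 < j → γ j = 0)
    (hγ : ∀ i j : ℤ, 0 ≤ i → 0 ≤ j → ∀ x, ((j - i : ℤ) : K) * γ (i + j) x
      = (if i = 0 then lam + 1 else 0) * γ j x + γ i (sRho K p j x)
        - (if j = 0 then lam + 1 else 0) * γ i x - γ j (sRho K p i x)) :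
    ∃ c ∈ cocycles K p (-1) (vermaRho K p 0 lam) (sRho K p),
      IsNormal lam c ∧ ∀ j, top c j = γ j := by
  let c : ℤ → (Fin (p - 1) → K) →ₗ[K] (Fin p → K) := fun j =>
    LinearMap.pi fun k => step γ (p - 1 - k) j
  have hcoord : ∀ j k m, k + m + 1 = p → ∀ x, coord K p k (c j x) = step γ m j x := by
    intro j k m hk x
    rw [coord_of_lt (by omega)]
    obtain rfl : m = p - 1 - k := by omega
    rfl
  have htopc : ∀ j x, coord K p (p - 1) (c j x) = γ j x := fun j x => by
    rw [hcoord j (p - 1) 0 (by omega)]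
    rfl
  have hc0 : ∀ j, j ≤ 0 → c j = 0 := fun j hj => LinearMap.ext fun x => funext fun k => by
    simp [c, step_nonpos h0 _ hj]
  have hcgt : ∀ j, (p : ℤ) - 2 < j → c j = 0 := fun j hj => LinearMap.ext fun x =>
    funext fun k => by simp [c, step_of_gt htop _ hj]
  have hcD : ∀ (j : ℤ) x, vermaRho K p 0 lam (-1) (c j x) - c j (sRho K p (-1) x)
      = ((j : K) + 1) • c (j - 1) x := by
    refine fun j x => coord_ext fun k hk => ?_
    rw [map_sub, map_smul, smul_eq_mul]
    rcases k with _ | k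
    · have := step_succ_apply γ (p - 1) j x
      rw [Nat.sub_add_cancel (by omega), step_char hp h0 htop, LinearMap.zero_apply] at this
      rw [coord_vermaRho_neg_one_zero, hcoord _ 0 (p - 1) (by omega),
        hcoord _ 0 (p - 1) (by omega)]
      linear_combination this
    · have := step_succ_apply γ (p - 1 - (k + 1)) j x
      rw [coord_vermaRho_neg_one_succ hk, hcoord _ k (p - 1 - (k + 1) + 1) (by omega),
        hcoord _ (k + 1) (p - 1 - (k + 1)) (by omega),
        hcoord _ (k + 1) (p - 1 - (k + 1)) (by omega)]
      linear_combination this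
  have hbr : ∀ i j, -1 ≤ i → -1 ≤ j → ∀ x,
      ((j - i : ℤ) : K) • c (i + j) x = vermaRho K p 0 lam i (c j x) + c i (sRho K p j x)
        - vermaRho K p 0 lam j (c i x) - c j (sRho K p i x) := by
    intro i j hi hj x
    rcases eq_or_lt_of_le hi with rfl | hi
    · have := hcD j x
      simp only [hc0 (-1) (by omega), LinearMap.zero_apply, map_zero, add_zero, sub_zero, this,
        show -1 + j = j - 1 by ring]
      simp
    · rcases eq_or_lt_of_le hj with rfl | hj
      · have := hcD i x
        have e : ((-1 - i : ℤ) : K) = -((i : K) + 1) := by push_cast; ring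
        simp only [hc0 (-1) (by omega), LinearMap.zero_apply, map_zero, zero_add, sub_zero, e,
          neg_smul, ← sub_eq_add_neg, ← this]
        abel
      · have := extEnd_bracket hp c (hc0 _ (by omega)) (fun j _ => hcD j)
          (by simpa only [htopc] using hγ) i j (by omega) (by omega)
        have := congrArg (fun T : Module.End K _ => (T (0, x)).1) this
        simp only [LinearMap.sub_apply, Module.End.mul_apply, LinearMap.smul_apply, extEnd_apply,
          Prod.fst_sub, Prod.smul_fst, map_zero, zero_add] at this
        rw [← this]
        abel
  have hchar : ∀ i, -1 ≤ i → i ≤ (p : ℤ) - 2 → ∀ x,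
      ∑ k ∈ Finset.range p, (vermaRho K p 0 lam i ^ k) (c i ((sRho K p i ^ (p - 1 - k)) x))
        = if i = 0 then c 0 x else 0 := by
    intro i hi hi' x
    rw [hc0 0 le_rfl, LinearMap.zero_apply, ite_self]
    rcases le_or_gt i 0 with hi0 | hi0
    · simp [hc0 i hi0]
    · obtain ⟨i, rfl⟩ := Int.eq_ofNat_of_zero_le hi0.le
      let R : ℤ → Module.End K ((Fin p → K) × (Fin (p - 1) → K)) := fun i =>
        extEnd (vermaRho K p 0 lam i) (c i) (sRho K p i)
      have hcomm : Commute (R i ^ p) (R (-1)) := by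
        refine commute_pow_char hp R (fun k hk => LinearMap.ext fun y => ?_)
          (fun i j hi hj => LinearMap.ext fun y => ?_) (by omega)
        · simp [R, vermaRho_of_gt (Or.inr hk), sRho_of_gt (Or.inr hk), hcgt k hk]
        · have h1 := hbr i j hi hj y.2
          have h2 := module_bracket (lam := lam) hp i j hi hj
          refine Prod.ext ?_ ?_
          · simp only [R, LinearMap.sub_apply, Module.End.mul_apply, LinearMap.smul_apply,
              extEnd_apply, Prod.fst_sub, Prod.smul_fst, map_add, smul_add, h1, ← h2.1]
            abel
          · exact h2.2 y.2
      have hR1 : R (-1) = extEnd (vermaRho K p 0 lam (-1)) 0 (sRho K p (-1)) := by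
        simp only [R, hc0 (-1) (by omega)]
      have hS : sRho K p i ^ p = 0 := sRho_pos_pow_eq_zero (by omega) (by omega) (by omega)
      have hV : ∀ y, coord K p (p - 1) (vermaRho K p 0 lam i y) = 0 := fun y => by
        rw [coord_top_vermaRho hp hi0.le, if_neg hi0.ne', zero_mul]
      have htopR : ∀ y, coord K p (p - 1) ((R i ^ p) y).1 = 0 := by
        intro y
        have hVp : ∀ n y, coord K p (p - 1) ((vermaRho K p 0 lam i ^ (n + 1)) y) = 0 :=
          fun n y => by rw [pow_succ', Module.End.mul_apply, hV]
        obtain ⟨n, rfl⟩ : ∃ n, p = n + 1 := ⟨p - 1, by omega⟩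
        rw [extEnd_pow_apply, Finset.sum_range_succ', map_add, map_add, map_sum, hVp,
          Finset.sum_eq_zero fun k _ => hVp k _,
          sRho_pos_pow_eq_zero (n := n + 1 - 1 - 0) (by omega) (by omega) (by omega)]
        simp
      have hRp : (R i ^ p) (0, x) = 0 := by
        refine eq_zero_of_coord_top (lam := lam) hp _ (fun m => ?_) (fun m => ?_)
        · rw [← hR1, ← Module.End.mul_apply, ← (hcomm.pow_right m).eq, Module.End.mul_apply,
            htopR]
        · rw [← hR1, ← Module.End.mul_apply, ← (hcomm.pow_right m).eq, Module.End.mul_apply,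
            extEnd_pow_apply, hS]
          simp
      have := congrArg Prod.fst hRp
      rw [extEnd_pow_apply] at this
      simpa using this
  refine ⟨c, mem_cocycles_iff.2 ⟨fun k hk => ?_, fun i j hi _ hj _ => hbr i j hi hj, hchar⟩,
    ⟨fun k hk => ?_, fun i j hi _ hj _ => hbr i j hi hj, hc0 _ (by omega), fun x => ?_⟩,
    fun j => LinearMap.ext fun x => htopc j x⟩
  · exact hk.elim (fun hk => hc0 k (by omega)) (hcgt k)
  · exact hk.elim (fun hk => hc0 k (by omega)) (hcgt k)
  · simp [hc0 0 le_rfl]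

end Lift

section Classification

variable {K : Type} [Field K] {p : ℕ} {lam : K}

theorem delta_add (f g : (Fin (p - 1) → K) →ₗ[K] (Fin p → K)) :
    delta lam (f + g) = delta lam f + delta lam g := by
  funext k
  simp only [delta, Pi.add_apply, LinearMap.comp_add, LinearMap.add_comp]
  abel

theorem top_sub_smul (c d : ℤ → (Fin (p - 1) → K) →ₗ[K] (Fin p → K)) (a : K) (j : ℤ)
    (x : Fin (p - 1) → K) : top (c - a • d) j x = top c j x - a * top d j x := by
  simp [top_apply]

variable [CharP K p]

theorem natCast_ne_zero (p : ℕ) [CharP K p] {n : ℕ} (h0 : 0 < n) (hn : n < p) : (n : K) ≠ 0 :=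
  fun h => absurd (Nat.le_of_dvd h0 ((CharP.cast_eq_zero_iff K p n).1 h)) (by omega)

theorem add_one_sub_natCast_pow (hp : 3 < p) (hlam : lam ^ p = lam) (j : ℕ) :
    (lam + 1 - j) ^ p = lam + 1 - j := by
  have : Fact p.Prime := ⟨(CharP.char_is_prime_or_zero K p).resolve_right (by omega)⟩
  rw [sub_pow_char, add_pow_char, hlam, one_pow, ← frobenius_def p (j : K), map_natCast]

/-- Normal cocycles are determined by their top values at `1`, which are subject only to the
`W_0`-relations. -/
theorem exists_normal_cocycle (hp : 3 < p) (hlam : lam ^ p = lam) (g : ℕ → K) (h0 : g 0 = 0)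
    (hgt : ∀ j, p < j + 2 → g j = 0) (heq : ∀ j : ℕ, lam + 1 = j → g j = 0)
    (hrel : ∀ i j : ℕ, 1 ≤ i → i + 2 ≤ p → 1 ≤ j → j + 2 ≤ p →
      ((j : K) - i) * g (i + j)
        = fall (lam + 1 - i) (j + 1) * g i - fall (lam + 1 - j) (i + 1) * g j) :
    ∃ c ∈ cocycles K p (-1) (vermaRho K p 0 lam) (sRho K p),
      IsNormal lam c ∧ ∀ j : ℕ, top c j 1 = g j := by
  choose F hF hF1 using fun j : ℕ => exists_isWeight hp (add_one_sub_natCast_pow hp hlam j)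
    (a := g j) fun h => heq j (sub_eq_zero.1 h)
  have hFz : ∀ j, g j = 0 → F j = 0 := fun j hj => (hF j).eq_zero hp (by rw [hF1, hj])
  obtain ⟨c, hc, hcn, htop⟩ := exists_lift (lam := lam) hp (γ := fun j => F j.toNat)
    (fun j hj => hFz _ (by rw [Int.toNat_of_nonpos hj, h0])) (fun j hj => hFz _ (hgt _ (by omega)))
    (fun i j hi hj x => by
      obtain ⟨i, rfl⟩ := Int.eq_ofNat_of_zero_le hi
      obtain ⟨j, rfl⟩ := Int.eq_ofNat_of_zero_le hj
      rw [← Nat.cast_add]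
      simp only [Int.toNat_natCast, Int.cast_sub, Int.cast_natCast, Nat.cast_eq_zero]
      rcases Nat.eq_zero_or_pos i with rfl | hi
      · have := hF j x
        rw [hFz 0 h0, zero_add]
        simp only [Nat.cast_zero, if_true, LinearMap.zero_apply, this]
        ring
      rcases Nat.eq_zero_or_pos j with rfl | hj
      · have := hF i x
        rw [hFz 0 h0, add_zero]
        simp only [Nat.cast_zero, if_true, LinearMap.zero_apply, this]
        ring
      rw [if_neg hi.ne', if_neg hj.ne']
      by_cases hi' : p < i + 2
      · rw [hFz _ (hgt i hi'), hFz _ (hgt (i + j) (by omega)),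
          sRho_of_gt (show (i : ℤ) < -1 ∨ (p : ℤ) - 2 < i by omega)]
        simp
      by_cases hj' : p < j + 2
      · rw [hFz _ (hgt j hj'), hFz _ (hgt (i + j) (by omega)),
          sRho_of_gt (show (j : ℤ) < -1 ∨ (p : ℤ) - 2 < j by omega)]
        simp
      have w1 := (hF i).comp_sRho hp (Int.natCast_nonneg j)
      have w2 := (hF j).comp_sRho hp (Int.natCast_nonneg i)
      have w3 := (hF (i + j)).smul ((j : K) - i)
      have e1 : lam + 1 - i - ((j : ℤ) : K) = lam + 1 - (i + j : ℕ) := by push_cast; ring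
      have e2 : lam + 1 - j - ((i : ℤ) : K) = lam + 1 - (i + j : ℕ) := by push_cast; ring
      rw [e1] at w1
      rw [e2] at w2
      have := LinearMap.congr_fun (((w1.sub w2).sub w3).eq_zero hp (by
        simp only [LinearMap.sub_apply, LinearMap.comp_apply, LinearMap.smul_apply, smul_eq_mul,
          (hF i).apply_sRho_one hp (j := j) (by omega),
          (hF j).apply_sRho_one hp (j := i) (by omega), hF1,
          hrel i j hi (by omega) hj (by omega)]
        ring)) x
      simp only [LinearMap.sub_apply, LinearMap.comp_apply, LinearMap.smul_apply, smul_eq_mul,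
        LinearMap.zero_apply] at this
      linear_combination -this)
  exact ⟨c, hc, hcn, fun j => by rw [htop, Int.toNat_natCast, hF1]⟩

namespace IsNormal

variable {c : ℤ → (Fin (p - 1) → K) →ₗ[K] (Fin p → K)}

theorem eq_zero_of_one_two (hp : 3 < p) (hc : IsNormal lam c) (h1 : top c (1 : ℕ) 1 = 0)
    (h2 : top c (2 : ℕ) 1 = 0) : c = 0 := by
  refine hc.eq_zero hp fun j hj => ?_
  induction j, hj using Nat.le_induction with
  | base => exact h1
  | succ j hj ih =>
    rcases eq_or_lt_of_le hj with rfl | hj'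
    · exact h2
    by_cases hp' : p < j + 1 + 2
    · exact hc.top_of_gt hp'
    have := hc.top_rel hp (i := 1) (j := j) le_rfl (by omega) hj (by omega)
    rw [h1, ih, mul_zero, mul_zero, sub_zero, mul_eq_zero, add_comm 1 j] at this
    refine this.resolve_left ?_
    rw [← Nat.cast_sub hj]
    exact natCast_ne_zero p (by omega) (by omega)

theorem top_two_eq_zero (hp : 3 < p) (hc : IsNormal lam c) (h1 : top c (1 : ℕ) 1 = 0)
    (h : ∀ j : ℕ, 2 ≤ j → j + 2 ≤ p → fall (lam + 1 - j) 2 ≠ 0) : top c (2 : ℕ) 1 = 0 := by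
  suffices ∀ m j : ℕ, 2 ≤ j → j + m + 1 = p → top c j 1 = 0 from
    this (p - 3) 2 le_rfl (by omega)
  intro m
  induction m with
  | zero => exact fun j _ hj => hc.top_of_gt (by omega)
  | succ m ih =>
    intro j hj hjm
    have := hc.top_rel hp (i := 1) (j := j) le_rfl (by omega) (by omega) (by omega)
    rw [h1, ih (1 + j) (by omega) (by omega), mul_zero, mul_zero, zero_sub, eq_comm, neg_eq_zero,
      mul_eq_zero] at this
    exact this.resolve_left (h j hj (by omega))

theorem top_two_eq_zero_of_six_le (hp : 3 < p) (hc : IsNormal lam c)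
    (h1 : top c (1 : ℕ) 1 = 0) {n : ℕ} (hn : 6 ≤ n) (hnp : n < p) (hlam : lam + 1 = n) :
    top c (2 : ℕ) 1 = 0 := by
  have e1 := hc.top_rel hp (i := 1) (j := 2) (by omega) (by omega) (by omega) (by omega)
  have e2 := hc.top_rel hp (i := 1) (j := 3) (by omega) (by omega) (by omega) (by omega)
  have e3 := hc.top_rel hp (i := 1) (j := 4) (by omega) (by omega) (by omega) (by omega)
  have e4 := hc.top_rel hp (i := 2) (j := 3) (by omega) (by omega) (by omega) (by omega)
  simp only [fall, Finset.prod_range_succ, Finset.prod_range_zero, hlam, h1, Nat.reduceAdd]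
    at e1 e2 e3 e4
  push_cast at e1 e2 e3 e4
  have hne : ∀ k : ℕ, k < 6 → (n : K) - k ≠ 0 := fun k hk => by
    rw [← Nat.cast_sub (by omega)]
    exact natCast_ne_zero p (by omega) (by omega)
  have : (∏ k ∈ Finset.range 6, ((n : K) - k)) * top c (2 : ℕ) 1 = 0 := by
    simp only [Finset.prod_range_succ, Finset.prod_range_zero]
    push_cast
    linear_combination (-6 : K) * e4 + 2 * e3 - ((n : K) - 4) * (n - 5) * e2
      + (((n : K) - 4) * (n - 5) * (n - 3) * (n - 4) + 6 * (n - 3) * (n - 4) * (n - 5)) * e1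
  exact (mul_eq_zero.1 this).resolve_left
    (Finset.prod_ne_zero_iff.2 fun k hk => hne k (Finset.mem_range.1 hk))

end IsNormal

/-- If `λ ≠ -1`, a cocycle can be normalised so that its top value at `e_1` vanishes. -/
theorem exists_isNormal_top_one (hp : 3 < p) (hlam : lam ^ p = lam) (h : lam + 1 ≠ 0)
    {c : ℤ → (Fin (p - 1) → K) →ₗ[K] (Fin p → K)}
    (hc : c ∈ cocycles K p (-1) (vermaRho K p 0 lam) (sRho K p)) :
    ∃ f, IsNormal lam (c - delta lam f) ∧ top (c - delta lam f) (1 : ℕ) 1 = 0 := by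
  obtain ⟨f, hf⟩ := exists_isNormal hp hc
  by_cases h1 : lam = 0
  · exact ⟨f, hf, hf.top_of_eq hp (by simp [h1])⟩
  · obtain ⟨f', hf', ht⟩ := hf.exists_top_one_eq_zero hp
      (by simpa using add_one_sub_natCast_pow hp hlam 0) h h1
    rw [sub_sub, ← delta_add] at hf' ht
    exact ⟨f + f', hf', ht⟩

theorem exists_eq_delta (hp : 3 < p) (hlam : lam ^ p = lam)
    (h : ¬(lam = 2 ∨ lam = 3 ∨ lam = 4 ∨ lam = (p : K) - 1))
    {c : ℤ → (Fin (p - 1) → K) →ₗ[K] (Fin p → K)}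
    (hc : c ∈ cocycles K p (-1) (vermaRho K p 0 lam) (sRho K p)) : ∃ f, delta lam f = c := by
  have hpK : (p : K) = 0 := CharP.cast_eq_zero K p
  rw [hpK, zero_sub] at h
  push Not at h
  obtain ⟨f, hf, h1⟩ := exists_isNormal_top_one hp hlam
    (fun e => h.2.2.2 (eq_neg_of_add_eq_zero_left e)) hc
  refine ⟨f, (sub_eq_zero.1 (hf.eq_zero_of_one_two hp h1 ?_)).symm⟩
  obtain ⟨n, hn, hnl⟩ := exists_natCast_eq hp (by simpa using add_one_sub_natCast_pow hp hlam 0)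
  have hl : lam = n - 1 := by linear_combination -hnl
  by_cases h6 : 6 ≤ n
  · exact hf.top_two_eq_zero_of_six_le hp h1 h6 hn hnl.symm
  interval_cases n
  · exact absurd (by rw [hl]; simp) h.2.2.2
  · refine hf.top_two_eq_zero hp h1 fun j hj hj' => ?_
    have e1 := natCast_ne_zero (K := K) p (n := j) (by omega) (by omega)
    have e2 := natCast_ne_zero (K := K) p (n := j - 1) (by omega) (by omega)
    rw [Nat.cast_sub (by omega), Nat.cast_one] at e2
    rw [← hnl]
    simp only [fall, Finset.prod_range_succ, Finset.prod_range_zero]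
    have : (1 : K) * (((1 : ℕ) : K) - j - (0 : ℕ)) * (((1 : ℕ) : K) - j - (1 : ℕ)) =
        (j - 1) * j := by
      push_cast; ring
    rw [this]
    exact mul_ne_zero e2 e1
  · exact hf.top_of_eq hp hnl.symm
  · exact absurd (by rw [hl]; norm_num) h.1
  · exact absurd (by rw [hl]; norm_num) h.2.1
  · exact absurd (by rw [hl]; norm_num) h.2.2.1

theorem top_delta (hp : 3 < p) {f : (Fin (p - 1) → K) →ₗ[K] (Fin p → K)}
    (hf : IsNormal lam (delta lam f)) :
    ∃ a : K, ∀ j : ℕ, 1 ≤ j → j + 2 ≤ p → top (delta lam f) j 1 = a * fall (lam + 1) (j + 1) := by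
  have hw : IsWeight (lam + 1) (coord K p (p - 1) ∘ₗ f) := fun x => by
    have := hf.top_zero x
    simp only [delta, LinearMap.sub_apply, LinearMap.comp_apply, map_sub,
      coord_top_vermaRho hp le_rfl, if_true] at this
    exact (sub_eq_zero.1 this).symm
  refine ⟨-coord K p (p - 1) (f 1), fun j hj hj' => ?_⟩
  have := hw.apply_sRho_one hp hj'
  rw [LinearMap.comp_apply, LinearMap.comp_apply] at this
  simp only [top_apply, delta, LinearMap.sub_apply, LinearMap.comp_apply, map_sub, this,
    coord_top_vermaRho hp (Int.natCast_nonneg j), Nat.cast_eq_zero, if_neg (show j ≠ 0 by omega)]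
  ring

theorem fall_neg_mul_factorial (a n : ℕ) :
    fall (-((a : K) + 1)) n * (a + 2).factorial
      = (-1) ^ n * (a + n).factorial * ((a + 1) * (a + 2)) := by
  have h : fall (-((a : K) + 1)) n = (-1) ^ n * (a + 1).ascFactorial n := by
    rw [fall, Nat.ascFactorial_eq_prod_range, Nat.cast_prod, ← Finset.card_range n,
      ← Finset.prod_const, Finset.card_range, ← Finset.prod_mul_distrib]
    refine Finset.prod_congr rfl fun t _ => ?_
    push_cast; ring
  rw [h, ← Nat.factorial_mul_ascFactorial a n, Nat.factorial_succ, Nat.factorial_succ]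
  push_cast; ring

/-- Generator of the extension space for `λ = -1`. -/
theorem exists_generator_neg_one (hp : 3 < p) (hlam : lam + 1 = 0) :
    ∃ z ∈ cocycles K p (-1) (vermaRho K p 0 lam) (sRho K p), (∀ f, delta lam f ≠ z) ∧
      ∀ c ∈ cocycles K p (-1) (vermaRho K p 0 lam) (sRho K p), ∃ (a : K) (f : _),
        delta lam f = c - a • z := by
  have hprime : p.Prime := (CharP.char_is_prime_or_zero K p).resolve_right (by omega)
  have : Fact p.Prime := ⟨hprime⟩
  have hlam' : lam = -1 := eq_neg_of_add_eq_zero_left hlam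
  have hodd : Odd p := hprime.odd_of_ne_two (by omega)
  have hfac : ∀ j, p < j + 2 → ((j + 1).factorial : K) = 0 := fun j hj =>
    (CharP.cast_eq_zero_iff K p _).2 (hprime.dvd_factorial.2 (by omega))
  obtain ⟨z, hz, hzn, hzt⟩ :=
    exists_normal_cocycle (lam := lam) hp (by rw [hlam', hodd.neg_one_pow])
    (fun j => if j = 0 then 0 else (-1) ^ j * ((j + 1).factorial : K)) (if_pos rfl)
    (fun j hj => by simp [hfac j hj])
    (fun j hj => by
      split_ifs with h
      · rfl
      · have := Nat.le_of_dvd (by omega) ((CharP.cast_eq_zero_iff K p j).1 (hj.symm.trans hlam))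
        rw [hfac j (by omega), mul_zero])
    (fun i j hi _ hj _ => by
      obtain ⟨i, rfl⟩ := Nat.exists_eq_add_of_le' hi
      obtain ⟨j, rfl⟩ := Nat.exists_eq_add_of_le' hj
      have h1 := fall_neg_mul_factorial (K := K) i (j + 1 + 1)
      have h2 := fall_neg_mul_factorial (K := K) j (i + 1 + 1)
      rw [if_neg (by omega), if_neg (by omega), if_neg (by omega), hlam, zero_sub, zero_sub,
        show i + 1 + (j + 1) + 1 = i + (j + 1 + 1) + 1 by omega, Nat.factorial_succ]
      rw [show j + (i + 1 + 1) = i + (j + 1 + 1) by omega] at h2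
      push_cast at h1 h2 ⊢
      linear_combination (-1 : K) ^ (j + 1) * h2 - (-1) ^ (i + 1) * h1)
  have hz1 : top z (1 : ℕ) 1 = -2 := by rw [hzt]; norm_num
  have h2 : (-2 : K) ≠ 0 := neg_ne_zero.2 (by
    exact_mod_cast natCast_ne_zero (K := K) p (n := 2) (by omega) (by omega))
  refine ⟨z, hz, fun f hf => ?_, fun c hc => ?_⟩
  · subst hf
    obtain ⟨a, ha⟩ := top_delta hp hzn
    have := ha 1 le_rfl (by omega)
    rw [hz1, hlam] at this
    exact h2 (by simpa [fall, Finset.prod_range_succ] using this)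
  · obtain ⟨f, hf⟩ := exists_isNormal hp hc
    have hw := hf.sub_smul hzn (top (c - delta lam f) (1 : ℕ) 1 / -2)
    have h1 : top (c - delta lam f - (top (c - delta lam f) (1 : ℕ) 1 / -2) • z) (1 : ℕ) 1 = 0 := by
      rw [top_sub_smul, hz1, div_mul_cancel₀ _ h2, sub_self]
    have := hw.eq_zero_of_one_two hp h1 (hw.top_two_eq_zero hp h1 fun j hj hj' => ?_)
    · rw [sub_right_comm, sub_eq_zero] at this
      exact ⟨_, f, this.symm⟩
    · have e1 := natCast_ne_zero (K := K) p (n := j) (by omega) (by omega)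
      have e2 := natCast_ne_zero (K := K) p (n := j + 1) (by omega) (by omega)
      have : fall (lam + 1 - j) 2 = (j : K) * (j + 1 : ℕ) := by
        simp only [fall, Finset.prod_range_succ, Finset.prod_range_zero, hlam]
        push_cast; ring
      rw [this]
      exact mul_ne_zero e1 e2

theorem fall_four_add (τ : K) (m : ℕ) :
    fall τ (4 + m) = τ * (τ - 1) * (τ - 2) * (τ - 3) * fall (τ - 4) m := by
  rw [fall, Finset.prod_range_add, fall]
  congr 1
  · simp [Finset.prod_range_succ]
  · refine Finset.prod_congr rfl fun t _ => ?_
    push_cast; ring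

/-- The top values of a normal cocycle of weight `ν ∈ {3, 4, 5}`. -/
def specialTop (ν : K) : ℕ → K
  | 2 => 1
  | 3 => -((ν - 2) * (ν - 3))
  | 4 => (ν - 2) * (ν - 3) ^ 2 * (ν - 4) / 2
  | _ => 0

theorem specialTop_rel (h2 : (2 : K) ≠ 0) {ν : K} (hν : (ν - 3) * (ν - 4) * (ν - 5) = 0) {i j : ℕ}
    (hi : 1 ≤ i) (hj : 1 ≤ j) :
    ((j : K) - i) * specialTop ν (i + j)
      = fall (ν - i) (j + 1) * specialTop ν i - fall (ν - j) (i + 1) * specialTop ν j := by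
  wlog hij : i < j generalizing i j
  · rcases eq_or_lt_of_le (not_lt.1 hij) with rfl | hlt
    · ring
    · have := this hj hi hlt
      rw [add_comm i j]
      linear_combination -this
  by_cases hj5 : 5 ≤ j
  · obtain ⟨j, rfl⟩ := Nat.exists_eq_add_of_le' hj5
    have e1 : specialTop ν (j + 5) = 0 := rfl
    have e2 : specialTop ν (i + (j + 5)) = 0 := rfl
    rw [e1, e2, show j + 5 + 1 = 4 + (j + 2) by omega, fall_four_add]
    by_cases hi5 : 5 ≤ i
    · obtain ⟨i, rfl⟩ := Nat.exists_eq_add_of_le' hi5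
      have e3 : specialTop ν (i + 5) = 0 := rfl
      rw [e3]; ring
    · interval_cases i
      · simp [specialTop]
      · simp only [specialTop]
        push_cast
        linear_combination -(ν - 2) * fall (ν - 2 - 4) (j + 2) * hν
      · simp only [specialTop]
        push_cast
        linear_combination (ν - 6) * (ν - 2) * (ν - 3) * fall (ν - 3 - 4) (j + 2) * hν
      · simp only [specialTop]
        push_cast
        linear_combination -(ν - 6) * (ν - 7) * (ν - 2) * (ν - 3) * (ν - 4) / 2
          * fall (ν - 4 - 4) (j + 2) * hν
  · have hj : j < 5 := not_le.1 hj5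
    interval_cases j <;> interval_cases i <;>
      simp only [specialTop, fall, Finset.prod_range_succ, Finset.prod_range_zero] <;> push_cast
    · ring
    · field_simp
      ring
    · linear_combination -(ν - 2) ^ 2 * hν
    · linear_combination (ν - 2) * (ν - 3) * (ν - 4) / 2 * hν
    · linear_combination ((ν - 6) * (ν - 2) * (ν - 3) * (ν - 4) / 2 - (ν - 2) * (ν - 6)) * hν
    · linear_combination ((ν - 6) * (ν - 7) * (ν - 2) * (ν - 3)
        + (ν - 6) * (ν - 7) * (ν - 2) * (ν - 3) * (ν - 4) / 2) * hν

/-- Generator of the extension space for `λ ∈ {2, 3, 4}`, `λ ≠ -1`. -/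
theorem exists_generator_special (hp : 3 < p) (hpow : lam ^ p = lam)
    (hlam : lam = 2 ∨ lam = 3 ∨ lam = 4)
    (h0 : lam + 1 ≠ 0) :
    ∃ z ∈ cocycles K p (-1) (vermaRho K p 0 lam) (sRho K p), (∀ f, delta lam f ≠ z) ∧
      ∀ c ∈ cocycles K p (-1) (vermaRho K p 0 lam) (sRho K p), ∃ (a : K) (f : _),
        delta lam f = c - a • z := by
  have hprime : p.Prime := (CharP.char_is_prime_or_zero K p).resolve_right (by omega)
  have h4 : p ≠ 4 := by rintro rfl; norm_num at hprime
  have h2 : (2 : K) ≠ 0 := by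
    exact_mod_cast natCast_ne_zero (K := K) p (n := 2) (by omega) (by omega)
  have h3 : (3 : K) ≠ 0 := by
    exact_mod_cast natCast_ne_zero (K := K) p (n := 3) (by omega) (by omega)
  have hν : (lam + 1 - 3) * (lam + 1 - 4) * (lam + 1 - 5) = 0 := by
    rcases hlam with rfl | rfl | rfl <;> ring
  have hne : lam ≠ 0 := by
    rcases hlam with rfl | rfl | rfl
    · exact h2
    · exact h3
    · rw [show (4 : K) = 2 * 2 by norm_num]
      exact mul_ne_zero h2 h2
  obtain ⟨z, hz, hzn, hzt⟩ := exists_normal_cocycle hp hpow (specialTop (lam + 1)) rfl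
    (fun j hj => by
      obtain ⟨j, rfl⟩ := Nat.exists_eq_add_of_le' (show 4 ≤ j by omega)
      rcases Nat.eq_zero_or_pos j with rfl | hj'
      · have hp5 : p = 5 := by omega
        subst hp5
        have h5 : (5 : K) = 0 := by exact_mod_cast CharP.cast_eq_zero K 5
        have : (lam + 1 - 3) * (lam + 1 - 4) = 0 := by
          rcases hlam with rfl | rfl | rfl
          · ring
          · ring
          · exact absurd (by linear_combination h5) h0
        simp only [specialTop]
        linear_combination (lam + 1 - 2) * (lam + 1 - 3) / 2 * this
      · obtain ⟨j, rfl⟩ := Nat.exists_eq_add_of_le' hj'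
        rfl)
    (fun j hj => by
      rcases j with _ | _ | _ | _ | _ | j
      · rfl
      · rfl
      · push_cast at hj
        rw [hj] at hν
        exact absurd (by linear_combination -hν) (mul_ne_zero h2 h3)
      · simp [specialTop, hj]
      · simp [specialTop, hj]
      · rfl)
    (fun i j hi _ hj _ => specialTop_rel h2 hν hi hj)
  have hz1 : top z (1 : ℕ) 1 = 0 := hzt 1
  have hz2 : top z (2 : ℕ) 1 = 1 := hzt 2
  refine ⟨z, hz, fun f hf => ?_, fun c hc => ?_⟩
  · subst hf
    obtain ⟨a, ha⟩ := top_delta hp hzn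
    have e1 := ha 1 le_rfl (by omega)
    have e2 := ha 2 (by omega) (by omega)
    rw [hz1] at e1
    rw [hz2] at e2
    simp only [fall, Finset.prod_range_succ, Finset.prod_range_zero] at e1 e2
    push_cast at e1 e2
    have ha0 : a = 0 := by
      have : a * ((lam + 1) * lam) = 0 := by linear_combination -e1
      exact (mul_eq_zero.1 this).resolve_right (mul_ne_zero h0 hne)
    rw [ha0, zero_mul] at e2
    exact one_ne_zero e2
  · obtain ⟨f, hf, h1⟩ := exists_isNormal_top_one hp hpow h0 hc
    have hw := hf.sub_smul hzn (top (c - delta lam f) (2 : ℕ) 1)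
    have := hw.eq_zero_of_one_two hp
      (by rw [top_sub_smul, h1, hz1]; ring) (by rw [top_sub_smul, hz2]; ring)
    rw [sub_right_comm, sub_eq_zero] at this
    exact ⟨_, f, this.symm⟩

end Classification

end WittExt

open scoped Classical in
/-- For `χ = 0` and `λ ∈ F_p`, in the category of restricted `W`-modules,
`Ext(S, V_0(λ)) ≅ K` if `λ ∈ {2, 3, 4, p-1}` and `Ext(S, V_0(λ)) = 0` otherwise. -/
theorem ext_S_verma
    (K : Type) [Field K] [IsAlgClosed K] (p : ℕ) [CharP K p] (hp : 3 < p)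
    (lam : K) (hlam : lam ^ p = lam) :
    Module.finrank K (extSpace K p (-1) (vermaRho K p 0 lam) (sRho K p))
      = if lam = 2 ∨ lam = 3 ∨ lam = 4 ∨ lam = (p : K) - 1 then 1 else 0 := by
  split_ifs with h
  · obtain ⟨z, hz, hz0, hgen⟩ : ∃ z ∈ cocycles K p (-1) (vermaRho K p 0 lam) (sRho K p),
        (∀ f, WittExt.delta lam f ≠ z) ∧
        ∀ c ∈ cocycles K p (-1) (vermaRho K p 0 lam) (sRho K p), ∃ (a : K) (f : _),
          WittExt.delta lam f = c - a • z := by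
      by_cases h0 : lam + 1 = 0
      · exact WittExt.exists_generator_neg_one hp h0
      · rw [CharP.cast_eq_zero, zero_sub] at h
        exact WittExt.exists_generator_special hp hlam
          (h.imp_right (Or.imp_right (Or.resolve_right · (h0 <| by simp [·])))) h0
    refine finrank_eq_one_iff'.2 ⟨Submodule.Quotient.mk ⟨z, hz⟩, fun h0 => ?_, fun w => ?_⟩
    · rw [Submodule.Quotient.mk_eq_zero, Submodule.mem_comap] at h0
      obtain ⟨f, hf⟩ := WittExt.mem_coboundaries_iff.1 h0
      exact hz0 f hf
    · obtain ⟨⟨c, hc⟩, rfl⟩ := Submodule.Quotient.mk_surjective _ w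
      obtain ⟨a, f, hf⟩ := hgen c hc
      refine ⟨a, ?_⟩
      rw [← Submodule.Quotient.mk_smul, eq_comm, Submodule.Quotient.eq, Submodule.mem_comap]
      exact WittExt.mem_coboundaries_iff.2 ⟨f, hf⟩
  · have : Subsingleton (extSpace K p (-1) (vermaRho K p 0 lam) (sRho K p)) := by
      refine Submodule.Quotient.subsingleton_iff.2 (eq_top_iff.2 fun c _ => ?_)
      rw [Submodule.mem_comap]
      exact WittExt.mem_coboundaries_iff.2 (WittExt.exists_eq_delta hp hlam h c.2)
    exact Module.finrank_zero_of_subsingleton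
end

section
/- Let χ = 0 and let K denote the one-dimensional trivial W-module. Then Ext(K, K) = 0 in the category of restricted W-modules; that is, every short exact sequence 0 → K → M → K → 0 of restricted W-modules splits. -/
/-!
Common setup: the Witt algebra `W` over `K` (char `p > 3`) has basis
`e_{-1}, e_0, ..., e_{p-2}` with `[e_i, e_j] = (j-i) e_{i+j}` (and `e_k = 0`
outside the range), and `p`-mapping `e_i^{[p]} = δ_{i0} e_i`.  A module with
`p`-character `χ` over `W` (resp. the subalgebra `W_0 = <e_0, ..., e_{p-2}>`)
is given by a family of endomorphisms `ρ k` (`k : ℤ`, vanishing outside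
`[lo, p-2]` where `lo = -1` for `W` and `lo = 0` for `W_0`) satisfying the
bracket relations and `(ρ i)^p - δ_{i0} ρ i = χ(e_i)^p • 1`.

The Baer Ext space `Ext(N, M)` of two such modules, in the category of
modules with `p`-character `χ`, is realized concretely: an extension
`0 → M → E → N → 0` admits a linear splitting `E ≃ M ⊕ N`, under which the
action of `e_k` is `(m, n) ↦ (ρM k m + c k n, ρN k n)` for a "cocycle"
`c : ℤ → (N →ₗ M)`; the conditions for `E` to be a module with `p`-character
`χ` are the cocycle conditions below, Baer equivalence corresponds to
differing by a coboundary, and the Baer sum / scalar action correspond to the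
linear structure on cocycles.  So `Ext(N, M) ≅ cocycles / coboundaries`.
-/

set_option maxHeartbeats 1000000
set_option synthInstance.maxHeartbeats 1000000

/-- The bracket relations for trivial coefficients: a cocycle kills all brackets. -/
theorem sub_smul_eq_zero_of_mem_cocycles_trivRho {K : Type} [Field K] {p : ℕ}
    {c : ℤ → K →ₗ[K] K} (hc : c ∈ cocycles K p (-1) (trivRho K) (trivRho K)) {i j : ℤ}
    (hi : -1 ≤ i ∧ i ≤ (p : ℤ) - 2) (hj : -1 ≤ j ∧ j ≤ (p : ℤ) - 2) :
    ((j - i : ℤ) : K) • c (i + j) = 0 := by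
  simp only [cocycles, Submodule.mem_inf, Submodule.mem_iInf, LinearMap.mem_ker] at hc
  have hij := hc.1.2 i j
  rw [bracketConstraint, if_pos ⟨hi.1, hi.2, hj.1, hj.2⟩] at hij
  have hcomp (f : K →ₗ[K] K) : LinearMap.lcomp K K (0 : K →ₗ[K] K) f = 0 :=
    LinearMap.comp_zero f
  simpa [trivRho, hcomp] using hij

/-- Every cocycle of the trivial module with coefficients in itself vanishes. -/
theorem eq_zero_of_mem_cocycles_trivRho {K : Type} [Field K] {p : ℕ} [CharP K p] (hp : 3 < p)
    {c : ℤ → K →ₗ[K] K} (hc : c ∈ cocycles K p (-1) (trivRho K) (trivRho K)) : c = 0 := by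
  funext k
  by_cases hk : k < -1 ∨ (p : ℤ) - 2 < k
  · simp only [cocycles, Submodule.mem_inf, Submodule.mem_iInf, LinearMap.mem_ker] at hc
    have hs := hc.1.1 k
    rwa [suppConstraint, if_pos hk] at hs
  · push Not at hk
    by_cases hk0 : k = 0
    · subst hk0
      have h := sub_smul_eq_zero_of_mem_cocycles_trivRho hc (i := -1) (j := 1)
        (by omega) (by omega)
      refine (smul_eq_zero.mp h).resolve_left fun h2 => ?_
      have := Int.le_of_dvd (by norm_num) ((CharP.intCast_eq_zero_iff K p _).mp h2)
      omega
    · have h := sub_smul_eq_zero_of_mem_cocycles_trivRho hc (i := 0) (j := k)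
        (by omega) hk
      rw [zero_add, sub_zero] at h
      refine (smul_eq_zero.mp h).resolve_left fun h2 => hk0 ?_
      refine Int.eq_zero_of_abs_lt_dvd ((CharP.intCast_eq_zero_iff K p _).mp h2) ?_
      rw [abs_lt]
      omega

/-- For `χ = 0`, `Ext(K, K) = 0` in the category of restricted `W`-modules: every
short exact sequence `0 → K → M → K → 0` of restricted `W`-modules splits
(every cocycle is a coboundary). -/
theorem ext_trivial_trivial_eq_zero
    (K : Type) [Field K] [IsAlgClosed K] (p : ℕ) [CharP K p] (hp : 3 < p)
    :
    cocycles K p (-1) (trivRho K) (trivRho K) ≤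
      coboundaries K p (-1) (trivRho K) (trivRho K) := by
  intro c hc
  rw [eq_zero_of_mem_cocycles_trivRho hp hc]
  exact Submodule.zero_mem _
end
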